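/- arXiv:2307.10662 — 2 statements merged into one kernel-verified Lean document; each statement's English description precedes it below -/
import Mathlib

section
/- Let Γ be a finitely generated virtually nilpotent group which is not virtually ℤ^d for any d ≤ 2 (so that every finitely supported symmetric admissible random walk on Γ is transient at the spectral radius), and let μ be a finitely supported symmetric admissible probability measure on Γ. Then the function r ↦ ω_Γ(r) is left-continuous at 1: lim_{r↑1} ω_Γ(r) = ω_Γ(1) = 0. -/
open scoped Pointwise Classical
open Filter

namespace GreenGrowth

variable {G : Type*} [Group G]

/-- Word length with respect to a finite generating set `S` (symmetrized). -/
noncomputable def wordLength (S : Finset G) (x : G) : ℕ :=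
  sInf {n : ℕ | x ∈ ((S : Set G) ∪ (S : Set G)⁻¹) ^ n}

/-- `n`-step distribution of the `μ`-random walk: the `n`-fold convolution power of `μ`,
so that `p_n(x, y) = convPow μ n (x⁻¹ * y)`. -/
noncomputable def convPow (μ : G → ℝ) : ℕ → G → ℝ
  | 0 => fun x => if x = 1 then 1 else 0
  | n + 1 => fun x => ∑' y : G, μ y * convPow μ n (y⁻¹ * x)

/-- The Green function `G(e, x | r)`. -/
noncomputable def green (μ : G → ℝ) (r : ℝ) (x : G) : ℝ :=
  ∑' n : ℕ, r ^ n * convPow μ n x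

/-- `μ` is a probability measure on `G`. -/
def IsProbMeasure (μ : G → ℝ) : Prop := (∀ x, 0 ≤ μ x) ∧ HasSum μ 1

/-- `μ` is admissible: its support generates `G` as a semigroup, i.e. every element of `G`
is reached with positive probability at some time. -/
def IsAdmissible (μ : G → ℝ) : Prop := ∀ x : G, ∃ n : ℕ, 0 < convPow μ n x

/-- `μ` is symmetric. -/
def IsSymm (μ : G → ℝ) : Prop := ∀ x : G, μ x⁻¹ = μ x

/-- The spectral radius of the `μ`-random walk. -/
noncomputable def spectralRadius (μ : G → ℝ) : ℝ :=
  limsup (fun n : ℕ => (convPow μ n 1) ^ ((n : ℝ)⁻¹)) atTop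

/-- `R`, the radius of convergence of the Green function: the inverse of the
spectral radius. -/
noncomputable def greenRadius (μ : G → ℝ) : ℝ := (spectralRadius μ)⁻¹

/-- The `μ`-random walk is transient at the spectral radius: the Green function
`G(x, y | r)` is finite for all `x, y` and all `0 < r ≤ R`. -/
def TransientAtSpectralRadius (μ : G → ℝ) : Prop :=
  ∀ r : ℝ, 0 < r → r ≤ greenRadius μ →
    ∀ x : G, Summable (fun n : ℕ => r ^ n * convPow μ n x)

/-- `H_r(n) = Σ_{x ∈ S_n} G(e, x | r)`, the sum of the Green function over the sphere
of radius `n`. -/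
noncomputable def greenSphereSum (S : Finset G) (μ : G → ℝ) (r : ℝ) (n : ℕ) : ℝ :=
  ∑' x : G, if wordLength S x = n then green μ r x else 0

/-- `ω_Γ(r) = limsup (1/n) log H_r(n)`, the growth rate of the Green function. -/
noncomputable def greenGrowthRate (S : Finset G) (μ : G → ℝ) (r : ℝ) : ℝ :=
  limsup (fun n : ℕ => Real.log (greenSphereSum S μ r n) / n) atTop

/-- The cardinality of the sphere of radius `n`. -/
noncomputable def sphereCard (S : Finset G) (n : ℕ) : ℕ :=
  Nat.card {x : G // wordLength S x = n}

/-- The volume growth rate `v = limsup (1/n) log #S_n`. -/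
noncomputable def volumeGrowthRate (S : Finset G) : ℝ :=
  limsup (fun n : ℕ => Real.log (sphereCard S n) / n) atTop

end GreenGrowth

namespace GreenGrowth

/-- `G` is not virtually `ℤ^d` for any `d ≤ 2`. -/
def NotVirtuallyLowZd (G : Type*) [Group G] : Prop :=
  ¬ ∃ (H : Subgroup G) (d : ℕ), d ≤ 2 ∧ H.FiniteIndex ∧
      Nonempty (H ≃* Multiplicative (Fin d → ℤ))


section FixedPoint

variable {E : Type*} [AddCommGroup E] [Module ℝ E] [UniformSpace E] [IsUniformAddGroup E]
  [ContinuousSMul ℝ E] [T2Space E]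

/-- A continuous linear map preserving a nonempty compact convex set has a fixed point in it. -/
theorem exists_fixedPoint_of_mapsTo (T : E →L[ℝ] E) {C : Set E} (hC : IsCompact C)
    (hconv : Convex ℝ C) (hne : C.Nonempty) (hT : Set.MapsTo T C C) :
    ∃ x ∈ C, T x = x := by
  obtain ⟨x₀, hx₀⟩ := hne
  have hiter : ∀ k : ℕ, (T^[k]) x₀ ∈ C := fun k => hT.iterate k hx₀
  set u : ℕ → E := fun n => ∑ k ∈ Finset.range (n + 1), ((n : ℝ) + 1)⁻¹ • (T^[k]) x₀ with hu
  have huC : ∀ n, u n ∈ C := by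
    intro n
    refine hconv.sum_mem (fun _ _ => by positivity) ?_ (fun k _ => hiter k)
    rw [Finset.sum_const, Finset.card_range, nsmul_eq_mul]
    push_cast
    field_simp
  have hdiff : ∀ n, T (u n) - u n = ((n : ℝ) + 1)⁻¹ • ((T^[n + 1]) x₀ - x₀) := by
    intro n
    simp only [hu, map_sum, map_smul, ← Finset.sum_sub_distrib, ← smul_sub, ← Finset.smul_sum]
    congr 1
    have := Finset.sum_range_sub (fun k => (T^[k]) x₀) (n + 1)
    simpa only [Function.iterate_succ_apply', Function.iterate_zero, id] using this
  have hbdd : Bornology.IsVonNBounded ℝ (C - C) := by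
    have : IsCompact (C - C) := by
      rw [← Set.image2_sub, ← Set.image_prod]
      exact (hC.prod hC).image continuous_sub
    exact this.totallyBounded.isVonNBounded ℝ
  have hlim : Tendsto (fun n => T (u n) - u n) atTop (nhds 0) := by
    simp only [hdiff]
    refine hbdd.smul_tendsto_zero (ε := fun n : ℕ => ((n : ℝ) + 1)⁻¹)
      (x := fun n => (T^[n + 1]) x₀ - x₀)
      (Eventually.of_forall fun n => Set.sub_mem_sub (hiter _) hx₀) ?_
    simpa [one_div] using tendsto_one_div_add_atTop_nhds_zero_nat (𝕜 := ℝ)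
  obtain ⟨x, hxC, hx⟩ := hC.exists_mapClusterPt (f := atTop) (u := u)
    (tendsto_principal.2 (Eventually.of_forall huC))
  obtain ⟨U, hU, hUx⟩ := mapClusterPt_iff_ultrafilter.1 hx
  have h1 : Tendsto (fun n => T (u n) - u n) U (nhds (T x - x)) :=
    ((T.continuous.tendsto x).comp hUx).sub hUx
  exact ⟨x, hxC, sub_eq_zero.1 (tendsto_nhds_unique h1 (hlim.mono_left hU))⟩

/-- The Markov–Kakutani fixed point theorem for continuous linear maps which commute on a
compact convex set. -/
theorem exists_common_fixedPoint_of_commute {ι : Type*} (T : ι → E →L[ℝ] E) {C : Set E}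
    (hC : IsCompact C) (hconv : Convex ℝ C) (hne : C.Nonempty)
    (hT : ∀ i, Set.MapsTo (T i) C C)
    (hcomm : ∀ i j, ∀ x ∈ C, T i (T j x) = T j (T i x)) :
    ∃ x ∈ C, ∀ i, T i x = x := by
  have hclosed : ∀ i, IsClosed {x | T i x = x} := fun i =>
    isClosed_eq (T i).continuous continuous_id
  have hfinite : ∀ s : Finset ι, (C ∩ ⋂ i ∈ s, {x | T i x = x}).Nonempty := by
    intro s
    induction s using Finset.induction_on with
    | empty => simpa using hne
    | insert j s _ ih =>
      have hconv' : Convex ℝ (C ∩ ⋂ i ∈ s, {x | T i x = x}) := by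
        refine hconv.inter (convex_iInter₂ fun i _ => ?_)
        intro x hx y hy a b _ _ _
        simp only [Set.mem_ofPred_eq] at hx hy ⊢
        simp [hx, hy]
      have hmaps : Set.MapsTo (T j) (C ∩ ⋂ i ∈ s, {x | T i x = x})
          (C ∩ ⋂ i ∈ s, {x | T i x = x}) := by
        intro x hx
        refine ⟨hT j hx.1, ?_⟩
        have h2 := hx.2
        simp only [Set.mem_iInter, Set.mem_ofPred_eq] at h2 ⊢
        intro i hi
        rw [hcomm i j x hx.1, h2 i hi]
      obtain ⟨x, hx, hxj⟩ := exists_fixedPoint_of_mapsTo (T j)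
        (hC.inter_right (isClosed_biInter fun i _ => hclosed i)) hconv' ih hmaps
      refine ⟨x, hx.1, ?_⟩
      have h2 := hx.2
      simp only [Set.mem_iInter, Set.mem_ofPred_eq, Finset.mem_insert] at h2 ⊢
      rintro i (rfl | hi)
      exacts [hxj, h2 i hi]
  obtain ⟨x, hxC, hx⟩ := hC.inter_iInter_nonempty (fun i => {x | T i x = x}) hclosed hfinite
  exact ⟨x, hxC, fun i => Set.mem_iInter.1 hx i⟩

end FixedPoint

/-- The linear action of `b` by normalized left translation on real functions on a group. -/
def normalizedTranslate {G : Type*} [Group G] (b : G) : (G → ℝ) →L[ℝ] (G → ℝ) where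
  toFun L x := L (b * x) - L b
  map_add' L L' := by ext x; simp only [Pi.add_apply]; ring
  map_smul' c L := by ext x; simp only [Pi.smul_apply, smul_eq_mul, RingHom.id_apply]; ring
  cont := by fun_prop

theorem normalizedTranslate_apply {G : Type*} [Group G] (b : G) (L : G → ℝ) (x : G) :
    normalizedTranslate b L x = L (b * x) - L b := rfl

theorem normalizedTranslate_mul {G : Type*} [Group G] (b c : G) (L : G → ℝ) :
    normalizedTranslate (b * c) L = normalizedTranslate c (normalizedTranslate b L) := by
  ext x
  simp only [normalizedTranslate_apply, mul_assoc]
  ring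

/-- A nilpotent normal subgroup acting by normalized translations on a compact convex set of
functions vanishing at `1` has a fixed point. -/
theorem exists_normalizedTranslate_fixedPoint {G : Type*} [Group G] {N : Subgroup G} [N.Normal]
    {c : ℕ} (hN : N.lowerCentralSeries c = ⊥) {C : Set (G → ℝ)} (hC : IsCompact C)
    (hconv : Convex ℝ C) (hne : C.Nonempty) (hone : ∀ L ∈ C, L 1 = 0)
    (hmaps : ∀ b ∈ N, Set.MapsTo (normalizedTranslate b) C C) :
    ∃ L ∈ C, ∀ b ∈ N, normalizedTranslate b L = L := by
  suffices key : ∀ n, (∃ L ∈ C, ∀ b ∈ N.lowerCentralSeries n, normalizedTranslate b L = L) →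
      ∃ L ∈ C, ∀ b ∈ N.lowerCentralSeries 0, normalizedTranslate b L = L by
    refine key c ?_
    obtain ⟨L, hL⟩ := hne
    refine ⟨L, hL, fun b hb => ?_⟩
    rw [hN, Subgroup.mem_bot] at hb
    subst hb
    ext x
    simp [normalizedTranslate_apply, hone L hL]
  intro n
  induction n with
  | zero => exact id
  | succ n ih =>
    rintro ⟨L₀, hL₀, hfix₀⟩
    apply ih
    set D := C ∩ {L | ∀ b ∈ N.lowerCentralSeries (n + 1), normalizedTranslate b L = L} with hD
    have hclosed : IsClosed
        {L : G → ℝ | ∀ b ∈ N.lowerCentralSeries (n + 1), normalizedTranslate b L = L} := by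
      simp only [Set.ofPred_forall]
      exact isClosed_biInter fun b _ =>
        isClosed_eq (normalizedTranslate b).continuous continuous_id
    have hDconv : Convex ℝ D := by
      refine hconv.inter ?_
      intro x hx y hy s t _ _ _ b hb
      rw [map_add, map_smul, map_smul, hx b hb, hy b hb]
    have hDmaps : ∀ b : N.lowerCentralSeries n,
        Set.MapsTo (normalizedTranslate (b : G)) D D := by
      intro b L hL
      refine ⟨hmaps b (N.lowerCentralSeries_le_self n b.2) hL.1, fun d hd => ?_⟩
      have hd' : (b : G) * d * (b : G)⁻¹ ∈ N.lowerCentralSeries (n + 1) :=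
        (Subgroup.lowerCentralSeries_normal N (n + 1)).conj_mem d hd b
      rw [← normalizedTranslate_mul]
      have h : (b : G) * d = (b * d * (b : G)⁻¹) * b := by group
      rw [h, normalizedTranslate_mul, hL.2 _ hd']
    have hDcomm : ∀ b b' : N.lowerCentralSeries n, ∀ L ∈ D,
        normalizedTranslate (b : G) (normalizedTranslate (b' : G) L) =
          normalizedTranslate (b' : G) (normalizedTranslate (b : G) L) := by
      intro b b' L hL
      have hcomm : (b * b' * (b : G)⁻¹ * (b' : G)⁻¹ : G) ∈ N.lowerCentralSeries (n + 1) :=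
        Subgroup.commutator_mem_commutator b.2 (N.lowerCentralSeries_le_self n b'.2)
      rw [← normalizedTranslate_mul, ← normalizedTranslate_mul]
      have h : (b : G) * b' = (b * b' * (b : G)⁻¹ * (b' : G)⁻¹ : G) * (b' * b) := by
        group
      rw [h, normalizedTranslate_mul (b * b' * (b : G)⁻¹ * (b' : G)⁻¹ : G), hL.2 _ hcomm]
    obtain ⟨L, hL, hfix⟩ := exists_common_fixedPoint_of_commute
      (fun b : N.lowerCentralSeries n => normalizedTranslate (b : G))
      (hC.inter_right hclosed) hDconv ⟨L₀, hL₀, hfix₀⟩ hDmaps hDcomm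
    exact ⟨L, hL.1, fun b hb => hfix ⟨b, hb⟩⟩

/-- `μ` is a symmetric admissible probability measure with finite support `F`. -/
structure IsFiniteRangeWalk {G : Type*} [Group G] (μ : G → ℝ) (F : Finset G) : Prop where
  pos : ∀ g ∈ F, 0 < μ g
  eq_zero : ∀ g, g ∉ F → μ g = 0
  sum_eq : ∑ g ∈ F, μ g = 1
  symm : ∀ g, μ g⁻¹ = μ g
  admissible : IsAdmissible μ

/-- `h` is harmonic for the random walk with step distribution `μ` supported on `F`. -/
def IsHarmonic {G : Type*} [Group G] (μ : G → ℝ) (F : Finset G) (h : G → ℝ) : Prop :=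
  ∀ x, ∑ g ∈ F, μ g * h (x * g) = h x

/-- The set of nonnegative harmonic functions normalized at the identity. -/
def normalizedHarmonic {G : Type*} [Group G] (μ : G → ℝ) (F : Finset G) : Set (G → ℝ) :=
  {h | (∀ x, 0 ≤ h x) ∧ h 1 = 1 ∧ IsHarmonic μ F h}

namespace IsFiniteRangeWalk

variable {G : Type*} [Group G] {μ : G → ℝ} {F : Finset G}

theorem nonneg (w : IsFiniteRangeWalk μ F) (g : G) : 0 ≤ μ g := by
  by_cases hg : g ∈ F
  · exact (w.pos g hg).le
  · exact (w.eq_zero g hg).ge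

theorem inv_mem (w : IsFiniteRangeWalk μ F) {g : G} (hg : g ∈ F) : g⁻¹ ∈ F := by
  by_contra h
  have h1 := w.pos g hg
  rw [← w.symm, w.eq_zero _ h] at h1
  exact lt_irrefl _ h1

theorem convPow_succ (w : IsFiniteRangeWalk μ F) (n : ℕ) (x : G) :
    convPow μ (n + 1) x = ∑ g ∈ F, μ g * convPow μ n (g⁻¹ * x) := by
  rw [convPow]
  exact tsum_eq_sum fun g hg => by rw [w.eq_zero g hg, zero_mul]

theorem convPow_nonneg (w : IsFiniteRangeWalk μ F) (n : ℕ) (x : G) : 0 ≤ convPow μ n x := by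
  induction n generalizing x with
  | zero => simp only [convPow]; split_ifs <;> norm_num
  | succ n ih =>
    rw [w.convPow_succ]
    exact Finset.sum_nonneg fun g _ => mul_nonneg (w.nonneg g) (ih _)

/-- A property of group elements holding at `1` and stable under left multiplication by the
steps of the walk holds everywhere. -/
theorem induction (w : IsFiniteRangeWalk μ F) {P : G → Prop} (one : P 1)
    (step : ∀ s ∈ F, ∀ g, P g → P (s * g)) (g : G) : P g := by
  obtain ⟨n, hn⟩ := w.admissible g
  induction n generalizing g with
  | zero =>
    have : g = 1 := by
      by_contra h
      simp [convPow, h] at hn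
    exact this ▸ one
  | succ n ih =>
    rw [w.convPow_succ] at hn
    obtain ⟨s, hs, hpos⟩ := Finset.exists_lt_of_sum_lt
      (s := F) (f := fun _ => (0 : ℝ)) (by simpa using hn)
    have hpos' : 0 < convPow μ n (s⁻¹ * g) := by
      by_contra h
      have h0 : convPow μ n (s⁻¹ * g) = 0 := le_antisymm (not_lt.1 h) (w.convPow_nonneg _ _)
      simp [h0] at hpos
    simpa using step s hs _ (ih _ hpos')

/-- The Harnack inequality. -/
theorem harnack (w : IsFiniteRangeWalk μ F) (g : G) :
    ∃ C : ℝ, 0 < C ∧ ∀ h : G → ℝ, (∀ x, ∀ s ∈ F, μ s * h (x * s) ≤ 2 * h x) →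
      ∀ x, h (x * g) ≤ C * h x := by
  induction g using w.induction with
  | one => exact ⟨1, one_pos, fun h _ x => by simp⟩
  | step s hs g ih =>
    obtain ⟨C, hC, ih⟩ := ih
    have hμ := w.pos s hs
    refine ⟨C * (2 / μ s), by positivity, fun h hh x => ?_⟩
    calc h (x * (s * g)) = h (x * s * g) := by rw [mul_assoc]
      _ ≤ C * h (x * s) := ih h hh _
      _ ≤ C * (2 / μ s * h x) := by
        refine mul_le_mul_of_nonneg_left ?_ hC.le
        rw [div_mul_eq_mul_div, le_div_iff₀ hμ, mul_comm]
        exact hh x s hs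
      _ = C * (2 / μ s) * h x := by ring

theorem step_le_of_superharmonic (w : IsFiniteRangeWalk μ F) {h : G → ℝ} (h0 : ∀ x, 0 ≤ h x)
    (hh : ∀ x, ∑ g ∈ F, μ g * h (x * g) ≤ h x) (x s : G) (hs : s ∈ F) :
    μ s * h (x * s) ≤ 2 * h x := by
  have h1 : μ s * h (x * s) ≤ ∑ g ∈ F, μ g * h (x * g) :=
    Finset.single_le_sum (f := fun g => μ g * h (x * g))
      (fun g _ => mul_nonneg (w.nonneg g) (h0 _)) hs
  linarith [hh x, h0 x]

/-- The strong minimum principle. -/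
theorem eq_zero_of_harmonic (w : IsFiniteRangeWalk μ F) {u : G → ℝ} (h0 : ∀ x, 0 ≤ u x)
    (hu : IsHarmonic μ F u) (h1 : u 1 = 0) (x : G) : u x = 0 := by
  obtain ⟨C, _, hC⟩ := w.harnack x
  have := hC u (w.step_le_of_superharmonic h0 fun x => (hu x).le) 1
  rw [one_mul, h1, mul_zero] at this
  exact le_antisymm this (h0 x)

theorem const_mem_normalizedHarmonic (w : IsFiniteRangeWalk μ F) :
    (fun _ => 1) ∈ normalizedHarmonic μ F :=
  ⟨fun _ => zero_le_one, rfl, fun _ => by simpa using w.sum_eq⟩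

theorem pos_of_mem_normalizedHarmonic (w : IsFiniteRangeWalk μ F) {h : G → ℝ}
    (hh : h ∈ normalizedHarmonic μ F) (x : G) : 0 < h x := by
  obtain ⟨C, hC0, hC⟩ := w.harnack x⁻¹
  have := hC h (w.step_le_of_superharmonic hh.1 fun x => (hh.2.2 x).le) x
  rw [mul_inv_cancel, hh.2.1] at this
  exact pos_of_mul_pos_right (lt_of_lt_of_le one_pos this) hC0.le

theorem translate_mem_normalizedHarmonic (w : IsFiniteRangeWalk μ F) {h : G → ℝ}
    (hh : h ∈ normalizedHarmonic μ F) (x : G) :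
    (fun y => h (x * y) / h x) ∈ normalizedHarmonic μ F := by
  have hx := w.pos_of_mem_normalizedHarmonic hh x
  refine ⟨fun y => div_nonneg (hh.1 _) hx.le, by simp [hx.ne'], fun y => ?_⟩
  simp only [← mul_div_assoc, ← Finset.sum_div, ← mul_assoc]
  rw [hh.2.2]

theorem isCompact_normalizedHarmonic (w : IsFiniteRangeWalk μ F) :
    IsCompact (normalizedHarmonic μ F) := by
  choose C _ hC using w.harnack
  refine (isCompact_univ_pi fun g => isCompact_Icc (a := 0) (b := C g)).of_isClosed_subset ?_ ?_
  · simp only [normalizedHarmonic, IsHarmonic, Set.ofPred_and, Set.ofPred_forall]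
    refine (isClosed_iInter fun x => ?_).inter (IsClosed.inter ?_ (isClosed_iInter fun x => ?_))
    · exact isClosed_le continuous_const (continuous_apply x)
    · exact isClosed_eq (continuous_apply 1) continuous_const
    · exact isClosed_eq (by fun_prop) (continuous_apply x)
  · intro h hh g _
    have := hC g h (w.step_le_of_superharmonic hh.1 fun x => (hh.2.2 x).le) 1
    rw [one_mul, hh.2.1, mul_one] at this
    exact ⟨hh.1 g, this⟩

end IsFiniteRangeWalk

namespace IsFiniteRangeWalk

variable {G : Type*} [Group G] {μ : G → ℝ} {F : Finset G}

/-- A positive superharmonic function which is multiplicative along a normal subgroup of finite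
index is constant; `L` is its logarithm. -/
theorem eq_zero_of_superharmonic_of_additive (w : IsFiniteRangeWalk μ F) {N : Subgroup G}
    [N.Normal] [N.FiniteIndex] {L : G → ℝ} (h1 : L 1 = 0)
    (hN : ∀ b ∈ N, ∀ x, L (b * x) = L b + L x)
    (hL : ∀ x, ∑ g ∈ F, μ g * Real.exp (L (x * g) - L x) ≤ 1) (x : G) : L x = 0 := by
  have : Fintype (G ⧸ N) := Fintype.ofFinite _
  set Φ : G ⧸ N → G → ℝ := fun q g => Real.exp (L (q.out * g) - L q.out) with hΦ
  have hΦmk : ∀ x g : G, Φ (x : G ⧸ N) g = Real.exp (L (x * g) - L x) := by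
    intro x g
    obtain ⟨b, hb⟩ := QuotientGroup.mk_out_eq_mul N x
    have hc : x * b * x⁻¹ ∈ N := Subgroup.Normal.conj_mem ‹_› _ b.2 x
    have hout : (x : G ⧸ N).out = (x * b * x⁻¹) * x := by rw [hb]; group
    simp only [hΦ]
    rw [hout, mul_assoc, hN _ hc, hN _ hc]
    congr 1
    ring
  have hΦpos : ∀ q g, 0 < Φ q g := fun q g => Real.exp_pos _
  have hΦinv : ∀ (q : G ⧸ N) (g : G), Φ (q * (g : G ⧸ N)) g⁻¹ = (Φ q g)⁻¹ := by
    intro q g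
    have h : q * (g : G ⧸ N) = ((q.out * g : G) : G ⧸ N) := by
      rw [QuotientGroup.mk_mul, QuotientGroup.out_eq']
    rw [h, hΦmk, mul_inv_cancel_right, ← Real.exp_neg, neg_sub]
  have hsum : ∑ q : G ⧸ N, ∑ g ∈ F, μ g * Φ q g ≤ Fintype.card (G ⧸ N) := by
    calc ∑ q : G ⧸ N, ∑ g ∈ F, μ g * Φ q g ≤ ∑ _q : G ⧸ N, (1 : ℝ) :=
          Finset.sum_le_sum fun q _ => hL q.out
      _ = _ := by simp
  have hsum_inv : ∑ q : G ⧸ N, ∑ g ∈ F, μ g * (Φ q g)⁻¹ =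
      ∑ q : G ⧸ N, ∑ g ∈ F, μ g * Φ q g := by
    rw [Finset.sum_comm, Finset.sum_comm (s := Finset.univ) (t := F)]
    refine Finset.sum_nbij' (fun g => g⁻¹) (fun g => g⁻¹) (fun g hg => w.inv_mem hg)
      (fun g hg => w.inv_mem hg) (fun _ _ => inv_inv _) (fun _ _ => inv_inv _) fun g _ => ?_
    rw [w.symm, ← Equiv.sum_comp (Equiv.mulRight (g : G ⧸ N)) (fun q => μ g * Φ q g⁻¹)]
    exact Finset.sum_congr rfl fun q _ => by rw [Equiv.coe_mulRight, hΦinv]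
  have hterm : ∀ q g, 0 ≤ μ g * (Φ q g + (Φ q g)⁻¹ - 2) := by
    intro q g
    refine mul_nonneg (w.nonneg g) ?_
    have h := hΦpos q g
    have : Φ q g + (Φ q g)⁻¹ - 2 = (Φ q g - 1) ^ 2 * (Φ q g)⁻¹ := by field_simp; ring
    rw [this]
    positivity
  have hzero : ∑ q : G ⧸ N, ∑ g ∈ F, μ g * (Φ q g + (Φ q g)⁻¹ - 2) = 0 := by
    refine le_antisymm ?_ (Finset.sum_nonneg fun q _ => Finset.sum_nonneg fun g _ => hterm q g)
    have : ∑ q : G ⧸ N, ∑ g ∈ F, μ g * (Φ q g + (Φ q g)⁻¹ - 2) =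
        ∑ q : G ⧸ N, ∑ g ∈ F, μ g * Φ q g + ∑ q : G ⧸ N, ∑ g ∈ F, μ g * (Φ q g)⁻¹
          - ∑ _q : G ⧸ N, ∑ g ∈ F, μ g * 2 := by
      simp only [mul_add, mul_sub, Finset.sum_add_distrib, Finset.sum_sub_distrib]
    rw [this, hsum_inv]
    have : ∑ _q : G ⧸ N, ∑ g ∈ F, μ g * 2 = 2 * Fintype.card (G ⧸ N) := by
      rw [← Finset.sum_mul, w.sum_eq]
      simp [mul_comm]
    rw [this]
    linarith
  have hstep : ∀ g ∈ F, ∀ x, L (x * g) = L x := by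
    intro g hg x
    have h1 := (Finset.sum_eq_zero_iff_of_nonneg fun q _ =>
      Finset.sum_nonneg fun g _ => hterm q g).1 hzero (x : G ⧸ N) (Finset.mem_univ _)
    have h2 := (Finset.sum_eq_zero_iff_of_nonneg fun g _ => hterm _ g).1 h1 g hg
    have h3 := (mul_eq_zero.1 h2).resolve_left (w.pos g hg).ne'
    have hp := hΦpos (x : G ⧸ N) g
    have h4 : (Φ (x : G ⧸ N) g - 1) ^ 2 = 0 := by
      field_simp at h3
      linarith
    have h5 : Φ (x : G ⧸ N) g = 1 := sub_eq_zero.1 (pow_eq_zero_iff two_ne_zero |>.1 h4)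
    rw [hΦmk, Real.exp_eq_one_iff] at h5
    exact sub_eq_zero.1 h5
  have hall : ∀ y, L (y * x) = L y := by
    induction x using w.induction with
    | one => simp
    | step s hs g ih => exact fun y => by rw [← mul_assoc, ih, hstep s hs]
  simpa [h1] using hall 1

/-- Logarithms of positive superharmonic functions which are left invariant under `A` and
multiplied by `exp m` under left translation by `z`. -/
def logSuperharmonic (μ : G → ℝ) (F : Finset G) (A : Subgroup G) (z : G) (m : ℝ) :
    Set (G → ℝ) :=
  {L | L 1 = 0 ∧ (∀ x, ∑ g ∈ F, μ g * Real.exp (L (x * g) - L x) ≤ 1) ∧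
    (∀ a ∈ A, ∀ x, L (a * x) = L x) ∧ ∀ x, L (z * x) = m + L x}

theorem convex_logSuperharmonic (w : IsFiniteRangeWalk μ F) (A : Subgroup G) (z : G) (m : ℝ) :
    Convex ℝ (logSuperharmonic μ F A z m) := by
  rintro L ⟨h1, h2, h3, h4⟩ L' ⟨h1', h2', h3', h4'⟩ a b ha hb hab
  refine ⟨by simp [h1, h1'], fun x => ?_, fun c hc x => ?_, fun x => ?_⟩
  · calc ∑ g ∈ F, μ g * Real.exp ((a • L + b • L') (x * g) - (a • L + b • L') x)
        ≤ ∑ g ∈ F, (a * (μ g * Real.exp (L (x * g) - L x)) +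
            b * (μ g * Real.exp (L' (x * g) - L' x))) := by
          refine Finset.sum_le_sum fun g _ => ?_
          have h := convexOn_exp.2 (Set.mem_univ (L (x * g) - L x))
            (Set.mem_univ (L' (x * g) - L' x)) ha hb hab
          simp only [smul_eq_mul] at h
          have he : (a • L + b • L') (x * g) - (a • L + b • L') x =
              a * (L (x * g) - L x) + b * (L' (x * g) - L' x) := by
            simp only [Pi.add_apply, Pi.smul_apply, smul_eq_mul]; ring
          rw [he]
          calc _ ≤ μ g * _ := mul_le_mul_of_nonneg_left h (w.nonneg g)
            _ = _ := by ring
      _ = a * ∑ g ∈ F, μ g * Real.exp (L (x * g) - L x) +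
            b * ∑ g ∈ F, μ g * Real.exp (L' (x * g) - L' x) := by
          rw [Finset.sum_add_distrib, Finset.mul_sum, Finset.mul_sum]
      _ ≤ a * 1 + b * 1 := by gcongr <;> [exact h2 x; exact h2' x]
      _ = 1 := by linarith
  · simp [h3 c hc, h3' c hc]
  · simp only [Pi.add_apply, Pi.smul_apply, smul_eq_mul, h4, h4']
    linear_combination m * hab

theorem isCompact_logSuperharmonic (w : IsFiniteRangeWalk μ F) (A : Subgroup G) (z : G) (m : ℝ) :
    IsCompact (logSuperharmonic μ F A z m) := by
  choose C hC0 hC using w.harnack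
  refine (isCompact_univ_pi fun g =>
    isCompact_Icc (a := -Real.log (C g⁻¹)) (b := Real.log (C g))).of_isClosed_subset ?_ ?_
  · simp only [logSuperharmonic, Set.ofPred_and, Set.ofPred_forall]
    refine IsClosed.inter ?_ ((isClosed_iInter fun x => ?_).inter
      ((isClosed_iInter fun a => isClosed_iInter fun _ => isClosed_iInter fun x => ?_).inter
        (isClosed_iInter fun x => ?_)))
    · exact isClosed_eq (continuous_apply 1) continuous_const
    · exact isClosed_le (by fun_prop) continuous_const
    · exact isClosed_eq (continuous_apply _) (continuous_apply x)
    · exact isClosed_eq (continuous_apply _) (by fun_prop)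
  · rintro L ⟨h1, h2, -, -⟩ g _
    have hsuper : ∀ x, ∀ s ∈ F, μ s * Real.exp (L (x * s)) ≤ 2 * Real.exp (L x) := by
      refine w.step_le_of_superharmonic (fun x => (Real.exp_pos _).le) fun x => ?_
      have := h2 x
      simp only [Real.exp_sub, ← mul_div_assoc, ← Finset.sum_div] at this
      rwa [div_le_one (Real.exp_pos _)] at this
    have hup := hC g (fun x => Real.exp (L x)) hsuper 1
    have hlow := hC g⁻¹ (fun x => Real.exp (L x)) hsuper g
    rw [one_mul, h1, Real.exp_zero, mul_one, ← Real.le_log_iff_exp_le (hC0 g)] at hup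
    rw [mul_inv_cancel, h1, Real.exp_zero] at hlow
    refine ⟨?_, hup⟩
    have h3 := Real.log_le_log one_pos hlow
    rw [Real.log_one, Real.log_mul (hC0 _).ne' (Real.exp_pos _).ne', Real.log_exp] at h3
    linarith

theorem mapsTo_logSuperharmonic {A N : Subgroup G} [A.Normal] {z : G} {m : ℝ}
    (hz : ∀ b ∈ N, z⁻¹ * b * z * b⁻¹ ∈ A) {b : G} (hb : b ∈ N) :
    Set.MapsTo (normalizedTranslate b) (logSuperharmonic μ F A z m)
      (logSuperharmonic μ F A z m) := by
  rintro L ⟨h1, h2, h3, h4⟩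
  refine ⟨by simp [normalizedTranslate_apply], fun x => ?_, fun a ha x => ?_, fun x => ?_⟩
  · simpa [normalizedTranslate_apply, ← mul_assoc] using h2 (b * x)
  · have : b * (a * x) = (b * a * b⁻¹) * (b * x) := by group
    rw [normalizedTranslate_apply, normalizedTranslate_apply, this,
      h3 _ (Subgroup.Normal.conj_mem ‹_› a ha b)]
  · have : b * (z * x) = z * ((z⁻¹ * b * z * b⁻¹) * (b * x)) := by group
    rw [normalizedTranslate_apply, normalizedTranslate_apply, this, h4, h3 _ (hz b hb)]
    ring

/-- If `z` is central in `N` modulo `A` and left translation by `z` multiplies an `A`-invariant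
positive harmonic function by a constant, then the constant is `1`. -/
theorem multiplier_eq_one (w : IsFiniteRangeWalk μ F) {N A : Subgroup G} [N.Normal]
    [N.FiniteIndex] [A.Normal] {c : ℕ} (hN : N.lowerCentralSeries c = ⊥) {z : G}
    (hz : ∀ b ∈ N, z⁻¹ * b * z * b⁻¹ ∈ A) {h : G → ℝ} (hh : h ∈ normalizedHarmonic μ F)
    (hA : ∀ a ∈ A, ∀ x, h (a * x) = h x) {M : ℝ} (hM : ∀ x, h (z * x) = M * h x) : M = 1 := by
  have hpos := w.pos_of_mem_normalizedHarmonic hh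
  have hMpos : 0 < M := by
    have := hM 1
    simp only [mul_one, hh.2.1] at this
    exact this ▸ hpos z
  have hmem : (fun x => Real.log (h x)) ∈ logSuperharmonic μ F A z (Real.log M) := by
    refine ⟨by simp [hh.2.1], fun x => ?_, fun a ha x => by simp only [hA a ha], fun x => ?_⟩
    · simp only [Real.exp_sub, Real.exp_log (hpos _), ← mul_div_assoc, ← Finset.sum_div]
      rw [hh.2.2, div_self (hpos x).ne']
    · simp only [hM, Real.log_mul hMpos.ne' (hpos x).ne']
  obtain ⟨L, ⟨h1, h2, -, h4⟩, hfix⟩ := exists_normalizedTranslate_fixedPoint hN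
    (w.isCompact_logSuperharmonic A z (Real.log M)) (w.convex_logSuperharmonic A z (Real.log M))
    ⟨_, hmem⟩ (fun L hL => hL.1) (fun b hb => mapsTo_logSuperharmonic hz hb)
  have hzero := w.eq_zero_of_superharmonic_of_additive (N := N) h1
    (fun b hb x => by
      have := congrFun (hfix b hb) x
      rw [normalizedTranslate_apply] at this
      linarith) h2
  have := h4 1
  rw [hzero, hzero] at this
  exact Real.eq_one_of_pos_of_log_eq_zero hMpos (by linarith)

end IsFiniteRangeWalk

namespace IsFiniteRangeWalk

variable {G : Type*} [Group G] {μ : G → ℝ} {F : Finset G}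

/-- If `B` is central in `N` modulo `A` and all positive harmonic functions are invariant under
`A`, then they are invariant under `B`. -/
theorem harmonic_invariant_of_central (w : IsFiniteRangeWalk μ F) {N A B : Subgroup G} [N.Normal]
    [N.FiniteIndex] [A.Normal] [B.Normal] {c : ℕ} (hN : N.lowerCentralSeries c = ⊥)
    (hcomm : ∀ z ∈ B, ∀ b ∈ N, z⁻¹ * b * z * b⁻¹ ∈ A)
    (hA : ∀ h ∈ normalizedHarmonic μ F, ∀ a ∈ A, ∀ x, h (a * x) = h x) :
    ∀ h ∈ normalizedHarmonic μ F, ∀ z ∈ B, ∀ x, h (z * x) = h x := by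
  have hmax : ∀ z : G, ∃ k ∈ normalizedHarmonic μ F,
      ∀ h ∈ normalizedHarmonic μ F, h z ≤ k z := by
    intro z
    obtain ⟨k, hk, hkmax⟩ := w.isCompact_normalizedHarmonic.exists_isMaxOn
      ⟨_, w.const_mem_normalizedHarmonic⟩ (continuous_apply z).continuousOn
    exact ⟨k, hk, fun h hh => hkmax hh⟩
  choose k hk hkmax using hmax
  have htrans : ∀ h ∈ normalizedHarmonic μ F, ∀ z x,
      h (z * x) ≤ k (x⁻¹ * z * x) (x⁻¹ * z * x) * h x := by
    intro h hh z x
    have hx := w.pos_of_mem_normalizedHarmonic hh x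
    have := hkmax (x⁻¹ * z * x) _ (w.translate_mem_normalizedHarmonic hh x)
    rw [div_le_iff₀ hx] at this
    simpa only [← mul_assoc, mul_inv_cancel, one_mul] using this
  have hconj : ∀ z ∈ B, ∀ b ∈ N, k (b⁻¹ * z * b) (b⁻¹ * z * b) = k z z := by
    intro z hz b hb
    have h1 : ∀ h ∈ normalizedHarmonic μ F, h (b⁻¹ * z * b) = h z := by
      intro h hh
      have h2 := hA h hh _ (Subgroup.Normal.conj_mem ‹A.Normal› _
        (hcomm z hz b⁻¹ (N.inv_mem hb)) z) z
      rw [← h2]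
      congr 1
      group
    refine le_antisymm ?_ ?_
    · rw [h1 _ (hk _)]
      exact hkmax z _ (hk _)
    · rw [← h1 _ (hk z)]
      exact hkmax _ _ (hk z)
  have hle : ∀ z ∈ B, k z z ≤ 1 := by
    intro z hz
    obtain ⟨q, hq⟩ := Finite.exists_max
      (fun q : G ⧸ N => k (q.out⁻¹ * z * q.out) (q.out⁻¹ * z * q.out))
    set v := q.out⁻¹ * z * q.out with hv
    have hconjmem : ∀ x : G, x⁻¹ * z * x ∈ B := fun x => by
      simpa using Subgroup.Normal.conj_mem ‹B.Normal› z hz x⁻¹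
    have hvB : v ∈ B := hconjmem _
    have hkv : ∀ x : G, k (x⁻¹ * z * x) (x⁻¹ * z * x) ≤ k v v := by
      intro x
      refine le_trans (le_of_eq ?_) (hq (x : G ⧸ N))
      obtain ⟨b, hb⟩ := QuotientGroup.mk_out_eq_mul N x
      rw [hb]
      have h : (x * b)⁻¹ * z * (x * b) = (b : G)⁻¹ * (x⁻¹ * z * x) * b := by group
      rw [h, hconj _ (hconjmem x) b b.2]
    have hkv' : ∀ x : G, k (x⁻¹ * v * x) (x⁻¹ * v * x) ≤ k v v := by
      intro x
      have h : x⁻¹ * v * x = (q.out * x)⁻¹ * z * (q.out * x) := by rw [hv]; group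
      rw [h]
      exact hkv _
    have hmul : ∀ x, k v (v * x) = k v v * k v x := by
      intro x
      refine (sub_eq_zero.1 (w.eq_zero_of_harmonic
        (u := fun x => k v v * k v x - k v (v * x)) ?_ ?_ ?_ x)).symm
      · intro x
        rw [sub_nonneg]
        exact (htrans _ (hk v) v x).trans
          (mul_le_mul_of_nonneg_right (hkv' x) ((hk v).1 x))
      · intro x
        have h1 := (hk v).2.2 x
        have h2 := (hk v).2.2 (v * x)
        simp only [mul_sub, Finset.sum_sub_distrib, ← mul_assoc] at h2 ⊢
        rw [h2, ← h1, Finset.mul_sum]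
        congr 1
        exact Finset.sum_congr rfl fun g _ => by ring
      · simp [(hk v).2.1]
    have hone := w.multiplier_eq_one hN (hcomm v hvB) (hk v) (hA _ (hk v)) hmul
    simpa [hone] using hkv 1
  have hdecr : ∀ h ∈ normalizedHarmonic μ F, ∀ z ∈ B, ∀ x, h (z * x) ≤ h x := by
    intro h hh z hz x
    have hmem : x⁻¹ * z * x ∈ B := by
      simpa using Subgroup.Normal.conj_mem ‹B.Normal› z hz x⁻¹
    exact (htrans h hh z x).trans (mul_le_of_le_one_left (hh.1 x) (hle _ hmem))
  intro h hh z hz x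
  refine le_antisymm (hdecr h hh z hz x) ?_
  simpa using hdecr h hh z⁻¹ (B.inv_mem hz) (z * x)

/-- The strong Liouville property: on a group with a nilpotent normal subgroup of finite index,
every positive harmonic function for a symmetric finite range walk is constant. -/
theorem eq_one_of_mem_normalizedHarmonic (w : IsFiniteRangeWalk μ F) {N : Subgroup G} [N.Normal]
    [N.FiniteIndex] {c : ℕ} (hN : N.lowerCentralSeries c = ⊥) {h : G → ℝ}
    (hh : h ∈ normalizedHarmonic μ F) (x : G) : h x = 1 := by
  have key : ∀ n, (∀ h ∈ normalizedHarmonic μ F, ∀ a ∈ N.lowerCentralSeries n, ∀ x,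
        h (a * x) = h x) →
      ∀ h ∈ normalizedHarmonic μ F, ∀ a ∈ N.lowerCentralSeries 0, ∀ x, h (a * x) = h x := by
    intro n
    induction n with
    | zero => exact id
    | succ n ih =>
      refine fun hinv => ih (w.harmonic_invariant_of_central hN
        (fun z hz b hb => ?_) hinv)
      have := Subgroup.commutator_mem_commutator ((N.lowerCentralSeries n).inv_mem hz) hb
      simpa [commutatorElement_def] using this
  have hinv : ∀ h ∈ normalizedHarmonic μ F, ∀ a ∈ N, ∀ x, h (a * x) = h x := by
    refine key c fun h _ a ha x => ?_
    rw [hN, Subgroup.mem_bot] at ha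
    rw [ha, one_mul]
  obtain ⟨q, hq⟩ := Finite.exists_max (fun q : G ⧸ N => h q.out)
  have hmax : ∀ y, h y ≤ h q.out := by
    intro y
    refine le_trans (le_of_eq ?_) (hq (y : G ⧸ N))
    obtain ⟨b, hb⟩ := QuotientGroup.mk_out_eq_mul N y
    have hout : (y : G ⧸ N).out = (y * b * y⁻¹) * y := by rw [hb]; group
    rw [hout, hinv h hh _ (Subgroup.Normal.conj_mem ‹N.Normal› _ b.2 y)]
  have hconst : ∀ y, h (q.out * y) = h q.out := by
    intro y
    refine (sub_eq_zero.1 (w.eq_zero_of_harmonic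
      (u := fun y => h q.out - h (q.out * y)) (fun y => sub_nonneg.2 (hmax _)) ?_ ?_ y)).symm
    · intro y
      have h2 := hh.2.2 (q.out * y)
      simp only [mul_sub, Finset.sum_sub_distrib, ← mul_assoc, ← Finset.sum_mul] at h2 ⊢
      rw [h2, w.sum_eq, one_mul]
    · simp
  have h1 := hconst (q.out⁻¹)
  have h2 := hconst (q.out⁻¹ * x)
  rw [mul_inv_cancel, hh.2.1] at h1
  rw [mul_inv_cancel_left] at h2
  rw [h2, h1]

end IsFiniteRangeWalk

namespace IsFiniteRangeWalk

variable {G : Type*} [Group G] {μ : G → ℝ} {F : Finset G}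

theorem hasSum_convPow (w : IsFiniteRangeWalk μ F) (n : ℕ) : HasSum (convPow μ n) 1 := by
  induction n with
  | zero =>
    simp only [convPow]
    exact hasSum_ite_eq 1 1
  | succ n ih =>
    have h : HasSum (fun x => ∑ g ∈ F, μ g * convPow μ n (g⁻¹ * x)) (∑ g ∈ F, μ g * 1) :=
      hasSum_sum fun g _ => ((Equiv.mulLeft g⁻¹).hasSum_iff.2 ih).mul_left (μ g)
    simp only [mul_one, w.sum_eq] at h
    exact (funext fun x => w.convPow_succ n x : convPow μ (n + 1) = _) ▸ h

theorem convPow_le_one (w : IsFiniteRangeWalk μ F) (n : ℕ) (x : G) : convPow μ n x ≤ 1 :=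
  le_hasSum (w.hasSum_convPow n) x fun y _ => w.convPow_nonneg n y

theorem convPow_mul_convPow_le (w : IsFiniteRangeWalk μ F) (n m : ℕ) (x y : G) :
    convPow μ n x * convPow μ m y ≤ convPow μ (n + m) (x * y) := by
  induction n generalizing x with
  | zero =>
    simp only [convPow]
    split_ifs with h
    · simp [h]
    · simpa using w.convPow_nonneg _ _
  | succ n ih =>
    rw [w.convPow_succ, Nat.add_right_comm n 1 m, w.convPow_succ, Finset.sum_mul]
    refine Finset.sum_le_sum fun g _ => ?_
    rw [mul_assoc, ← mul_assoc g⁻¹]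
    exact mul_le_mul_of_nonneg_left (ih _) (w.nonneg g)

theorem summable_convPow_mul (w : IsFiniteRangeWalk μ F) {x y : G}
    (h : Summable fun n => convPow μ n (x * y)) : Summable fun n => convPow μ n y := by
  obtain ⟨k, hk⟩ := w.admissible x
  have h1 : Summable fun n => (convPow μ k x)⁻¹ * convPow μ (k + n) (x * y) := by
    refine Summable.mul_left _ ?_
    simpa only [add_comm k] using (summable_nat_add_iff k).2 h
  refine h1.of_nonneg_of_le (fun n => w.convPow_nonneg n y) fun n => ?_
  rw [le_inv_mul_iff₀ hk]
  exact w.convPow_mul_convPow_le k n x y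

theorem summable_green_term (w : IsFiniteRangeWalk μ F) {r : ℝ} (h0 : 0 ≤ r) (h1 : r < 1)
    (x : G) : Summable fun n => r ^ n * convPow μ n x :=
  (summable_geometric_of_lt_one h0 h1).of_nonneg_of_le
    (fun n => mul_nonneg (pow_nonneg h0 n) (w.convPow_nonneg n x))
    fun n => mul_le_of_le_one_right (pow_nonneg h0 n) (w.convPow_le_one n x)

theorem green_nonneg (w : IsFiniteRangeWalk μ F) {r : ℝ} (h0 : 0 ≤ r) (x : G) :
    0 ≤ green μ r x :=
  tsum_nonneg fun n => mul_nonneg (pow_nonneg h0 n) (w.convPow_nonneg n x)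

theorem green_pos (w : IsFiniteRangeWalk μ F) {r : ℝ} (h0 : 0 < r) (h1 : r < 1) (x : G) :
    0 < green μ r x := by
  obtain ⟨n, hn⟩ := w.admissible x
  exact (w.summable_green_term h0.le h1 x).tsum_pos
    (fun n => mul_nonneg (pow_nonneg h0.le n) (w.convPow_nonneg n x)) n
    (mul_pos (pow_pos h0 n) hn)

theorem green_eq (w : IsFiniteRangeWalk μ F) {r : ℝ} (h0 : 0 ≤ r) (h1 : r < 1) (x : G) :
    green μ r x = (if x = 1 then 1 else 0) + r * ∑ g ∈ F, μ g * green μ r (g⁻¹ * x) := by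
  have hs := w.summable_green_term h0 h1
  rw [green, (hs x).tsum_eq_zero_add]
  congr 1
  · simp [convPow]
  · have h : ∀ n, r ^ (n + 1) * convPow μ (n + 1) x =
        ∑ g ∈ F, r * (μ g * (r ^ n * convPow μ n (g⁻¹ * x))) := by
      intro n
      rw [w.convPow_succ, Finset.mul_sum]
      exact Finset.sum_congr rfl fun g _ => by ring
    simp only [h]
    rw [Summable.tsum_finsetSum fun g _ => ((hs (g⁻¹ * x)).mul_left _).mul_left _,
      Finset.mul_sum]
    exact Finset.sum_congr rfl fun g _ => by rw [tsum_mul_left, tsum_mul_left, green]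

theorem summable_green (w : IsFiniteRangeWalk μ F) {r : ℝ} (h0 : 0 ≤ r) (h1 : r < 1) :
    Summable (green μ r) := by
  have h2 : (fun n : ℕ => ∑' x, r ^ n * convPow μ n x) = fun n => r ^ n :=
    funext fun n => by rw [tsum_mul_left, (w.hasSum_convPow n).tsum_eq, mul_one]
  have hnn : 0 ≤ fun p : ℕ × G => r ^ p.1 * convPow μ p.1 p.2 := fun p =>
    mul_nonneg (pow_nonneg h0 p.1) (w.convPow_nonneg p.1 p.2)
  have h : Summable fun p : ℕ × G => r ^ p.1 * convPow μ p.1 p.2 := by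
    refine (summable_prod_of_nonneg hnn).2
      ⟨fun n => (w.hasSum_convPow n).summable.mul_left (r ^ n), ?_⟩
    change Summable fun n : ℕ => ∑' x, r ^ n * convPow μ n x
    rw [h2]
    exact summable_geometric_of_lt_one h0 h1
  have h' : Summable fun p : G × ℕ => r ^ p.2 * convPow μ p.2 p.1 := h.prod_symm
  exact h'.prod

/-- The Green function is maximal at the identity. -/
theorem green_le_green_one (w : IsFiniteRangeWalk μ F) {r : ℝ} (h0 : 0 < r) (h1 : r < 1) (x : G) :
    green μ r x ≤ green μ r 1 := by
  have hfin : {y | green μ r 1 ≤ green μ r y}.Finite := by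
    have h := (w.summable_green h0.le h1).tendsto_cofinite_zero.eventually_lt_const
      (w.green_pos h0 h1 1)
    simpa only [Filter.eventually_cofinite, not_lt] using h
  obtain ⟨y, hy, hmax⟩ := hfin.exists_maximalFor (green μ r) _ ⟨1, le_refl (green μ r 1)⟩
  have hmax' : ∀ z, green μ r z ≤ green μ r y := by
    intro z
    by_cases hz : green μ r 1 ≤ green μ r z
    · exact le_of_not_gt fun hlt => absurd (hmax hz hlt.le) (not_le.2 hlt)
    · exact (not_le.1 hz).le.trans hy
  by_cases hy1 : y = 1
  · exact hy1 ▸ hmax' x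
  exfalso
  have hpos := w.green_pos h0 h1 y
  have heq := w.green_eq h0.le h1 y
  have hle : ∑ g ∈ F, μ g * green μ r (g⁻¹ * y) ≤ green μ r y := by
    calc _ ≤ ∑ g ∈ F, μ g * green μ r y :=
          Finset.sum_le_sum fun g _ => mul_le_mul_of_nonneg_left (hmax' _) (w.nonneg g)
      _ = green μ r y := by rw [← Finset.sum_mul, w.sum_eq, one_mul]
  rw [if_neg hy1, zero_add] at heq
  have : r * ∑ g ∈ F, μ g * green μ r (g⁻¹ * y) ≤ r * green μ r y :=
    mul_le_mul_of_nonneg_left hle h0.le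
  nlinarith

theorem green_le_green_at_one (w : IsFiniteRangeWalk μ F) {r : ℝ} (h0 : 0 ≤ r) (h1 : r < 1)
    {x : G} (hs : Summable fun n => convPow μ n x) : green μ r x ≤ green μ 1 x := by
  refine (w.summable_green_term h0 h1 x).tsum_le_tsum (fun n => ?_) (by simpa using hs)
  exact mul_le_mul_of_nonneg_right (by simpa using pow_le_one₀ h0 h1.le) (w.convPow_nonneg n x)

theorem green_at_one_le (w : IsFiniteRangeWalk μ F) (hs : Summable fun n => convPow μ n 1)
    (x : G) : green μ 1 x ≤ green μ 1 1 := by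
  refine Real.tsum_le_of_sum_le
    (fun n => mul_nonneg (by simp) (w.convPow_nonneg n x)) fun s => ?_
  have hlim : Tendsto (fun r : ℝ => ∑ n ∈ s, r ^ n * convPow μ n x) (nhdsWithin 1 (Set.Iio 1))
      (nhds (∑ n ∈ s, 1 ^ n * convPow μ n x)) :=
    ((by fun_prop : Continuous fun r : ℝ => ∑ n ∈ s, r ^ n * convPow μ n x).tendsto 1).mono_left
      nhdsWithin_le_nhds
  refine le_of_tendsto hlim ?_
  filter_upwards [Ioo_mem_nhdsLT (zero_lt_one' ℝ)] with r hr
  calc ∑ n ∈ s, r ^ n * convPow μ n x ≤ green μ r x :=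
        (w.summable_green_term hr.1.le hr.2 x).sum_le_tsum s fun n _ =>
          mul_nonneg (pow_nonneg hr.1.le n) (w.convPow_nonneg n x)
    _ ≤ green μ r 1 := w.green_le_green_one hr.1 hr.2 x
    _ ≤ green μ 1 1 := w.green_le_green_at_one hr.1.le hr.2 hs

/-- Ratios of the Green function at bounded distance tend to `1`, uniformly as `r ↑ 1` and as
the point tends to infinity. -/
theorem tendsto_green_ratio (w : IsFiniteRangeWalk μ F) {N : Subgroup G} [N.Normal]
    [N.FiniteIndex] {c : ℕ} (hN : N.lowerCentralSeries c = ⊥) (g : G) :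
    Tendsto (fun p : ℝ × G => green μ p.1 (g * p.2) / green μ p.1 p.2)
      (nhdsWithin 1 (Set.Iio 1) ×ˢ cofinite) (nhds 1) := by
  choose C _ hC using w.harnack
  have hr : ∀ᶠ p : ℝ × G in nhdsWithin 1 (Set.Iio 1) ×ˢ cofinite, p.1 ∈ Set.Ioo (1 / 2 : ℝ) 1 :=
    tendsto_fst.eventually (Ioo_mem_nhdsLT (by norm_num))
  have hlim : Tendsto (fun (p : ℝ × G) (x : G) => green μ p.1 (x⁻¹ * p.2) / green μ p.1 p.2)
      (nhdsWithin 1 (Set.Iio 1) ×ˢ cofinite) (nhds fun _ => 1) := by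
    refine (isCompact_univ_pi fun x =>
      isCompact_Icc (a := 0) (b := C x)).tendsto_nhds_of_unique_mapClusterPt ?_ ?_
    · filter_upwards [hr] with p hp x _
      have hp0 : 0 < p.1 := by linarith [hp.1]
      refine ⟨div_nonneg (w.green_nonneg hp0.le _) (w.green_nonneg hp0.le _), ?_⟩
      rw [div_le_iff₀ (w.green_pos hp0 hp.2 _)]
      have := hC x (fun x => green μ p.1 (x⁻¹ * p.2)) (fun x s hs => ?_) 1
      · simpa using this
      · have heq := w.green_eq hp0.le hp.2 (x⁻¹ * p.2)
        have hsingle : μ s * green μ p.1 (s⁻¹ * (x⁻¹ * p.2)) ≤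
            ∑ g ∈ F, μ g * green μ p.1 (g⁻¹ * (x⁻¹ * p.2)) :=
          Finset.single_le_sum (f := fun g => μ g * green μ p.1 (g⁻¹ * (x⁻¹ * p.2)))
            (fun g _ => mul_nonneg (w.nonneg g) (w.green_nonneg hp0.le _)) hs
        have hnn : 0 ≤ μ s * green μ p.1 (s⁻¹ * (x⁻¹ * p.2)) :=
          mul_nonneg (w.nonneg s) (w.green_nonneg hp0.le _)
        have hite : (0 : ℝ) ≤ if x⁻¹ * p.2 = 1 then 1 else 0 := by split_ifs <;> norm_num
        rw [mul_inv_rev, mul_assoc]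
        nlinarith [hp.1]
    · intro h _ hcl
      obtain ⟨U, hU, hUh⟩ := mapClusterPt_iff_ultrafilter.1 hcl
      have hx : ∀ x, Tendsto (fun p : ℝ × G => green μ p.1 (x⁻¹ * p.2) / green μ p.1 p.2) U
          (nhds (h x)) := fun x => ((continuous_apply x).tendsto h).comp hUh
      have hrU : ∀ᶠ p : ℝ × G in U, p.1 ∈ Set.Ioo (1 / 2 : ℝ) 1 := hU hr
      refine funext fun x => w.eq_one_of_mem_normalizedHarmonic hN (h := h) ⟨fun x => ?_, ?_,
        fun x => ?_⟩ x
      · refine ge_of_tendsto (hx x) ?_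
        filter_upwards [hrU] with p hp
        have hp0 : 0 ≤ p.1 := by linarith [hp.1]
        exact div_nonneg (w.green_nonneg hp0 _) (w.green_nonneg hp0 _)
      · refine tendsto_nhds_unique (hx 1) (tendsto_const_nhds.congr' ?_)
        filter_upwards [hrU] with p hp
        have hp0 : 0 < p.1 := by linarith [hp.1]
        rw [inv_one, one_mul, div_self (w.green_pos hp0 hp.2 _).ne']
      · have hfst : Tendsto (fun p : ℝ × G => p.1) U (nhds 1) :=
          (tendsto_fst.mono_left hU).mono_right nhdsWithin_le_nhds
        have h1 := hfst.mul (tendsto_finsetSum F fun g _ => (hx (x * g)).const_mul (μ g))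
        rw [one_mul] at h1
        refine tendsto_nhds_unique h1 ((hx x).congr' ?_)
        have hne : ∀ᶠ p : ℝ × G in U, p.2 ≠ x :=
          hU (tendsto_snd.eventually (Set.finite_singleton x).eventually_cofinite_notMem)
        filter_upwards [hrU, hne] with p hp hpx
        have hp0 : 0 ≤ p.1 := by linarith [hp.1]
        have hne' : x⁻¹ * p.2 ≠ 1 := fun h => hpx (inv_mul_eq_one.1 h).symm
        rw [w.green_eq hp0 hp.2 (x⁻¹ * p.2), if_neg hne', zero_add, mul_div_assoc, Finset.sum_div]
        simp only [mul_inv_rev, mul_assoc, mul_div_assoc]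
  simpa [Function.comp_def] using ((continuous_apply g⁻¹).tendsto _).comp hlim

end IsFiniteRangeWalk

section WordLength

variable {G : Type*} [Group G] {S : Finset G}

theorem finite_generators (S : Finset G) : ((S : Set G) ∪ (S : Set G)⁻¹).Finite :=
  S.finite_toSet.union S.finite_toSet.inv

theorem finite_generators_pow (S : Finset G) (n : ℕ) :
    (((S : Set G) ∪ (S : Set G)⁻¹) ^ n).Finite := by
  induction n with
  | zero => simp
  | succ n ih =>
    rw [pow_succ]
    exact ih.mul (finite_generators S)

theorem mem_pow_wordLength (hS : Subgroup.closure (S : Set G) = ⊤) (x : G) :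
    x ∈ ((S : Set G) ∪ (S : Set G)⁻¹) ^ wordLength S x := by
  refine Nat.sInf_mem (s := {n : ℕ | x ∈ ((S : Set G) ∪ (S : Set G)⁻¹) ^ n}) ?_
  have hx : x ∈ Submonoid.closure ((S : Set G) ∪ (S : Set G)⁻¹) := by
    rw [← Subgroup.closure_toSubmonoid, hS]
    exact Subgroup.mem_top x
  induction hx using Submonoid.closure_induction with
  | mem x hx => exact ⟨1, by simpa using hx⟩
  | one => exact ⟨0, by simp⟩
  | mul x y _ _ hx hy =>
    obtain ⟨n, hn⟩ := hx
    obtain ⟨m, hm⟩ := hy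
    refine ⟨n + m, ?_⟩
    change x * y ∈ ((S : Set G) ∪ (S : Set G)⁻¹) ^ (n + m)
    rw [pow_add]
    exact Set.mul_mem_mul hn hm

theorem wordLength_le {n : ℕ} {x : G} (hx : x ∈ ((S : Set G) ∪ (S : Set G)⁻¹) ^ n) :
    wordLength S x ≤ n :=
  Nat.sInf_le hx

theorem finite_sphere (hS : Subgroup.closure (S : Set G) = ⊤) (n : ℕ) :
    {x | wordLength S x = n}.Finite :=
  (finite_generators_pow S n).subset fun x hx => by
    have h := mem_pow_wordLength hS x
    rwa [show wordLength S x = n from hx] at h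

theorem exists_wordLength_eq [Infinite G] (hS : Subgroup.closure (S : Set G) = ⊤) (n : ℕ) :
    ∃ x, wordLength S x = n := by
  by_contra! hne
  have hlt : ∀ m, ∀ x ∈ ((S : Set G) ∪ (S : Set G)⁻¹) ^ m, wordLength S x < n := by
    intro m
    induction m with
    | zero =>
      intro x hx
      exact lt_of_le_of_ne ((wordLength_le hx).trans (Nat.zero_le n)) (hne x)
    | succ m ih =>
      intro x hx
      rw [pow_succ'] at hx
      obtain ⟨s, hs, y, hy, rfl⟩ := Set.mem_mul.1 hx
      refine lt_of_le_of_ne (le_trans (wordLength_le ?_) (ih y hy)) (hne _)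
      rw [pow_succ']
      exact Set.mul_mem_mul hs (mem_pow_wordLength hS y)
  refine Set.infinite_univ (α := G) (((Finset.range n).finite_toSet.biUnion fun m _ =>
    finite_sphere hS m).subset fun x _ => ?_)
  simpa using hlt _ x (mem_pow_wordLength hS x)

theorem greenSphereSum_eq (hS : Subgroup.closure (S : Set G) = ⊤) (μ : G → ℝ) (r : ℝ) (n : ℕ) :
    greenSphereSum S μ r n = ∑ x ∈ (finite_sphere hS n).toFinset, green μ r x := by
  rw [greenSphereSum, tsum_eq_sum (s := (finite_sphere hS n).toFinset)]
  · exact Finset.sum_congr rfl fun x hx => if_pos (by simpa using hx)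
  · exact fun x hx => if_neg (by simpa using hx)

end WordLength

theorem infinite_of_notVirtuallyLowZd {G : Type*} [Group G] (h : NotVirtuallyLowZd G) :
    Infinite G := by
  by_contra hfin
  rw [not_infinite_iff_finite] at hfin
  refine h ⟨⊥, 0, Nat.zero_le 2, inferInstance, ⟨?_⟩⟩
  have : Unique (Multiplicative (Fin 0 → ℤ)) := inferInstanceAs (Unique (Fin 0 → ℤ))
  exact MulEquiv.ofUnique

theorem log_growth_bounds {a b θ Θ : ℝ} (ha : 0 < a) (hb : 0 < b) (hθ : 0 < θ) (hΘ : 0 < Θ)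
    {u : ℕ → ℝ} (hl : ∀ n, a * θ ^ n ≤ u n) (hu : ∀ n, u n ≤ b * Θ ^ n) :
    Real.log θ ≤ limsup (fun n : ℕ => Real.log (u n) / n) atTop ∧
      limsup (fun n : ℕ => Real.log (u n) / n) atTop ≤ Real.log Θ := by
  have hlim : ∀ {a θ : ℝ}, Tendsto (fun n : ℕ => Real.log a / n + Real.log θ) atTop
      (nhds (Real.log θ)) := fun {a θ} => by
    simpa using (tendsto_const_div_atTop_nhds_zero_nat (Real.log a)).add_const (Real.log θ)
  have hexp : ∀ {a θ : ℝ}, 0 < a → 0 < θ → ∀ n : ℕ, 0 < n →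
      Real.log (a * θ ^ n) / n = Real.log a / n + Real.log θ := by
    intro a θ ha hθ n hn
    have : (n : ℝ) ≠ 0 := by positivity
    rw [Real.log_mul ha.ne' (by positivity), Real.log_pow]
    field_simp
  have hL : ∀ᶠ n : ℕ in atTop, Real.log a / n + Real.log θ ≤ Real.log (u n) / n := by
    filter_upwards [eventually_gt_atTop 0] with n hn
    rw [← hexp ha hθ n hn]
    exact div_le_div_of_nonneg_right (Real.log_le_log (by positivity) (hl n)) (Nat.cast_nonneg n)
  have hU : ∀ᶠ n : ℕ in atTop, Real.log (u n) / n ≤ Real.log b / n + Real.log Θ := by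
    filter_upwards [eventually_gt_atTop 0] with n hn
    rw [← hexp hb hΘ n hn]
    have hpos : 0 < u n := lt_of_lt_of_le (by positivity) (hl n)
    exact div_le_div_of_nonneg_right (Real.log_le_log hpos (hu n)) (Nat.cast_nonneg n)
  have hbl : IsBoundedUnder (· ≥ ·) atTop fun n : ℕ => Real.log (u n) / n :=
    hlim.isBoundedUnder_ge.mono_ge hL
  have hbu : IsBoundedUnder (· ≤ ·) atTop fun n : ℕ => Real.log (u n) / n :=
    hlim.isBoundedUnder_le.mono_le hU
  constructor
  · rw [← (hlim (a := a) (θ := θ)).limsup_eq]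
    exact limsup_le_limsup hL hlim.isCoboundedUnder_le hbu
  · rw [← (hlim (a := b) (θ := Θ)).limsup_eq]
    exact limsup_le_limsup hU hbl.isCoboundedUnder_le hlim.isBoundedUnder_le

namespace IsFiniteRangeWalk

variable {G : Type*} [Group G] {μ : G → ℝ} {F S : Finset G}

/-- For `r` close to `1`, the Green function decays slower than any given exponential. -/
theorem eventually_exists_mul_pow_le_green (w : IsFiniteRangeWalk μ F) {N : Subgroup G} [N.Normal]
    [N.FiniteIndex] {c : ℕ} (hN : N.lowerCentralSeries c = ⊥)
    (hS : Subgroup.closure (S : Set G) = ⊤) {θ : ℝ} (h0 : 0 < θ) (h1 : θ < 1) :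
    ∀ᶠ r in nhdsWithin 1 (Set.Iio 1), ∃ a > 0, ∀ x, a * θ ^ wordLength S x ≤ green μ r x := by
  have hratio : ∀ᶠ p : ℝ × G in nhdsWithin 1 (Set.Iio 1) ×ˢ cofinite,
      ∀ s ∈ (S : Set G) ∪ (S : Set G)⁻¹, θ < green μ p.1 (s * p.2) / green μ p.1 p.2 :=
    (Filter.eventually_all_finite (finite_generators S)).2 fun s _ =>
      (w.tendsto_green_ratio hN s).eventually_const_lt h1
  filter_upwards [hratio.curry, Ioo_mem_nhdsLT (zero_lt_one' ℝ)] with r hr hr01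
  have hpos := w.green_pos hr01.1 hr01.2
  set Y := {y | ¬ ∀ s ∈ (S : Set G) ∪ (S : Set G)⁻¹, θ < green μ r (s * y) / green μ r y}
  have hY : Y.Finite := hr
  have hZ : (insert 1 (((S : Set G) ∪ (S : Set G)⁻¹) * Y)).Finite :=
    ((finite_generators S).mul hY).insert 1
  obtain ⟨z, _, hz⟩ := hZ.exists_minimalFor (green μ r) _ (Set.insert_nonempty _ _)
  have hz' : ∀ y ∈ insert 1 (((S : Set G) ∪ (S : Set G)⁻¹) * Y), green μ r z ≤ green μ r y :=
    fun y hy => (le_total (green μ r z) (green μ r y)).elim id fun h => hz hy h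
  have key : ∀ n, ∀ x ∈ ((S : Set G) ∪ (S : Set G)⁻¹) ^ n,
      green μ r z * θ ^ n ≤ green μ r x := by
    intro n
    induction n with
    | zero =>
      intro x hx
      obtain rfl : x = 1 := by simpa using hx
      simpa using hz' 1 (Set.mem_insert _ _)
    | succ n ih =>
      intro x hx
      rw [pow_succ'] at hx
      obtain ⟨s, hs, y, hy, rfl⟩ := Set.mem_mul.1 hx
      by_cases hyY : y ∈ Y
      · exact (mul_le_of_le_one_right (hpos z).le (pow_le_one₀ h0.le h1.le)).trans
          (hz' _ (Set.mem_insert_of_mem _ (Set.mul_mem_mul hs hyY)))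
      · have hlt := (lt_div_iff₀ (hpos y)).1 (not_not.1 hyY s hs)
        calc green μ r z * θ ^ (n + 1) = θ * (green μ r z * θ ^ n) := by ring
          _ ≤ θ * green μ r y := mul_le_mul_of_nonneg_left (ih y hy) h0.le
          _ ≤ green μ r (s * y) := hlt.le
  exact ⟨green μ r z, hpos z, fun x => key _ x (mem_pow_wordLength hS x)⟩

theorem le_greenSphereSum [Infinite G] (hS : Subgroup.closure (S : Set G) = ⊤) {r a θ : ℝ}
    (hnn : ∀ x, 0 ≤ green μ r x) (ha : ∀ x, a * θ ^ wordLength S x ≤ green μ r x) (n : ℕ) :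
    a * θ ^ n ≤ greenSphereSum S μ r n := by
  obtain ⟨x, hx⟩ := exists_wordLength_eq hS n
  rw [greenSphereSum_eq hS]
  calc a * θ ^ n ≤ green μ r x := by simpa only [hx] using ha x
    _ ≤ _ := Finset.single_le_sum (f := green μ r) (fun y _ => hnn y) (by simpa using hx)

theorem greenSphereSum_le_tsum (w : IsFiniteRangeWalk μ F)
    (hS : Subgroup.closure (S : Set G) = ⊤) {r : ℝ} (h0 : 0 ≤ r) (h1 : r < 1) (n : ℕ) :
    greenSphereSum S μ r n ≤ ∑' x, green μ r x := by
  rw [greenSphereSum_eq hS]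
  exact (w.summable_green h0 h1).sum_le_tsum _ fun x _ => w.green_nonneg h0 x

theorem eventually_greenGrowthRate_mem_Icc (w : IsFiniteRangeWalk μ F) [Infinite G]
    {N : Subgroup G} [N.Normal] [N.FiniteIndex] {c : ℕ} (hN : N.lowerCentralSeries c = ⊥)
    (hS : Subgroup.closure (S : Set G) = ⊤) {θ : ℝ} (hθ0 : 0 < θ) (hθ1 : θ < 1) :
    ∀ᶠ r in nhdsWithin 1 (Set.Iio 1), greenGrowthRate S μ r ∈ Set.Icc (Real.log θ) 0 := by
  filter_upwards [w.eventually_exists_mul_pow_le_green hN hS hθ0 hθ1,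
    Ioo_mem_nhdsLT (zero_lt_one' ℝ)] with r ⟨a, ha, hle⟩ hr
  have htsum : 0 < ∑' x, green μ r x :=
    (w.summable_green hr.1.le hr.2).tsum_pos (w.green_nonneg hr.1.le) 1 (w.green_pos hr.1 hr.2 1)
  have h := log_growth_bounds ha htsum hθ0 one_pos
    (le_greenSphereSum hS (w.green_nonneg hr.1.le) hle)
    fun n => by simpa using w.greenSphereSum_le_tsum hS hr.1.le hr.2 n
  rwa [Real.log_one] at h

/-- The spheres grow subexponentially, which bounds the Green function at `r = 1` from above. -/
theorem greenGrowthRate_one_mem_Icc (w : IsFiniteRangeWalk μ F) [Infinite G]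
    {N : Subgroup G} [N.Normal] [N.FiniteIndex] {c : ℕ} (hN : N.lowerCentralSeries c = ⊥)
    (hS : Subgroup.closure (S : Set G) = ⊤) {θ : ℝ} (hθ0 : 0 < θ) (hθ1 : θ < 1)
    (hs : ∀ x, Summable fun n => convPow μ n x) :
    greenGrowthRate S μ 1 ∈ Set.Icc (Real.log θ) (-Real.log θ) := by
  obtain ⟨r, ⟨a, ha, hle⟩, hr⟩ := ((w.eventually_exists_mul_pow_le_green hN hS hθ0 hθ1).and
    (Ioo_mem_nhdsLT (zero_lt_one' ℝ))).exists
  have htsum : 0 < ∑' x, green μ r x :=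
    (w.summable_green hr.1.le hr.2).tsum_pos (w.green_nonneg hr.1.le) 1 (w.green_pos hr.1 hr.2 1)
  have hle1 : ∀ x, green μ r x ≤ green μ 1 x :=
    fun x => w.green_le_green_at_one hr.1.le hr.2 (hs x)
  have h1pos : 0 < green μ 1 1 := (w.green_pos hr.1 hr.2 1).trans_le (hle1 1)
  have hb : 0 < (∑' x, green μ r x) / a * green μ 1 1 := by positivity
  have h := log_growth_bounds ha hb hθ0 (inv_pos.2 hθ0)
    (le_greenSphereSum hS (w.green_nonneg zero_le_one) fun x => (hle x).trans (hle1 x))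
    fun n => ?_
  · rwa [Real.log_inv] at h
  set k : ℝ := ((finite_sphere hS n).toFinset.card : ℝ)
  have hcard : k * (a * θ ^ n) ≤ ∑' x, green μ r x := by
    refine le_trans ?_ (w.greenSphereSum_le_tsum hS hr.1.le hr.2 n)
    rw [greenSphereSum_eq hS, ← nsmul_eq_mul]
    refine Finset.card_nsmul_le_sum _ _ _ fun x hx => ?_
    have hx' : wordLength S x = n := by simpa using hx
    simpa only [hx'] using hle x
  have hsum : greenSphereSum S μ 1 n ≤ k * green μ 1 1 := by
    rw [greenSphereSum_eq hS, ← nsmul_eq_mul]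
    exact Finset.sum_le_card_nsmul _ _ _ fun x _ => w.green_at_one_le (hs 1) x
  refine hsum.trans ?_
  have hk : k ≤ (∑' x, green μ r x) / a * θ⁻¹ ^ n := by
    rw [inv_pow, ← div_eq_mul_inv, div_div, le_div_iff₀ (by positivity)]
    exact hcard
  calc k * green μ 1 1 ≤ (∑' x, green μ r x) / a * θ⁻¹ ^ n * green μ 1 1 :=
        mul_le_mul_of_nonneg_right hk h1pos.le
    _ = _ := by ring

theorem greenGrowthRate_one_eq_zero (w : IsFiniteRangeWalk μ F) [Infinite G]
    {N : Subgroup G} [N.Normal] [N.FiniteIndex] {c : ℕ} (hN : N.lowerCentralSeries c = ⊥)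
    (hS : Subgroup.closure (S : Set G) = ⊤) : greenGrowthRate S μ 1 = 0 := by
  by_cases hs : Summable fun n => convPow μ n 1
  · have hs' : ∀ x, Summable fun n => convPow μ n x := fun x =>
      w.summable_convPow_mul (x := x⁻¹) (by simpa using hs)
    have h : ∀ δ > 0, |greenGrowthRate S μ 1| ≤ δ := by
      intro δ hδ
      have := w.greenGrowthRate_one_mem_Icc hN hS (Real.exp_pos (-δ))
        (Real.exp_lt_one_iff.2 (neg_lt_zero.2 hδ)) hs'
      rw [Real.log_exp, neg_neg] at this
      exact abs_le.2 this
    exact abs_nonpos_iff.1 (le_of_forall_gt_imp_ge_of_dense h)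
  · have hz : ∀ x, green μ 1 x = 0 := fun x => by
      refine tsum_eq_zero_of_not_summable fun hx => hs ?_
      exact w.summable_convPow_mul (x := x) (by simpa using hx)
    simp [greenGrowthRate, greenSphereSum, hz]

theorem tendsto_greenGrowthRate (w : IsFiniteRangeWalk μ F) [Infinite G]
    {N : Subgroup G} [N.Normal] [N.FiniteIndex] {c : ℕ} (hN : N.lowerCentralSeries c = ⊥)
    (hS : Subgroup.closure (S : Set G) = ⊤) :
    Tendsto (fun r : ℝ => greenGrowthRate S μ r) (nhdsWithin 1 (Set.Iio 1)) (nhds 0) := by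
  refine tendsto_order.2 ⟨fun b hb => ?_, fun b hb => ?_⟩
  · filter_upwards [w.eventually_greenGrowthRate_mem_Icc hN hS (Real.exp_pos (b / 2))
      (Real.exp_lt_one_iff.2 (by linarith))] with r hr
    have := hr.1
    rw [Real.log_exp] at this
    linarith
  · filter_upwards [w.eventually_greenGrowthRate_mem_Icc hN hS (θ := 1 / 2) (by norm_num)
      (by norm_num)] with r hr
    exact hr.2.trans_lt hb

end IsFiniteRangeWalk

theorem isFiniteRangeWalk_of_finite_support {G : Type*} [Group G] {μ : G → ℝ}
    (hprob : IsProbMeasure μ) (hsymm : IsSymm μ) (hadm : IsAdmissible μ)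
    (hfin : (Function.support μ).Finite) : IsFiniteRangeWalk μ hfin.toFinset where
  pos g hg := lt_of_le_of_ne (hprob.1 g) (Ne.symm (by simpa using hg))
  eq_zero g hg := by simpa using hg
  sum_eq := (hasSum_sum_of_ne_finset_zero fun g hg => by simpa using hg).unique hprob.2
  symm := hsymm
  admissible := hadm

/-- Let `Γ` be a finitely generated virtually nilpotent group which is
not virtually `ℤ^d` for any `d ≤ 2`, and let `μ` be a finitely supported symmetric
admissible probability measure on `Γ`.  Then `r ↦ ω_Γ(r)` is left-continuous at `1`:
`lim_{r↑1} ω_Γ(r) = ω_Γ(1) = 0`. -/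
theorem greenGrowthRate_left_continuous_at_one {G : Type*} [Group G] (S : Finset G)
    (hS : Subgroup.closure (S : Set G) = ⊤)
    (hvn : ∃ H : Subgroup G, H.FiniteIndex ∧ Group.IsNilpotent H)
    (hnz : NotVirtuallyLowZd G)
    (μ : G → ℝ) (hprob : IsProbMeasure μ) (hsymm : IsSymm μ) (hadm : IsAdmissible μ)
    (hfin : (Function.support μ).Finite) :
    greenGrowthRate S μ 1 = 0 ∧
      Tendsto (fun r : ℝ => greenGrowthRate S μ r)
        (nhdsWithin 1 (Set.Iio 1)) (nhds (greenGrowthRate S μ 1)) := by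
  obtain ⟨H, hH, hnil⟩ := hvn
  have := infinite_of_notVirtuallyLowZd hnz
  have w := isFiniteRangeWalk_of_finite_support hprob hsymm hadm hfin
  have hN : H.normalCore.lowerCentralSeries (Group.nilpotencyClass H) = ⊥ :=
    le_bot_iff.1 ((Subgroup.lowerCentralSeries_mono _ H.normalCore_le).trans
      (Subgroup.lowerCentralSeries_eq_bot_of_nilpotencyClass_le le_rfl).le)
  rw [w.greenGrowthRate_one_eq_zero hN hS]
  exact ⟨rfl, w.tendsto_greenGrowthRate hN hS⟩

end GreenGrowth
end

section
/- Let d ≥ 3 and let μ be a finitely supported symmetric admissible probability measure on ℤ^d. Endow ℤ^d with any finite generating set S and the corresponding word length, and let S_n denote the sphere of radius n. Then there exists a constant C > 0 such that Σ_{x∈S_n} G(e,x) ∼ C n as n → ∞, i.e. (1/n) Σ_{x∈S_n} G(e,x) → C. -/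
open scoped Pointwise Classical
open Filter

namespace GreenGrowth
/-- The pairing of a point of the dual space with a lattice point. -/
noncomputable def pairing {d : ℕ} (θ : Fin d → ℝ) (x : Fin d → ℤ) : ℝ := ∑ i, θ i * (x i : ℝ)

/-- Convolution powers of a weight `m` with finite support `s` on the additive group `ℤ^d`. -/
noncomputable def latticeConv {d : ℕ} (s : Finset (Fin d → ℤ)) (m : (Fin d → ℤ) → ℝ) :
    ℕ → (Fin d → ℤ) → ℝ
  | 0 => fun x => if x = 0 then 1 else 0
  | k + 1 => fun x => ∑ y ∈ s, m y * latticeConv s m k (x - y)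

/-- The characteristic function of the weight `m` exponentially tilted by `η`. -/
noncomputable def tiltedChar {d : ℕ} (s : Finset (Fin d → ℤ)) (m : (Fin d → ℤ) → ℝ)
    (η θ : Fin d → ℝ) : ℂ :=
  ∑ y ∈ s, (m y : ℂ) * Complex.exp (pairing η y + pairing θ y * Complex.I)

/-- The cube `[-π, π]^d`. -/
def piCube (d : ℕ) : Set (Fin d → ℝ) := Set.Icc (fun _ => -Real.pi) (fun _ => Real.pi)

/-- The density at time `t` of the continuous-time random walk with step distribution `m`. -/
noncomputable def heat {d : ℕ} (s : Finset (Fin d → ℤ)) (m : (Fin d → ℤ) → ℝ) (t : ℝ)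
    (x : Fin d → ℤ) : ℝ :=
  ∑' k : ℕ, Real.exp (-t) * (t ^ k / k.factorial) * latticeConv s m k x

lemma pairing_sub {d : ℕ} (θ : Fin d → ℝ) (x y : Fin d → ℤ) :
    pairing θ (x - y) = pairing θ x - pairing θ y := by
  simp [pairing, mul_sub, Finset.sum_sub_distrib]

lemma pairing_add {d : ℕ} (θ : Fin d → ℝ) (x y : Fin d → ℤ) :
    pairing θ (x + y) = pairing θ x + pairing θ y := by
  simp [pairing, mul_add, Finset.sum_add_distrib]

lemma pairing_neg {d : ℕ} (θ : Fin d → ℝ) (x : Fin d → ℤ) :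
    pairing θ (-x) = -pairing θ x := by
  simp [pairing]

lemma pairing_zero_left {d : ℕ} (x : Fin d → ℤ) : pairing 0 x = 0 := by
  simp [pairing]

lemma pairing_zero_right {d : ℕ} (θ : Fin d → ℝ) : pairing θ 0 = 0 := by
  simp [pairing]

lemma pairing_smul {d : ℕ} (r : ℝ) (θ : Fin d → ℝ) (x : Fin d → ℤ) :
    pairing (r • θ) x = r * pairing θ x := by
  simp [pairing, Finset.mul_sum, mul_assoc]

@[fun_prop]
lemma continuous_pairing {d : ℕ} (x : Fin d → ℤ) :
    Continuous fun θ : Fin d → ℝ => pairing θ x := by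
  unfold pairing
  fun_prop

lemma abs_pairing_le {d : ℕ} (θ : Fin d → ℝ) (x : Fin d → ℤ) :
    |pairing θ x| ≤ ‖θ‖ * ∑ i, |(x i : ℝ)| := by
  unfold pairing
  rw [Finset.mul_sum]
  refine (Finset.abs_sum_le_sum_abs _ _).trans (Finset.sum_le_sum fun i _ => ?_)
  rw [abs_mul]
  gcongr
  exact norm_le_pi_norm θ i

@[fun_prop]
lemma continuous_tiltedChar {d : ℕ} (s : Finset (Fin d → ℤ)) (m : (Fin d → ℤ) → ℝ)
    (η : Fin d → ℝ) : Continuous fun θ => tiltedChar s m η θ := by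
  unfold tiltedChar
  fun_prop

lemma isCompact_piCube (d : ℕ) : IsCompact (piCube d) := isCompact_Icc

lemma measurableSet_piCube (d : ℕ) : MeasurableSet (piCube d) := measurableSet_Icc

lemma volume_real_piCube (d : ℕ) :
    MeasureTheory.volume.real (piCube d) = (2 * Real.pi) ^ d := by
  unfold piCube MeasureTheory.Measure.real
  rw [Real.volume_Icc_pi_toReal]
  · simp [two_mul]
  · intro i
    have := Real.pi_pos
    simp only
    linarith

lemma integral_exp_int_mul (n : ℤ) :
    ∫ θ in Set.Icc (-Real.pi) Real.pi, Complex.exp (-((θ * n : ℝ) : ℂ) * Complex.I) =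
      if n = 0 then ((2 * Real.pi : ℝ) : ℂ) else 0 := by
  have hπ := Real.pi_pos
  rw [MeasureTheory.integral_Icc_eq_integral_Ioc,
    ← intervalIntegral.integral_of_le (by linarith)]
  split_ifs with h
  · subst h
    simp
    ring
  · have hc : (-(n : ℂ) * Complex.I) ≠ 0 := by
      simp [h]
    have h1 : ∀ θ : ℝ, Complex.exp (-((θ * n : ℝ) : ℂ) * Complex.I) =
        Complex.exp ((-(n : ℂ) * Complex.I) * θ) := by
      intro θ
      push_cast
      ring_nf
    simp_rw [h1]
    rw [integral_exp_mul_complex hc]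
    have h2 : Complex.exp (-(n : ℂ) * Complex.I * (Real.pi : ℝ)) =
        Complex.exp (-(n : ℂ) * Complex.I * ((-Real.pi : ℝ) : ℂ)) := by
      rw [Complex.exp_eq_exp_iff_exists_int]
      refine ⟨-n, ?_⟩
      push_cast
      ring
    rw [h2, sub_self, zero_div]

lemma integral_piCube_exp {d : ℕ} (x : Fin d → ℤ) :
    ∫ θ in piCube d, Complex.exp (-(pairing θ x : ℂ) * Complex.I) =
      if x = 0 then (((2 * Real.pi) ^ d : ℝ) : ℂ) else 0 := by
  have h1 : ∀ θ : Fin d → ℝ, Complex.exp (-(pairing θ x : ℂ) * Complex.I) =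
      ∏ i, Complex.exp (-((θ i * (x i : ℤ) : ℝ) : ℂ) * Complex.I) := by
    intro θ
    rw [← Complex.exp_sum, ← Finset.sum_mul, Finset.sum_neg_distrib]
    simp [pairing]
  simp_rw [h1]
  unfold piCube
  rw [← Set.pi_univ_Icc, MeasureTheory.volume_pi, MeasureTheory.Measure.restrict_pi_pi,
    MeasureTheory.integral_fintype_prod_eq_prod
      (f := fun i (θ : ℝ) => Complex.exp (-((θ * (x i : ℤ) : ℝ) : ℂ) * Complex.I))]
  simp_rw [integral_exp_int_mul]
  split_ifs with h
  · simp [h]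
  · obtain ⟨i, hi⟩ : ∃ i, x i ≠ 0 := by
      by_contra! hcon
      exact h (funext hcon)
    exact Finset.prod_eq_zero (Finset.mem_univ i) (by simp [hi])

lemma integrableOn_piCube {d : ℕ} {f : (Fin d → ℝ) → ℂ} (hf : Continuous f) :
    MeasureTheory.IntegrableOn f (piCube d) :=
  hf.continuousOn.integrableOn_compact (isCompact_piCube d)

/-- Fourier inversion for the tilted convolution powers. -/
lemma latticeConv_fourier {d : ℕ} (s : Finset (Fin d → ℤ)) (m : (Fin d → ℤ) → ℝ)
    (η : Fin d → ℝ) (k : ℕ) (x : Fin d → ℤ) :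
    ((latticeConv s m k x * Real.exp (pairing η x) * (2 * Real.pi) ^ d : ℝ) : ℂ) =
      ∫ θ in piCube d, tiltedChar s m η θ ^ k * Complex.exp (-(pairing θ x : ℂ) * Complex.I) := by
  induction k generalizing x with
  | zero =>
    simp only [pow_zero, one_mul, integral_piCube_exp, latticeConv]
    split_ifs with h
    · simp [h, pairing_zero_right]
    · simp
  | succ k ih =>
    have h1 : ∀ θ : Fin d → ℝ,
        tiltedChar s m η θ ^ (k + 1) * Complex.exp (-(pairing θ x : ℂ) * Complex.I) =
        ∑ y ∈ s, (m y * Real.exp (pairing η y) : ℝ) * (tiltedChar s m η θ ^ k *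
          Complex.exp (-(pairing θ (x - y) : ℂ) * Complex.I)) := by
      intro θ
      rw [pow_succ, mul_assoc]
      nth_rw 2 [tiltedChar]
      rw [Finset.sum_mul, Finset.mul_sum]
      refine Finset.sum_congr rfl fun y _ => ?_
      rw [pairing_sub]
      push_cast
      have : Complex.exp (-((pairing θ x : ℂ) - pairing θ y) * Complex.I) =
          Complex.exp (pairing θ y * Complex.I) * Complex.exp (-(pairing θ x : ℂ) * Complex.I) := by
        rw [← Complex.exp_add]
        ring_nf
      rw [this, Complex.exp_add]
      ring
    simp_rw [h1]
    rw [MeasureTheory.integral_finsetSum]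
    · simp_rw [MeasureTheory.integral_const_mul, ← ih, latticeConv]
      push_cast
      rw [Finset.sum_mul, Finset.sum_mul]
      refine Finset.sum_congr rfl fun y _ => ?_
      rw [pairing_sub]
      push_cast
      rw [Complex.exp_sub]
      field_simp [Complex.exp_ne_zero]
    · intro y _
      exact (integrableOn_piCube (by fun_prop))

lemma latticeConv_nonneg {d : ℕ} {s : Finset (Fin d → ℤ)} {m : (Fin d → ℤ) → ℝ}
    (hm : ∀ y, 0 ≤ m y) (k : ℕ) (x : Fin d → ℤ) : 0 ≤ latticeConv s m k x := by
  induction k generalizing x with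
  | zero => simp only [latticeConv]; split_ifs <;> norm_num
  | succ k ih => exact Finset.sum_nonneg fun y _ => mul_nonneg (hm y) (ih _)

/-- Fourier inversion for the tilted continuous-time walk. -/
lemma heat_fourier {d : ℕ} (s : Finset (Fin d → ℤ)) (m : (Fin d → ℤ) → ℝ)
    (η : Fin d → ℝ) (t : ℝ) (x : Fin d → ℤ) :
    ((heat s m t x * Real.exp (pairing η x) * (2 * Real.pi) ^ d : ℝ) : ℂ) =
      ∫ θ in piCube d, Complex.exp (t * (tiltedChar s m η θ - 1)) *
        Complex.exp (-(pairing θ x : ℂ) * Complex.I) := by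
  obtain ⟨M, hM⟩ := (isCompact_piCube d).exists_bound_of_continuousOn
    (continuous_tiltedChar s m η).continuousOn
  have key : HasSum (fun k : ℕ => ∫ θ in piCube d, Complex.exp (-t) *
      ((t : ℂ) ^ k / k.factorial) * (tiltedChar s m η θ ^ k *
        Complex.exp (-(pairing θ x : ℂ) * Complex.I)))
      (∫ θ in piCube d, Complex.exp (t * (tiltedChar s m η θ - 1)) *
        Complex.exp (-(pairing θ x : ℂ) * Complex.I)) := by
    refine MeasureTheory.hasSum_integral_of_dominated_convergence
      (fun k _ => Real.exp (-t) * ((|t| * M) ^ k / k.factorial)) ?_ ?_ ?_ ?_ ?_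
    · intro k
      refine Continuous.aestronglyMeasurable ?_
      fun_prop
    · intro k
      refine (MeasureTheory.ae_restrict_iff' (measurableSet_piCube d)).mpr
        (Filter.Eventually.of_forall fun θ hθ => ?_)
      have h1 : ‖Complex.exp (-(pairing θ x : ℂ) * Complex.I)‖ = 1 := by
        rw [← Complex.ofReal_neg, Complex.norm_exp_ofReal_mul_I]
      rw [norm_mul, norm_mul, norm_mul, h1, ← Complex.ofReal_neg, Complex.norm_exp_ofReal,
        norm_div, norm_pow, norm_pow, Complex.norm_natCast, Complex.norm_real, Real.norm_eq_abs,
        mul_one, mul_pow, mul_assoc]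
      have := pow_le_pow_left₀ (norm_nonneg _) (hM θ hθ) k
      calc Real.exp (-t) * (|t| ^ k / k.factorial * ‖tiltedChar s m η θ‖ ^ k)
          ≤ Real.exp (-t) * (|t| ^ k / k.factorial * M ^ k) := by gcongr
        _ = _ := by ring
    · refine Filter.Eventually.of_forall fun θ => ?_
      exact (Real.summable_pow_div_factorial _).mul_left _
    · exact MeasureTheory.integrableOn_const (isCompact_piCube d).measure_lt_top.ne
    · refine Filter.Eventually.of_forall fun θ => ?_
      have h2 := (NormedSpace.expSeries_div_hasSum_exp (t * tiltedChar s m η θ))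
      rw [← Complex.exp_eq_exp_ℂ] at h2
      have h3 := (h2.mul_left (Complex.exp (-t))).mul_right
        (Complex.exp (-(pairing θ x : ℂ) * Complex.I))
      rw [← Complex.exp_add] at h3
      rw [show (t : ℂ) * (tiltedChar s m η θ - 1) = -t + t * tiltedChar s m η θ by ring]
      refine (congrArg (fun f => HasSum f _) (funext fun k => ?_)).mpr h3
      rw [mul_pow]
      ring
  rw [← key.tsum_eq]
  simp_rw [MeasureTheory.integral_const_mul, ← latticeConv_fourier]
  rw [heat, ← tsum_mul_right, ← tsum_mul_right, Complex.ofReal_tsum]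
  refine tsum_congr fun k => ?_
  push_cast
  ring
/-- A finitely supported symmetric probability weight on `ℤ^d` whose support generates `ℤ^d` as a
semigroup. -/
structure IsStepLaw {d : ℕ} (s : Finset (Fin d → ℤ)) (m : (Fin d → ℤ) → ℝ) : Prop where
  nonneg : ∀ y, 0 ≤ m y
  symm : ∀ y, m (-y) = m y
  zero_of_notMem : ∀ y ∉ s, m y = 0
  sum_eq_one : ∑ y ∈ s, m y = 1
  generates : ∀ x, ∃ k, 0 < latticeConv s m k x

/-- `1 - φ(θ)` where `φ` is the (real) characteristic function of a symmetric weight. -/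
noncomputable def charGap {d : ℕ} (s : Finset (Fin d → ℤ)) (m : (Fin d → ℤ) → ℝ)
    (θ : Fin d → ℝ) : ℝ := ∑ y ∈ s, m y * (1 - Real.cos (pairing θ y))

lemma one_sub_cos_add_le (a b : ℝ) :
    1 - Real.cos (a + b) ≤ 2 * (1 - Real.cos a) + 2 * (1 - Real.cos b) := by
  rw [Real.cos_add]
  nlinarith [sq_nonneg (Real.cos a + Real.cos b - 2), sq_nonneg (Real.sin a - Real.sin b),
    Real.sin_sq_add_cos_sq a, Real.sin_sq_add_cos_sq b]

lemma charGap_nonneg {d : ℕ} {s : Finset (Fin d → ℤ)} {m : (Fin d → ℤ) → ℝ}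
    (hm : ∀ y, 0 ≤ m y) (θ : Fin d → ℝ) : 0 ≤ charGap s m θ :=
  Finset.sum_nonneg fun y _ => mul_nonneg (hm y) (by linarith [Real.cos_le_one (pairing θ y)])

lemma exists_one_sub_cos_le_charGap {d : ℕ} {s : Finset (Fin d → ℤ)} {m : (Fin d → ℤ) → ℝ}
    (hm : ∀ y, 0 ≤ m y) {k : ℕ} {x : Fin d → ℤ} (hx : 0 < latticeConv s m k x) :
    ∃ C : ℝ, 0 ≤ C ∧ ∀ θ, 1 - Real.cos (pairing θ x) ≤ C * charGap s m θ := by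
  induction k generalizing x with
  | zero =>
    have : x = 0 := by
      by_contra h
      simp [latticeConv, h] at hx
    subst this
    exact ⟨0, le_rfl, by simp [pairing_zero_right]⟩
  | succ k ih =>
    obtain ⟨y, hy, hpos⟩ := Finset.exists_lt_of_sum_lt
      (f := fun _ : Fin d → ℤ => (0 : ℝ)) (by simpa [latticeConv] using hx)
    have hmy : 0 < m y := (hm y).lt_of_ne fun h => by simp [← h] at hpos
    obtain ⟨C, hC, hCle⟩ := ih (pos_of_mul_pos_right hpos hmy.le)
    refine ⟨2 / m y + 2 * C, by positivity, fun θ => ?_⟩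
    have h1 : m y * (1 - Real.cos (pairing θ y)) ≤ charGap s m θ :=
      Finset.single_le_sum (f := fun y => m y * (1 - Real.cos (pairing θ y)))
        (fun z _ => mul_nonneg (hm z) (by linarith [Real.cos_le_one (pairing θ z)])) hy
    have h2 : 1 - Real.cos (pairing θ y) ≤ charGap s m θ / m y := by
      rw [le_div_iff₀ hmy]
      linarith
    have h3 := one_sub_cos_add_le (pairing θ y) (pairing θ (x - y))
    rw [← pairing_add, add_sub_cancel] at h3
    have h4 := hCle θ
    calc 1 - Real.cos (pairing θ x)
        ≤ 2 * (charGap s m θ / m y) + 2 * (C * charGap s m θ) := by linarith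
      _ = _ := by ring

lemma exists_charGap_lower {d : ℕ} {s : Finset (Fin d → ℤ)} {m : (Fin d → ℤ) → ℝ}
    (h : IsStepLaw s m) :
    ∃ c : ℝ, 0 < c ∧ ∀ θ ∈ piCube d, c * ∑ i, θ i ^ 2 ≤ charGap s m θ := by
  have h1 : ∀ i : Fin d, ∃ C : ℝ, 0 ≤ C ∧ ∀ θ ∈ piCube d, θ i ^ 2 ≤ C * charGap s m θ := by
    intro i
    obtain ⟨k, hk⟩ := h.generates (Pi.single i 1)
    obtain ⟨C, hC, hCle⟩ := exists_one_sub_cos_le_charGap h.nonneg hk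
    refine ⟨Real.pi ^ 2 / 2 * C, by positivity, fun θ hθ => ?_⟩
    have h2 := hCle θ
    have h3 : pairing θ (Pi.single i 1) = θ i := by
      simp [pairing, Pi.single_apply]
    rw [h3] at h2
    have h4 := Real.cos_le_one_sub_mul_cos_sq (x := θ i) (abs_le.mpr ⟨hθ.1 i, hθ.2 i⟩)
    have h5 : 2 / Real.pi ^ 2 * θ i ^ 2 ≤ C * charGap s m θ := by linarith
    have hπ := Real.pi_pos
    calc θ i ^ 2 = Real.pi ^ 2 / 2 * (2 / Real.pi ^ 2 * θ i ^ 2) := by field_simp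
      _ ≤ Real.pi ^ 2 / 2 * (C * charGap s m θ) := by gcongr
      _ = _ := by ring
  choose C hC hCle using h1
  refine ⟨(1 + ∑ i, C i)⁻¹, ?_, fun θ hθ => ?_⟩
  · have := Finset.sum_nonneg fun i (_ : i ∈ Finset.univ) => hC i
    positivity
  · have h0 := Finset.sum_nonneg fun i (_ : i ∈ Finset.univ) => hC i
    rw [inv_mul_le_iff₀ (by positivity)]
    calc ∑ i, θ i ^ 2 ≤ ∑ i, C i * charGap s m θ := Finset.sum_le_sum fun i _ => hCle i θ hθ
      _ = (∑ i, C i) * charGap s m θ := by rw [Finset.sum_mul]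
      _ ≤ _ := by
        have := charGap_nonneg (s := s) h.nonneg θ
        nlinarith

lemma IsStepLaw.sum_neg {d : ℕ} {s : Finset (Fin d → ℤ)} {m : (Fin d → ℤ) → ℝ}
    (h : IsStepLaw s m) {E : Type*} [AddCommGroup E] [Module ℝ E] (f : (Fin d → ℤ) → E) :
    ∑ y ∈ s, m y • f (-y) = ∑ y ∈ s, m y • f y := by
  refine Finset.sum_bij_ne_zero (fun y _ _ => -y) ?_ ?_ ?_ ?_
  · intro y _ hy
    by_contra hcon
    have := h.zero_of_notMem _ hcon
    rw [h.symm] at this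
    simp [this] at hy
  · intro a _ _ b _ _ hab
    exact neg_injective hab
  · intro y _ hy
    refine ⟨-y, ?_, ?_, neg_neg y⟩
    · by_contra hcon
      have := h.zero_of_notMem _ hcon
      rw [h.symm] at this
      simp [this] at hy
    · rwa [h.symm, neg_neg]
  · intro y _ _
    rw [h.symm]

lemma IsStepLaw.tiltedChar_zero {d : ℕ} {s : Finset (Fin d → ℤ)} {m : (Fin d → ℤ) → ℝ}
    (h : IsStepLaw s m) (θ : Fin d → ℝ) :
    tiltedChar s m 0 θ - 1 = ((-charGap s m θ : ℝ) : ℂ) := by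
  have h1 := h.sum_neg fun y => Complex.exp (pairing θ y * Complex.I)
  have h2 : (2 : ℂ) * tiltedChar s m 0 θ = 2 * ∑ y ∈ s, (m y : ℂ) * Real.cos (pairing θ y) := by
    have h3 : tiltedChar s m 0 θ = ∑ y ∈ s, m y • Complex.exp (pairing θ y * Complex.I) := by
      simp [tiltedChar, pairing_zero_left]
    rw [two_mul]
    nth_rw 1 [h3]
    rw [← h1, h3, ← Finset.sum_add_distrib, Finset.mul_sum]
    refine Finset.sum_congr rfl fun y _ => ?_
    rw [pairing_neg, ← smul_add, Complex.real_smul, Complex.ofReal_cos, Complex.cos]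
    push_cast
    ring_nf
  have h4 := mul_left_cancel₀ two_ne_zero h2
  have h5 : ((∑ y ∈ s, m y : ℝ) : ℂ) = 1 := by rw [h.sum_eq_one, Complex.ofReal_one]
  rw [h4, charGap]
  push_cast at h5 ⊢
  simp_rw [mul_sub, Finset.sum_sub_distrib, mul_one, h5]
  ring

lemma IsStepLaw.tiltedChar_re {d : ℕ} {s : Finset (Fin d → ℤ)} {m : (Fin d → ℤ) → ℝ}
    (h : IsStepLaw s m) (η θ : Fin d → ℝ) :
    (tiltedChar s m η θ).re =
      ∑ y ∈ s, m y * (Real.cosh (pairing η y) * Real.cos (pairing θ y)) := by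
  have h0 : (tiltedChar s m η θ).re =
      ∑ y ∈ s, m y • (Real.exp (pairing η y) * Real.cos (pairing θ y)) := by
    rw [tiltedChar, Complex.re_sum]
    refine Finset.sum_congr rfl fun y _ => ?_
    rw [Complex.re_ofReal_mul, Complex.exp_re]
    simp
  have h1 := h.sum_neg fun y => Real.exp (pairing η y) * Real.cos (pairing θ y)
  have h2 : (2 : ℝ) * (tiltedChar s m η θ).re =
      2 * ∑ y ∈ s, m y * (Real.cosh (pairing η y) * Real.cos (pairing θ y)) := by
    rw [two_mul]
    nth_rw 1 [h0]
    rw [← h1, h0, ← Finset.sum_add_distrib, Finset.mul_sum]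
    refine Finset.sum_congr rfl fun y _ => ?_
    rw [pairing_neg, pairing_neg, Real.cos_neg, smul_eq_mul, smul_eq_mul, Real.cosh_eq]
    ring
  linarith

lemma IsStepLaw.exists_tiltedChar_re_le {d : ℕ} {s : Finset (Fin d → ℤ)}
    {m : (Fin d → ℤ) → ℝ} (h : IsStepLaw s m) :
    ∃ C : ℝ, 0 ≤ C ∧ ∀ η : Fin d → ℝ, ‖η‖ ≤ 1 → ∀ θ,
      (tiltedChar s m η θ).re - 1 ≤ -charGap s m θ + C * ‖η‖ ^ 2 := by
  let R : (Fin d → ℤ) → ℝ := fun y => ∑ i, |(y i : ℝ)|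
  refine ⟨∑ y ∈ s, m y * (R y ^ 2 / 2 * Real.exp (R y ^ 2 / 2)),
    Finset.sum_nonneg fun y _ => mul_nonneg (h.nonneg y) (by positivity), fun η hη θ => ?_⟩
  rw [h.tiltedChar_re, charGap]
  have h1 : ∀ y, Real.cosh (pairing η y) * Real.cos (pairing θ y) - 1 ≤
      -(1 - Real.cos (pairing θ y)) + R y ^ 2 / 2 * Real.exp (R y ^ 2 / 2) * ‖η‖ ^ 2 := by
    intro y
    have hR : 0 ≤ R y := Finset.sum_nonneg fun i _ => abs_nonneg _
    have hp : pairing η y ^ 2 ≤ (‖η‖ * R y) ^ 2 := sq_le_sq' (by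
      linarith [neg_abs_le (pairing η y), abs_pairing_le η y])
      ((le_abs_self _).trans (abs_pairing_le η y))
    have hp' : pairing η y ^ 2 ≤ R y ^ 2 := hp.trans (by
      apply pow_le_pow_left₀ (by positivity)
      exact mul_le_of_le_one_left hR hη)
    have h2 : Real.cosh (pairing η y) - 1 ≤
        pairing η y ^ 2 / 2 * Real.exp (pairing η y ^ 2 / 2) := by
      have h3 := Real.cosh_le_exp_half_sq (pairing η y)
      have h4 := Real.add_one_le_exp (-(pairing η y ^ 2 / 2))
      have h5 : Real.exp (pairing η y ^ 2 / 2) * Real.exp (-(pairing η y ^ 2 / 2)) = 1 := by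
        rw [← Real.exp_add]; simp
      nlinarith [Real.exp_pos (pairing η y ^ 2 / 2)]
    have h6 : pairing η y ^ 2 / 2 * Real.exp (pairing η y ^ 2 / 2) ≤
        (‖η‖ * R y) ^ 2 / 2 * Real.exp (R y ^ 2 / 2) := by gcongr
    have h7 : Real.cos (pairing θ y) * (Real.cosh (pairing η y) - 1) ≤
        Real.cosh (pairing η y) - 1 := by
      nlinarith [Real.one_le_cosh (pairing η y), Real.cos_le_one (pairing θ y)]
    nlinarith
  calc (∑ y ∈ s, m y * (Real.cosh (pairing η y) * Real.cos (pairing θ y))) - 1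
      = ∑ y ∈ s, m y * (Real.cosh (pairing η y) * Real.cos (pairing θ y) - 1) := by
        simp_rw [mul_sub, Finset.sum_sub_distrib, mul_one, h.sum_eq_one]
    _ ≤ ∑ y ∈ s, m y * (-(1 - Real.cos (pairing θ y)) +
          R y ^ 2 / 2 * Real.exp (R y ^ 2 / 2) * ‖η‖ ^ 2) :=
        Finset.sum_le_sum fun y _ => mul_le_mul_of_nonneg_left (h1 y) (h.nonneg y)
    _ = _ := by
        rw [← Finset.sum_neg_distrib, Finset.sum_mul, ← Finset.sum_add_distrib]
        refine Finset.sum_congr rfl fun y _ => ?_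
        ring

lemma integrable_exp_neg_sum_sq {d : ℕ} {c : ℝ} (hc : 0 < c) :
    MeasureTheory.Integrable fun θ : Fin d → ℝ => Real.exp (-(c * ∑ i, θ i ^ 2)) := by
  have h1 := MeasureTheory.Integrable.fintype_prod (ι := Fin d)
    (f := fun _ (u : ℝ) => Real.exp (-c * u ^ 2)) (fun _ => integrable_exp_neg_mul_sq hc)
  refine h1.congr (Filter.Eventually.of_forall fun θ => ?_)
  simp only
  rw [← Real.exp_sum, ← Finset.mul_sum, neg_mul]

lemma exists_integral_piCube_exp_le (d : ℕ) {c : ℝ} (hc : 0 < c) :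
    ∃ K : ℝ, 0 < K ∧ ∀ t : ℝ, 0 < t →
      ∫ θ in piCube d, Real.exp (-(c * t * ∑ i, θ i ^ 2)) ≤ K * (√(max 1 t) ^ d)⁻¹ := by
  set J := ∫ θ : Fin d → ℝ, Real.exp (-(c * ∑ i, θ i ^ 2)) with hJ
  have hJ0 : 0 ≤ J := MeasureTheory.integral_nonneg fun θ => (Real.exp_pos _).le
  have hπ := Real.pi_pos
  refine ⟨(2 * Real.pi) ^ d + J, by positivity, fun t ht => ?_⟩
  rcases le_total t 1 with h1 | h1
  · rw [max_eq_left h1]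
    simp only [Real.sqrt_one, one_pow, inv_one, mul_one]
    have h2 : ∫ θ in piCube d, Real.exp (-(c * t * ∑ i, θ i ^ 2)) ≤
        ∫ θ in piCube d, (1 : ℝ) := by
      refine MeasureTheory.setIntegral_mono_on ?_ ?_ (measurableSet_piCube d) fun θ _ => ?_
      · refine Continuous.continuousOn ?_ |>.integrableOn_compact (isCompact_piCube d)
        fun_prop
      · exact MeasureTheory.integrableOn_const (isCompact_piCube d).measure_lt_top.ne
      · refine Real.exp_le_one_iff.mpr ?_
        have := Finset.sum_nonneg fun i (_ : i ∈ Finset.univ) => sq_nonneg (θ i)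
        simp only [Left.neg_nonpos_iff]
        positivity
    rw [MeasureTheory.setIntegral_const, volume_real_piCube] at h2
    simp only [smul_eq_mul, mul_one] at h2
    linarith
  · rw [max_eq_right h1]
    have h3 : ∀ θ : Fin d → ℝ, Real.exp (-(c * t * ∑ i, θ i ^ 2)) =
        (fun θ : Fin d → ℝ => Real.exp (-(c * ∑ i, θ i ^ 2))) (√t • θ) := by
      intro θ
      simp only [Pi.smul_apply, smul_eq_mul, mul_pow, Real.sq_sqrt ht.le, ← Finset.mul_sum]
      ring_nf
    calc ∫ θ in piCube d, Real.exp (-(c * t * ∑ i, θ i ^ 2))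
        ≤ ∫ θ : Fin d → ℝ, Real.exp (-(c * t * ∑ i, θ i ^ 2)) :=
          MeasureTheory.setIntegral_le_integral (integrable_exp_neg_sum_sq (by positivity))
            (Filter.Eventually.of_forall fun θ => (Real.exp_pos _).le)
      _ = (√t ^ d)⁻¹ * J := by
          simp_rw [h3]
          rw [MeasureTheory.Measure.integral_comp_smul_of_nonneg MeasureTheory.volume
            (fun θ : Fin d → ℝ => Real.exp (-(c * ∑ i, θ i ^ 2))) √t (hR := Real.sqrt_nonneg t)]
          simp [hJ]
      _ ≤ _ := by
          rw [mul_comm]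
          gcongr
          have : 0 ≤ (2 * Real.pi) ^ d := by positivity
          linarith

/-- A sub-exponential heat kernel upper bound. -/
lemma IsStepLaw.exists_heat_le {d : ℕ} (hd : 0 < d) {s : Finset (Fin d → ℤ)}
    {m : (Fin d → ℤ) → ℝ} (h : IsStepLaw s m) :
    ∃ K : ℝ, 0 < K ∧ ∀ t : ℝ, 0 < t → ∀ x : Fin d → ℤ,
      |heat s m t x| ≤ K * (√(max 1 t) ^ d)⁻¹ * Real.exp (-(‖x‖ / √(max 1 t))) := by
  obtain ⟨c, hc, hcle⟩ := exists_charGap_lower h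
  obtain ⟨C, hC, hCle⟩ := h.exists_tiltedChar_re_le
  obtain ⟨K, hK, hKle⟩ := exists_integral_piCube_exp_le d hc
  have hπ := Real.pi_pos
  refine ⟨Real.exp C * K, by positivity, fun t ht x => ?_⟩
  set ρ := √(max 1 t) with hρ
  have hρ1 : 1 ≤ ρ := by
    rw [hρ]
    exact Real.one_le_sqrt.mpr (le_max_left _ _)
  have hρt : t ≤ ρ ^ 2 := by
    rw [hρ, Real.sq_sqrt (by positivity)]
    exact le_max_right _ _
  obtain ⟨i, hi⟩ : ∃ i, ‖x i‖ = ‖x‖ := by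
    have : Nonempty (Fin d) := ⟨⟨0, hd⟩⟩
    obtain ⟨i, _, hi⟩ := Finset.exists_mem_eq_sup' (Finset.univ_nonempty (α := Fin d))
      fun i => ‖x i‖₊
    refine ⟨i, ?_⟩
    rw [← coe_nnnorm, ← hi, Finset.sup'_eq_sup, Pi.norm_def]
  set η : Fin d → ℝ := Pi.single i (SignType.sign (x i : ℝ) * ρ⁻¹) with hη
  have hηx : pairing η x = ‖x‖ / ρ := by
    rw [← hi, pairing, Finset.sum_eq_single i]
    · simp only [hη, Pi.single_eq_same]
      rw [Int.norm_eq_abs, div_eq_mul_inv, mul_right_comm, sign_mul_self]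
    · intro j _ hj
      simp [hη, hj]
    · simp
  have hηn : ‖η‖ ≤ ρ⁻¹ := by
    refine (pi_norm_le_iff_of_nonneg (by positivity)).mpr fun j => ?_
    by_cases hj : j = i
    · subst hj
      simp only [hη, Pi.single_eq_same, norm_mul, norm_inv, Real.norm_eq_abs]
      rw [abs_of_pos (by positivity : 0 < ρ)]
      refine mul_le_of_le_one_left (by positivity) ?_
      rcases SignType.sign (x j : ℝ) with _ | _ | _ <;> simp
    · simp only [hη, Pi.single_eq_of_ne hj, norm_zero]
      positivity
  have hη1 : ‖η‖ ≤ 1 := hηn.trans (inv_le_one_of_one_le₀ hρ1)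
  have hF := heat_fourier s m η t x
  have hn : ‖∫ θ in piCube d, Complex.exp (t * (tiltedChar s m η θ - 1)) *
      Complex.exp (-(pairing θ x : ℂ) * Complex.I)‖ ≤
      ∫ θ in piCube d, Real.exp C * Real.exp (-(c * t * ∑ i, θ i ^ 2)) := by
    refine MeasureTheory.norm_integral_le_of_norm_le ?_ ?_
    · refine Continuous.continuousOn ?_ |>.integrableOn_compact (isCompact_piCube d)
      fun_prop
    · refine (MeasureTheory.ae_restrict_iff' (measurableSet_piCube d)).mpr
        (Filter.Eventually.of_forall fun θ hθ => ?_)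
      have h1 : ‖Complex.exp (-(pairing θ x : ℂ) * Complex.I)‖ = 1 := by
        rw [← Complex.ofReal_neg, Complex.norm_exp_ofReal_mul_I]
      rw [norm_mul, h1, mul_one, Complex.norm_exp, Complex.re_ofReal_mul, ← Real.exp_add,
        Complex.sub_re, Complex.one_re]
      refine Real.exp_le_exp.mpr ?_
      have h2 := hCle η hη1 θ
      have h3 := hcle θ hθ
      have h4 : t * (C * ‖η‖ ^ 2) ≤ C := by
        have h5 : ‖η‖ ^ 2 ≤ (ρ⁻¹) ^ 2 := pow_le_pow_left₀ (norm_nonneg _) hηn 2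
        have h6 : t * ‖η‖ ^ 2 ≤ 1 := by
          calc t * ‖η‖ ^ 2 ≤ ρ ^ 2 * (ρ⁻¹) ^ 2 := by gcongr
            _ = 1 := by rw [← mul_pow, mul_inv_cancel₀ (by positivity), one_pow]
        nlinarith
      calc t * ((tiltedChar s m η θ).re - 1)
          ≤ t * (-(c * ∑ i, θ i ^ 2) + C * ‖η‖ ^ 2) := by
            gcongr
            linarith
        _ ≤ _ := by linarith
  rw [← hF, Complex.norm_real, MeasureTheory.integral_const_mul, Real.norm_eq_abs, abs_mul,
    abs_mul, abs_of_pos (Real.exp_pos _), abs_of_pos (by positivity : 0 < (2 * Real.pi) ^ d),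
    hηx] at hn
  have h7 := hKle t ht
  have h8 : 1 ≤ (2 * Real.pi) ^ d := one_le_pow₀ (by linarith [Real.pi_gt_three])
  have h9 : |heat s m t x| * Real.exp (‖x‖ / ρ) ≤ Real.exp C * K * (ρ ^ d)⁻¹ :=
    calc |heat s m t x| * Real.exp (‖x‖ / ρ)
        ≤ |heat s m t x| * Real.exp (‖x‖ / ρ) * (2 * Real.pi) ^ d :=
          le_mul_of_one_le_right (by positivity) h8
      _ ≤ Real.exp C * (K * (ρ ^ d)⁻¹) := hn.trans (by gcongr)
      _ = _ := by ring
  rw [Real.exp_neg, ← div_eq_mul_inv, le_div_iff₀ (Real.exp_pos _)]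
  exact h9
/-- The Green function of the lattice walk. -/
noncomputable def latticeGreen {d : ℕ} (s : Finset (Fin d → ℤ)) (m : (Fin d → ℤ) → ℝ)
    (x : Fin d → ℤ) : ℝ := ∑' k : ℕ, latticeConv s m k x

lemma IsStepLaw.latticeConv_le_one {d : ℕ} {s : Finset (Fin d → ℤ)} {m : (Fin d → ℤ) → ℝ}
    (h : IsStepLaw s m) (k : ℕ) (x : Fin d → ℤ) : latticeConv s m k x ≤ 1 := by
  induction k generalizing x with
  | zero => simp only [latticeConv]; split_ifs <;> norm_num
  | succ k ih =>
    simp only [latticeConv]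
    rw [← h.sum_eq_one]
    exact Finset.sum_le_sum fun y _ => mul_le_of_le_one_right (h.nonneg y) (ih _)

lemma IsStepLaw.summable_heat {d : ℕ} {s : Finset (Fin d → ℤ)} {m : (Fin d → ℤ) → ℝ}
    (h : IsStepLaw s m) (t : ℝ) (x : Fin d → ℤ) :
    Summable fun k : ℕ => Real.exp (-t) * (t ^ k / k.factorial) * latticeConv s m k x := by
  refine Summable.of_norm_bounded
    (((Real.summable_pow_div_factorial |t|).mul_left (Real.exp (-t)))) fun k => ?_
  rw [norm_mul, norm_mul, Real.norm_of_nonneg (Real.exp_pos _).le,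
    Real.norm_of_nonneg (latticeConv_nonneg h.nonneg k x), norm_div, norm_pow, Real.norm_eq_abs,
    Real.norm_natCast]
  exact mul_le_of_le_one_right (by positivity) (h.latticeConv_le_one k x)

lemma IsStepLaw.measurable_heat {d : ℕ} {s : Finset (Fin d → ℤ)} {m : (Fin d → ℤ) → ℝ}
    (h : IsStepLaw s m) (x : Fin d → ℤ) : Measurable fun t => heat s m t x := by
  refine measurable_of_tendsto_metrizable (f := fun (n : ℕ) (t : ℝ) => ∑ k ∈ Finset.range n,
    Real.exp (-t) * (t ^ k / k.factorial) * latticeConv s m k x) (fun n => ?_) ?_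
  · fun_prop
  · rw [tendsto_pi_nhds]
    exact fun t => (h.summable_heat t x).hasSum.tendsto_sum_nat

lemma IsStepLaw.heat_nonneg {d : ℕ} {s : Finset (Fin d → ℤ)} {m : (Fin d → ℤ) → ℝ}
    (h : IsStepLaw s m) {t : ℝ} (ht : 0 ≤ t) (x : Fin d → ℤ) : 0 ≤ heat s m t x :=
  tsum_nonneg fun k => mul_nonneg (by positivity) (latticeConv_nonneg h.nonneg k x)

lemma integrableOn_inv_sqrt_max_pow {d : ℕ} (hd : 3 ≤ d) :
    MeasureTheory.IntegrableOn (fun t : ℝ => (√(max 1 t) ^ d)⁻¹) (Set.Ioi 0) := by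
  have hcont : Continuous fun t : ℝ => (√(max 1 t) ^ d)⁻¹ := by
    refine Continuous.inv₀ (by fun_prop) fun t => ?_
    have : 0 < max 1 t := by positivity
    positivity
  rw [← Set.Ioc_union_Ioi_eq_Ioi (zero_le_one (α := ℝ))]
  refine MeasureTheory.IntegrableOn.union ?_ ?_
  · exact (hcont.continuousOn.integrableOn_compact isCompact_Icc).mono_set Set.Ioc_subset_Icc_self
  · have h1 := integrableOn_Ioi_rpow_of_lt (a := -(3 / 2 : ℝ)) (by norm_num) one_pos
    refine MeasureTheory.Integrable.mono' h1 hcont.aestronglyMeasurable ?_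
    refine (MeasureTheory.ae_restrict_iff' measurableSet_Ioi).mpr
      (Filter.Eventually.of_forall fun t ht => ?_)
    have ht1 : (1 : ℝ) ≤ t := le_of_lt ht
    have h2 : 1 ≤ √t := Real.one_le_sqrt.mpr ht1
    rw [max_eq_right ht1, Real.norm_of_nonneg (by positivity), Real.rpow_neg (by linarith)]
    have h3 : t ^ (3 / 2 : ℝ) = √t ^ 3 := by
      rw [Real.sqrt_eq_rpow, ← Real.rpow_natCast, ← Real.rpow_mul (by linarith)]
      norm_num
    rw [h3]
    gcongr

lemma lintegral_gamma_density (k : ℕ) :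
    ∫⁻ t in Set.Ioi (0 : ℝ), ENNReal.ofReal (Real.exp (-t) * (t ^ k / k.factorial)) = 1 := by
  have h1 : ∀ t ∈ Set.Ioi (0 : ℝ), Real.exp (-t) * t ^ ((k + 1 : ℝ) - 1) / k.factorial =
      Real.exp (-t) * (t ^ k / k.factorial) := by
    intro t _
    rw [add_sub_cancel_right, Real.rpow_natCast, mul_div_assoc]
  have hInt : MeasureTheory.IntegrableOn
      (fun t : ℝ => Real.exp (-t) * (t ^ k / k.factorial)) (Set.Ioi 0) :=
    MeasureTheory.IntegrableOn.congr_fun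
      ((Real.GammaIntegral_convergent (s := (k + 1 : ℝ)) (by positivity)).div_const _)
      h1 measurableSet_Ioi
  rw [← MeasureTheory.ofReal_integral_eq_lintegral_ofReal hInt,
    ← MeasureTheory.setIntegral_congr_fun measurableSet_Ioi h1, MeasureTheory.integral_div,
    ← Real.Gamma_eq_integral (by positivity), Real.Gamma_nat_eq_factorial,
    div_self (by positivity), ENNReal.ofReal_one]
  refine (MeasureTheory.ae_restrict_iff' measurableSet_Ioi).mpr
    (Filter.Eventually.of_forall fun t ht => ?_)
  have : (0 : ℝ) < t := ht
  simp only [Pi.zero_apply]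
  positivity

lemma IsStepLaw.latticeGreen_eq_integral {d : ℕ} {s : Finset (Fin d → ℤ)}
    {m : (Fin d → ℤ) → ℝ} (h : IsStepLaw s m) (x : Fin d → ℤ) :
    latticeGreen s m x = ∫ t in Set.Ioi 0, heat s m t x := by
  have hnn : ∀ k, 0 ≤ latticeConv s m k x := fun k => latticeConv_nonneg h.nonneg k x
  have h1 : ∫⁻ t in Set.Ioi (0 : ℝ), ENNReal.ofReal (heat s m t x) =
      ∑' k, ENNReal.ofReal (latticeConv s m k x) := by
    calc ∫⁻ t in Set.Ioi (0 : ℝ), ENNReal.ofReal (heat s m t x)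
        = ∫⁻ t in Set.Ioi (0 : ℝ), ∑' k : ℕ, ENNReal.ofReal
            (Real.exp (-t) * (t ^ k / k.factorial)) * ENNReal.ofReal (latticeConv s m k x) := by
          refine MeasureTheory.setLIntegral_congr_fun measurableSet_Ioi fun t ht => ?_
          have ht0 : (0 : ℝ) < t := ht
          rw [heat, ENNReal.ofReal_tsum_of_nonneg (fun k => mul_nonneg (by positivity) (hnn k))
            (h.summable_heat t x)]
          exact tsum_congr fun k => ENNReal.ofReal_mul (by positivity)
      _ = _ := by
          rw [MeasureTheory.lintegral_tsum (fun k => by fun_prop)]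
          refine tsum_congr fun k => ?_
          rw [MeasureTheory.lintegral_mul_const _ (by fun_prop), lintegral_gamma_density, one_mul]
  rw [MeasureTheory.integral_eq_lintegral_of_nonneg_ae, h1, ENNReal.tsum_toReal_eq]
  · simp_rw [ENNReal.toReal_ofReal (hnn _)]
    rfl
  · exact fun k => ENNReal.ofReal_ne_top
  · refine (MeasureTheory.ae_restrict_iff' measurableSet_Ioi).mpr
      (Filter.Eventually.of_forall fun t ht => h.heat_nonneg (le_of_lt ht) x)
  · exact (h.measurable_heat x).aestronglyMeasurable

lemma IsStepLaw.scaled_latticeGreen {d : ℕ} (hd : 3 ≤ d) {s : Finset (Fin d → ℤ)}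
    {m : (Fin d → ℤ) → ℝ} (h : IsStepLaw s m) {n : ℕ} (hn : 0 < n) (x : Fin d → ℤ) :
    (n : ℝ) ^ (d - 2) * latticeGreen s m x =
      ∫ t in Set.Ioi 0, (n : ℝ) ^ d * heat s m ((n : ℝ) ^ 2 * t) x := by
  have hn' : (0 : ℝ) < n := by exact_mod_cast hn
  rw [MeasureTheory.integral_const_mul, MeasureTheory.integral_comp_mul_left_Ioi
    (fun t => heat s m t x) 0 (by positivity : (0 : ℝ) < (n : ℝ) ^ 2), mul_zero,
    ← h.latticeGreen_eq_integral, smul_eq_mul, ← mul_assoc]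
  congr 1
  rw [← div_eq_mul_inv, eq_div_iff (by positivity), ← pow_add]
  congr 1
  omega

lemma IsStepLaw.exists_scaled_heat_le {d : ℕ} (hd : 3 ≤ d) {s : Finset (Fin d → ℤ)}
    {m : (Fin d → ℤ) → ℝ} (h : IsStepLaw s m) {c : ℝ} (hc : 0 < c) :
    ∃ K : ℝ, 0 < K ∧ ∀ n : ℕ, 0 < n → ∀ x : Fin d → ℤ, c * n ≤ ‖x‖ → ∀ t : ℝ, 0 < t →
      (n : ℝ) ^ d * heat s m ((n : ℝ) ^ 2 * t) x ≤ K * (√(max 1 t) ^ d)⁻¹ := by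
  obtain ⟨K, hK, hle⟩ := h.exists_heat_le (by omega)
  refine ⟨K + K * (d.factorial / c ^ d), by positivity, fun n hn x hx t ht => ?_⟩
  have hn' : (0 : ℝ) < n := by exact_mod_cast hn
  set ρ := √(max 1 ((n : ℝ) ^ 2 * t)) with hρ
  have hρ1 : 1 ≤ ρ := Real.one_le_sqrt.mpr (le_max_left _ _)
  have hρ0 : 0 < ρ := by linarith
  have h1 := (le_abs_self _).trans (hle ((n : ℝ) ^ 2 * t) (by positivity) x)
  rw [← hρ] at h1
  have hxpos : 0 < ‖x‖ := lt_of_lt_of_le (by positivity) hx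
  have hC : 0 ≤ K * (d.factorial / c ^ d) := by positivity
  rcases le_total t 1 with h2 | h2
  · rw [max_eq_left h2]
    simp only [Real.sqrt_one, one_pow, inv_one, mul_one]
    have h3 : Real.exp (-(‖x‖ / ρ)) ≤ d.factorial * (ρ / ‖x‖) ^ d := by
      have h4 := Real.pow_div_factorial_le_exp (‖x‖ / ρ) (by positivity) d
      rw [Real.exp_neg, ← inv_inv ((d.factorial : ℝ) * (ρ / ‖x‖) ^ d)]
      refine inv_anti₀ (by positivity) (le_trans (le_of_eq ?_) h4)
      rw [mul_inv, ← inv_pow, inv_div]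
      ring
    have h5 : (n : ℝ) ^ d * heat s m ((n : ℝ) ^ 2 * t) x ≤ K * (d.factorial / c ^ d) :=
      calc (n : ℝ) ^ d * heat s m ((n : ℝ) ^ 2 * t) x
          ≤ (n : ℝ) ^ d * (K * (ρ ^ d)⁻¹ * (d.factorial * (ρ / ‖x‖) ^ d)) := by
            gcongr
            exact h1.trans (by gcongr)
        _ = K * (d.factorial * ((n : ℝ) / ‖x‖) ^ d) := by
            rw [div_pow, div_pow]
            field_simp
        _ ≤ K * (d.factorial * (1 / c) ^ d) := by
            gcongr K * (_ * ?_ ^ d)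
            rw [div_le_div_iff₀ hxpos hc]
            linarith
        _ = _ := by rw [one_div, inv_pow, div_eq_mul_inv]
    linarith
  · rw [max_eq_right h2]
    have h3 : (n : ℝ) * √t ≤ ρ := by
      rw [hρ]
      refine Real.le_sqrt_of_sq_le (le_trans (le_of_eq ?_) (le_max_right _ _))
      rw [mul_pow, Real.sq_sqrt ht.le]
    have ht' : 0 < √t := Real.sqrt_pos.mpr ht
    have h4 : Real.exp (-(‖x‖ / ρ)) ≤ 1 := by
      refine Real.exp_le_one_iff.mpr ?_
      simp only [Left.neg_nonpos_iff]
      positivity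
    calc (n : ℝ) ^ d * heat s m ((n : ℝ) ^ 2 * t) x
        ≤ (n : ℝ) ^ d * (K * (((n : ℝ) * √t) ^ d)⁻¹ * 1) := by
          gcongr
          exact h1.trans (by gcongr)
      _ = K * (√t ^ d)⁻¹ := by
          rw [mul_pow]
          field_simp
      _ ≤ _ := by
          gcongr
          linarith

lemma IsStepLaw.latticeGreen_nonneg {d : ℕ} {s : Finset (Fin d → ℤ)}
    {m : (Fin d → ℤ) → ℝ} (h : IsStepLaw s m) (x : Fin d → ℤ) : 0 ≤ latticeGreen s m x :=
  tsum_nonneg fun k => latticeConv_nonneg h.nonneg k x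

lemma IsStepLaw.exists_scaled_latticeGreen_le {d : ℕ} (hd : 3 ≤ d) {s : Finset (Fin d → ℤ)}
    {m : (Fin d → ℤ) → ℝ} (h : IsStepLaw s m) {c : ℝ} (hc : 0 < c) :
    ∃ K : ℝ, ∀ n : ℕ, 0 < n → ∀ x : Fin d → ℤ, c * n ≤ ‖x‖ →
      (n : ℝ) ^ (d - 2) * latticeGreen s m x ≤ K := by
  obtain ⟨K, hK, hle⟩ := h.exists_scaled_heat_le hd hc
  refine ⟨∫ t in Set.Ioi 0, K * (√(max 1 t) ^ d)⁻¹, fun n hn x hx => ?_⟩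
  rw [h.scaled_latticeGreen hd hn]
  refine MeasureTheory.integral_mono_of_nonneg ?_
    ((integrableOn_inv_sqrt_max_pow hd).const_mul K) ?_
  · refine (MeasureTheory.ae_restrict_iff' measurableSet_Ioi).mpr
      (Filter.Eventually.of_forall fun t ht => ?_)
    have ht0 : (0 : ℝ) < t := ht
    exact mul_nonneg (by positivity) (h.heat_nonneg (by positivity) x)
  · exact (MeasureTheory.ae_restrict_iff' measurableSet_Ioi).mpr
      (Filter.Eventually.of_forall fun t ht => hle n hn x hx t ht)
/-- The limiting quadratic form `Q(u) = ½ Σ m(y) ⟨u, y⟩²`. -/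
noncomputable def covForm {d : ℕ} (s : Finset (Fin d → ℤ)) (m : (Fin d → ℤ) → ℝ)
    (u : Fin d → ℝ) : ℝ := ∑ y ∈ s, m y * (pairing u y ^ 2 / 2)

/-- The (unnormalized) limiting Gaussian kernel. -/
noncomputable def gaussKernel {d : ℕ} (s : Finset (Fin d → ℤ)) (m : (Fin d → ℤ) → ℝ) (t : ℝ)
    (z : Fin d → ℝ) : ℂ :=
  ∫ u : Fin d → ℝ, Complex.exp (-(t * covForm s m u : ℝ)) *
    Complex.exp (-((∑ i, u i * z i : ℝ) : ℂ) * Complex.I)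

/-- The limiting (Newtonian) Green kernel. -/
noncomputable def newtonKernel {d : ℕ} (s : Finset (Fin d → ℤ)) (m : (Fin d → ℤ) → ℝ)
    (z : Fin d → ℝ) : ℝ :=
  ∫ t in Set.Ioi (0 : ℝ), (gaussKernel s m t z).re / (2 * Real.pi) ^ d

@[fun_prop]
lemma continuous_covForm {d : ℕ} (s : Finset (Fin d → ℤ)) (m : (Fin d → ℤ) → ℝ) :
    Continuous fun u => covForm s m u := by
  unfold covForm
  fun_prop

lemma covForm_smul {d : ℕ} (s : Finset (Fin d → ℤ)) (m : (Fin d → ℤ) → ℝ) (r : ℝ)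
    (u : Fin d → ℝ) : covForm s m (r • u) = r ^ 2 * covForm s m u := by
  unfold covForm
  rw [Finset.mul_sum]
  refine Finset.sum_congr rfl fun y _ => ?_
  rw [pairing_smul]
  ring

lemma tendsto_sq_mul_one_sub_cos (a : ℝ) :
    Tendsto (fun n : ℕ => (n : ℝ) ^ 2 * (1 - Real.cos ((n : ℝ)⁻¹ * a))) atTop
      (nhds (a ^ 2 / 2)) := by
  have h1 : Tendsto (fun n : ℕ => a ^ 2 / 2 * Real.sinc ((n : ℝ)⁻¹ * (a / 2)) ^ 2) atTop
      (nhds (a ^ 2 / 2 * Real.sinc (0 * (a / 2)) ^ 2)) := by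
    refine ((Real.continuous_sinc.tendsto _).comp ?_ |>.pow 2).const_mul _
    exact tendsto_inv_atTop_nhds_zero_nat.mul_const _
  rw [zero_mul, Real.sinc_zero, one_pow, mul_one] at h1
  refine h1.congr' ?_
  filter_upwards [eventually_gt_atTop 0] with n hn
  have hn' : (0 : ℝ) < n := by exact_mod_cast hn
  have h2 : Real.cos ((n : ℝ)⁻¹ * a) = 1 - 2 * Real.sin ((n : ℝ)⁻¹ * (a / 2)) ^ 2 := by
    rw [show (n : ℝ)⁻¹ * a = 2 * ((n : ℝ)⁻¹ * (a / 2)) by ring, Real.cos_two_mul]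
    linarith [Real.sin_sq_add_cos_sq ((n : ℝ)⁻¹ * (a / 2))]
  rw [h2]
  by_cases ha : a = 0
  · simp [ha]
  · rw [Real.sinc_of_ne_zero (by positivity)]
    field_simp
    ring

lemma tendsto_sq_mul_charGap {d : ℕ} (s : Finset (Fin d → ℤ)) (m : (Fin d → ℤ) → ℝ)
    (u : Fin d → ℝ) :
    Tendsto (fun n : ℕ => (n : ℝ) ^ 2 * charGap s m ((n : ℝ)⁻¹ • u)) atTop
      (nhds (covForm s m u)) := by
  simp only [charGap, covForm, Finset.mul_sum]
  refine tendsto_finsetSum _ fun y _ => ?_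
  refine ((tendsto_sq_mul_one_sub_cos (pairing u y)).const_mul (m y)).congr fun n => ?_
  rw [pairing_smul]
  ring

lemma eventually_inv_smul_mem_piCube {d : ℕ} (u : Fin d → ℝ) :
    ∀ᶠ n : ℕ in atTop, (n : ℝ)⁻¹ • u ∈ piCube d := by
  have h1 : Tendsto (fun n : ℕ => (n : ℝ)⁻¹ • u) atTop (nhds ((0 : ℝ) • u)) :=
    tendsto_inv_atTop_nhds_zero_nat.smul_const u
  rw [zero_smul] at h1
  refine h1.eventually_mem ?_
  unfold piCube
  rw [← Set.pi_univ_Icc]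
  refine set_pi_mem_nhds Set.finite_univ fun i _ => Icc_mem_nhds ?_ ?_
  · simpa using Real.pi_pos
  · simpa using Real.pi_pos

lemma IsStepLaw.exists_covForm_lower {d : ℕ} {s : Finset (Fin d → ℤ)} {m : (Fin d → ℤ) → ℝ}
    (h : IsStepLaw s m) : ∃ c : ℝ, 0 < c ∧ ∀ u, c * ∑ i, u i ^ 2 ≤ covForm s m u := by
  obtain ⟨c, hc, hle⟩ := exists_charGap_lower h
  refine ⟨c, hc, fun u => ?_⟩
  refine ge_of_tendsto (tendsto_sq_mul_charGap s m u) ?_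
  filter_upwards [eventually_inv_smul_mem_piCube u, eventually_gt_atTop 0] with n hn hn0
  have hn' : (0 : ℝ) < n := by exact_mod_cast hn0
  have h1 := hle _ hn
  calc c * ∑ i, u i ^ 2 = (n : ℝ) ^ 2 * (c * ∑ i, ((n : ℝ)⁻¹ • u) i ^ 2) := by
        simp only [Pi.smul_apply, smul_eq_mul, mul_pow, ← Finset.mul_sum]
        field_simp
    _ ≤ _ := by gcongr

/-- The local central limit theorem at the diffusive scale. -/
lemma IsStepLaw.tendsto_scaled_heat {d : ℕ} {s : Finset (Fin d → ℤ)} {m : (Fin d → ℤ) → ℝ}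
    (h : IsStepLaw s m) {t : ℝ} (ht : 0 < t) {x : ℕ → Fin d → ℤ} {z : Fin d → ℝ}
    (hz : ∀ i, Tendsto (fun n => (x n i : ℝ) / n) atTop (nhds (z i))) :
    Tendsto (fun n : ℕ => (n : ℝ) ^ d * heat s m ((n : ℝ) ^ 2 * t) (x n)) atTop
      (nhds ((gaussKernel s m t z).re / (2 * Real.pi) ^ d)) := by
  obtain ⟨c, hc, hle⟩ := exists_charGap_lower h
  have hπ := Real.pi_pos
  let F : ℕ → (Fin d → ℝ) → ℂ := fun n => (piCube d).indicator fun θ =>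
    Complex.exp ((((n : ℝ) ^ 2 * t : ℝ) : ℂ) * (tiltedChar s m 0 θ - 1)) *
      Complex.exp (-(pairing θ (x n) : ℂ) * Complex.I)
  have hF : ∀ n : ℕ, 0 < n → (((n : ℝ) ^ d * heat s m ((n : ℝ) ^ 2 * t) (x n) *
      (2 * Real.pi) ^ d : ℝ) : ℂ) = ∫ u, F n ((n : ℝ)⁻¹ • u) := by
    intro n hn
    have hn' : (0 : ℝ) < n := by exact_mod_cast hn
    rw [MeasureTheory.Measure.integral_comp_smul_of_nonneg MeasureTheory.volume (F n) (n : ℝ)⁻¹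
      (hR := by positivity), MeasureTheory.integral_indicator (measurableSet_piCube d),
      ← heat_fourier]
    simp [pairing_zero_left]
    ring
  have hlim : Tendsto (fun n : ℕ => ∫ u, F n ((n : ℝ)⁻¹ • u)) atTop
      (nhds (gaussKernel s m t z)) := by
    refine MeasureTheory.tendsto_integral_filter_of_dominated_convergence
      (fun u => Real.exp (-(c * t * ∑ i, u i ^ 2))) ?_ ?_ ?_ ?_
    · refine Filter.Eventually.of_forall fun n => ?_
      refine Measurable.aestronglyMeasurable ?_
      refine Measurable.comp (g := F n) ?_ (by fun_prop)
      refine Measurable.indicator (Continuous.measurable ?_) (measurableSet_piCube d)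
      fun_prop
    · filter_upwards [eventually_gt_atTop 0] with n hn
      have hn' : (0 : ℝ) < n := by exact_mod_cast hn
      refine Filter.Eventually.of_forall fun u => ?_
      by_cases hu : (n : ℝ)⁻¹ • u ∈ piCube d
      · have h1 : ‖Complex.exp (-(pairing ((n : ℝ)⁻¹ • u) (x n) : ℂ) * Complex.I)‖ = 1 := by
          rw [← Complex.ofReal_neg, Complex.norm_exp_ofReal_mul_I]
        simp only [F, Set.indicator_of_mem hu]
        rw [norm_mul, h1, mul_one, h.tiltedChar_zero, ← Complex.ofReal_mul,
          Complex.norm_exp_ofReal]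
        refine Real.exp_le_exp.mpr ?_
        rw [mul_neg, neg_le_neg_iff]
        calc c * t * ∑ i, u i ^ 2
            = (n : ℝ) ^ 2 * t * (c * ∑ i, ((n : ℝ)⁻¹ • u) i ^ 2) := by
              simp only [Pi.smul_apply, smul_eq_mul, mul_pow, ← Finset.mul_sum]
              field_simp
          _ ≤ _ := by
              gcongr
              exact hle _ hu
      · simp only [F, Set.indicator_of_notMem hu, norm_zero]
        positivity
    · exact integrable_exp_neg_sum_sq (by positivity)
    · refine Filter.Eventually.of_forall fun u => ?_
      have h2 : Tendsto (fun n : ℕ => Complex.exp (-(t * ((n : ℝ) ^ 2 *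
          charGap s m ((n : ℝ)⁻¹ • u)) : ℝ)) *
          Complex.exp (-((∑ i, u i * ((x n i : ℝ) / n) : ℝ) : ℂ) * Complex.I)) atTop
          (nhds (Complex.exp (-(t * covForm s m u : ℝ)) *
            Complex.exp (-((∑ i, u i * z i : ℝ) : ℂ) * Complex.I))) := by
        refine Tendsto.mul ?_ ?_
        · refine (Complex.continuous_exp.tendsto _).comp ?_
          refine ((Complex.continuous_ofReal.tendsto _).comp ?_).neg
          exact (tendsto_sq_mul_charGap s m u).const_mul t
        · refine (Complex.continuous_exp.tendsto _).comp ?_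
          refine Tendsto.mul_const _ ?_
          refine ((Complex.continuous_ofReal.tendsto _).comp ?_).neg
          exact tendsto_finsetSum _ fun i _ => (hz i).const_mul _
      refine h2.congr' ?_
      filter_upwards [eventually_inv_smul_mem_piCube u] with n hu
      simp only [F, Set.indicator_of_mem hu]
      rw [h.tiltedChar_zero, pairing_smul]
      congr 2
      · push_cast
        ring
      · congr 3
        rw [pairing, Finset.mul_sum]
        refine Finset.sum_congr rfl fun i _ => ?_
        ring
  have hre : Tendsto (fun n : ℕ => (∫ u, F n ((n : ℝ)⁻¹ • u)).re / (2 * Real.pi) ^ d) atTop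
      (nhds ((gaussKernel s m t z).re / (2 * Real.pi) ^ d)) :=
    ((Complex.continuous_re.tendsto _).comp hlim).div_const _
  refine hre.congr' ?_
  filter_upwards [eventually_gt_atTop 0] with n hn
  rw [← hF n hn, Complex.ofReal_re, mul_div_assoc, div_self (by positivity), mul_one]

lemma IsStepLaw.eventually_gaussKernel_re_pos {d : ℕ} {s : Finset (Fin d → ℤ)}
    {m : (Fin d → ℤ) → ℝ} (h : IsStepLaw s m) (z : Fin d → ℝ) :
    ∀ᶠ t : ℝ in atTop, 0 < (gaussKernel s m t z).re := by
  obtain ⟨c, hc, hle⟩ := h.exists_covForm_lower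
  have hscale : ∀ t : ℝ, 0 < t → gaussKernel s m t z = ((√t ^ d)⁻¹ : ℝ) •
      ∫ v : Fin d → ℝ, Complex.exp (-(covForm s m v : ℝ)) *
        Complex.exp (-(((√t)⁻¹ * ∑ i, v i * z i : ℝ) : ℂ) * Complex.I) := by
    intro t ht
    have ht' : 0 < √t := Real.sqrt_pos.mpr ht
    have h1 := MeasureTheory.Measure.integral_comp_smul_of_nonneg MeasureTheory.volume
      (fun v : Fin d → ℝ => Complex.exp (-(covForm s m v : ℝ)) *
        Complex.exp (-(((√t)⁻¹ * ∑ i, v i * z i : ℝ) : ℂ) * Complex.I)) √t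
      (hR := Real.sqrt_nonneg t)
    rw [Module.finrank_fin_fun] at h1
    rw [← h1, gaussKernel]
    congr 1
    ext u
    rw [covForm_smul, Real.sq_sqrt ht.le]
    congr 5
    simp only [Pi.smul_apply, smul_eq_mul, mul_assoc, ← Finset.mul_sum]
    field_simp
  have hlim : Tendsto (fun t : ℝ => ∫ v : Fin d → ℝ, Complex.exp (-(covForm s m v : ℝ)) *
        Complex.exp (-(((√t)⁻¹ * ∑ i, v i * z i : ℝ) : ℂ) * Complex.I)) atTop
      (nhds (∫ v : Fin d → ℝ, Complex.exp (-(covForm s m v : ℝ)) *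
        Complex.exp (-((0 * ∑ i, v i * z i : ℝ) : ℂ) * Complex.I))) := by
    refine MeasureTheory.tendsto_integral_filter_of_dominated_convergence
      (fun u => Real.exp (-(c * ∑ i, u i ^ 2))) ?_ ?_ ?_ ?_
    · refine Filter.Eventually.of_forall fun t => Continuous.aestronglyMeasurable ?_
      fun_prop
    · refine Filter.Eventually.of_forall fun t => Filter.Eventually.of_forall fun u => ?_
      rw [norm_mul, ← Complex.ofReal_neg, ← Complex.ofReal_neg, Complex.norm_exp_ofReal_mul_I,
        Complex.norm_exp_ofReal, mul_one]
      exact Real.exp_le_exp.mpr (neg_le_neg (hle u))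
    · exact integrable_exp_neg_sum_sq hc
    · refine Filter.Eventually.of_forall fun u => ?_
      refine Tendsto.const_mul _ ((Complex.continuous_exp.tendsto _).comp ?_)
      refine Tendsto.mul_const _ ((Complex.continuous_ofReal.tendsto _).comp ?_).neg
      exact (tendsto_inv_atTop_zero.comp Real.tendsto_sqrt_atTop).mul_const _
  have hval : (∫ v : Fin d → ℝ, Complex.exp (-(covForm s m v : ℝ)) *
        Complex.exp (-((0 * ∑ i, v i * z i : ℝ) : ℂ) * Complex.I)) =
      ((∫ v : Fin d → ℝ, Real.exp (-covForm s m v) : ℝ) : ℂ) := by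
    rw [← integral_complex_ofReal]
    congr 1
    ext v
    simp
  rw [hval] at hlim
  have hInt : MeasureTheory.Integrable fun v : Fin d → ℝ => Real.exp (-covForm s m v) := by
    refine (integrable_exp_neg_sum_sq hc).mono' (Continuous.aestronglyMeasurable (by fun_prop))
      (Filter.Eventually.of_forall fun u => ?_)
    rw [Real.norm_of_nonneg (Real.exp_pos _).le]
    exact Real.exp_le_exp.mpr (neg_le_neg (hle u))
  have hpos : 0 < ∫ v : Fin d → ℝ, Real.exp (-covForm s m v) :=
    MeasureTheory.integral_exp_pos hInt
  have hre := (Complex.continuous_re.tendsto _).comp hlim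
  rw [Complex.ofReal_re] at hre
  filter_upwards [hre.eventually (lt_mem_nhds hpos), eventually_gt_atTop 0] with t h1 h2
  rw [hscale t h2, Complex.smul_re]
  have ht' : 0 < √t := Real.sqrt_pos.mpr h2
  exact smul_pos (by positivity) h1

/-- Asymptotics of the Green function. -/
lemma IsStepLaw.tendsto_scaled_latticeGreen {d : ℕ} (hd : 3 ≤ d) {s : Finset (Fin d → ℤ)}
    {m : (Fin d → ℤ) → ℝ} (h : IsStepLaw s m) {c : ℝ} (hc : 0 < c) {x : ℕ → Fin d → ℤ}
    {z : Fin d → ℝ} (hx : ∀ᶠ n : ℕ in atTop, c * n ≤ ‖x n‖)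
    (hz : ∀ i, Tendsto (fun n => (x n i : ℝ) / n) atTop (nhds (z i))) :
    Tendsto (fun n : ℕ => (n : ℝ) ^ (d - 2) * latticeGreen s m (x n)) atTop
      (nhds (newtonKernel s m z)) ∧ 0 < newtonKernel s m z := by
  obtain ⟨K, hK, hle⟩ := h.exists_scaled_heat_le hd hc
  have hev : ∀ᶠ n : ℕ in atTop, 0 < n ∧ c * n ≤ ‖x n‖ := (eventually_gt_atTop 0).and hx
  have hInt := (integrableOn_inv_sqrt_max_pow hd).const_mul K
  have hmeas : ∀ n : ℕ, MeasureTheory.AEStronglyMeasurable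
      (fun t : ℝ => (n : ℝ) ^ d * heat s m ((n : ℝ) ^ 2 * t) (x n))
      (MeasureTheory.volume.restrict (Set.Ioi 0)) := fun n =>
    (((h.measurable_heat (x n)).comp (by fun_prop)).const_mul _).aestronglyMeasurable
  have hnn : ∀ n : ℕ, ∀ t : ℝ, 0 < t → 0 ≤ (n : ℝ) ^ d * heat s m ((n : ℝ) ^ 2 * t) (x n) :=
    fun n t ht => mul_nonneg (by positivity) (h.heat_nonneg (by positivity) _)
  refine ⟨?_, ?_⟩
  · have hlim : Tendsto (fun n : ℕ => ∫ t in Set.Ioi 0,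
        (n : ℝ) ^ d * heat s m ((n : ℝ) ^ 2 * t) (x n)) atTop (nhds (newtonKernel s m z)) := by
      refine MeasureTheory.tendsto_integral_filter_of_dominated_convergence
        (fun t => K * (√(max 1 t) ^ d)⁻¹) (Filter.Eventually.of_forall hmeas) ?_ hInt ?_
      · filter_upwards [hev] with n hn
        refine (MeasureTheory.ae_restrict_iff' measurableSet_Ioi).mpr
          (Filter.Eventually.of_forall fun t ht => ?_)
        rw [Real.norm_of_nonneg (hnn n t ht)]
        exact hle n hn.1 _ hn.2 t ht
      · exact (MeasureTheory.ae_restrict_iff' measurableSet_Ioi).mpr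
          (Filter.Eventually.of_forall fun t ht => h.tendsto_scaled_heat ht hz)
    refine hlim.congr' ?_
    filter_upwards [hev] with n hn
    exact (h.scaled_latticeGreen hd hn.1 _).symm
  · have hnn' : ∀ t : ℝ, 0 < t → 0 ≤ (gaussKernel s m t z).re / (2 * Real.pi) ^ d :=
      fun t ht => ge_of_tendsto (h.tendsto_scaled_heat ht hz)
        (Filter.Eventually.of_forall fun n => hnn n t ht)
    have hle' : ∀ t : ℝ, 0 < t → (gaussKernel s m t z).re / (2 * Real.pi) ^ d ≤
        K * (√(max 1 t) ^ d)⁻¹ := fun t ht => by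
      refine le_of_tendsto (h.tendsto_scaled_heat ht hz) ?_
      filter_upwards [hev] with n hn
      exact hle n hn.1 _ hn.2 t ht
    have hae : MeasureTheory.AEStronglyMeasurable
        (fun t => (gaussKernel s m t z).re / (2 * Real.pi) ^ d)
        (MeasureTheory.volume.restrict (Set.Ioi 0)) :=
      aestronglyMeasurable_of_tendsto_ae atTop hmeas
        ((MeasureTheory.ae_restrict_iff' measurableSet_Ioi).mpr
          (Filter.Eventually.of_forall fun t ht => h.tendsto_scaled_heat ht hz))
    have hInt' : MeasureTheory.IntegrableOn
        (fun t => (gaussKernel s m t z).re / (2 * Real.pi) ^ d) (Set.Ioi 0) := by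
      refine MeasureTheory.Integrable.mono' hInt hae ?_
      refine (MeasureTheory.ae_restrict_iff' measurableSet_Ioi).mpr
        (Filter.Eventually.of_forall fun t ht => ?_)
      rw [Real.norm_of_nonneg (hnn' t ht)]
      exact hle' t ht
    rw [newtonKernel, MeasureTheory.setIntegral_pos_iff_support_of_nonneg_ae ?_ hInt']
    · obtain ⟨T, hT⟩ := (h.eventually_gaussKernel_re_pos z).exists_forall_of_atTop
      have hsub : Set.Ioi (max T 0) ⊆ Function.support
          (fun t => (gaussKernel s m t z).re / (2 * Real.pi) ^ d) ∩ Set.Ioi 0 := by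
        intro t ht
        have hπ := Real.pi_pos
        have h1 := hT t ((le_max_left _ _).trans (le_of_lt ht))
        exact ⟨(div_pos h1 (by positivity)).ne',
          Set.mem_Ioi.mpr (lt_of_le_of_lt (le_max_right T 0) (Set.mem_Ioi.mp ht))⟩
      refine lt_of_lt_of_le ?_ (MeasureTheory.measure_mono hsub)
      simp
    · exact (MeasureTheory.ae_restrict_iff' measurableSet_Ioi).mpr
        (Filter.Eventually.of_forall fun t ht => hnn' t ht)

/-! ### Riemann sums over dilated simplices -/

/-- The lattice points `a ∈ ℕ^ι` with `∑ a + l ≤ n`. -/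
noncomputable def simplexPoints (ι : Type*) [Fintype ι] (l n : ℕ) : Finset (ι → ℕ) :=
  (Fintype.piFinset fun _ : ι => Finset.range (n + 1)).filter fun a => ∑ i, a i + l ≤ n

lemma mem_simplexPoints {ι : Type*} [Fintype ι] {l n : ℕ} {a : ι → ℕ} :
    a ∈ simplexPoints ι l n ↔ ∑ i, a i + l ≤ n := by
  simp only [simplexPoints, Finset.mem_filter, Fintype.mem_piFinset, Finset.mem_range,
    and_iff_right_iff_imp]
  intro h i
  have := Finset.single_le_sum (f := a) (fun j _ => Nat.zero_le _) (Finset.mem_univ i)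
  omega

/-- The half-open cube of side `1 / n` with lower corner `a / n`. -/
def gridCube {ι : Type*} (n : ℕ) (a : ι → ℕ) : Set (ι → ℝ) :=
  Set.pi Set.univ fun i => Set.Ico ((a i : ℝ) / n) ((a i + 1 : ℝ) / n)

lemma mem_gridCube {ι : Type*} {n : ℕ} (hn : 0 < n) {a : ι → ℕ} {y : ι → ℝ} :
    y ∈ gridCube n a ↔ (∀ i, 0 ≤ y i) ∧ (fun i => ⌊n * y i⌋₊) = a := by
  have hn' : (0 : ℝ) < n := by exact_mod_cast hn
  simp only [gridCube, Set.mem_univ_pi, Set.mem_Ico, funext_iff, ← forall_and]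
  refine forall_congr' fun i => ?_
  constructor
  · rintro ⟨h1, h2⟩
    have h0 : 0 ≤ y i := le_trans (by positivity) h1
    refine ⟨h0, (Nat.floor_eq_iff (by positivity)).mpr ⟨?_, ?_⟩⟩
    · rwa [div_le_iff₀' hn'] at h1
    · rwa [lt_div_iff₀' hn'] at h2
  · rintro ⟨h0, h1⟩
    rw [Nat.floor_eq_iff (by positivity)] at h1
    exact ⟨(div_le_iff₀' hn').mpr h1.1, (lt_div_iff₀' hn').mpr h1.2⟩

lemma measurableSet_gridCube {ι : Type*} [Fintype ι] (n : ℕ) (a : ι → ℕ) :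
    MeasurableSet (gridCube n a) :=
  MeasurableSet.univ_pi fun _ => measurableSet_Ico

lemma volume_gridCube {ι : Type*} [Fintype ι] (n : ℕ) (a : ι → ℕ) :
    MeasureTheory.volume (gridCube n a) = ENNReal.ofReal ((n : ℝ)⁻¹) ^ Fintype.card ι := by
  rw [gridCube, Real.volume_pi_Ico]
  simp [← sub_div]

/-- The step function with value `f a` on the cube of corner `a / n`. -/
noncomputable def stepFun {ι : Type*} [Fintype ι] (l n : ℕ) (f : (ι → ℕ) → ℝ) (y : ι → ℝ) : ℝ :=
  ∑ a ∈ simplexPoints ι l n, (gridCube n a).indicator (fun _ => f a) y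

lemma stepFun_eq {ι : Type*} [Fintype ι] {l n : ℕ} (hn : 0 < n) (f : (ι → ℕ) → ℝ) (y : ι → ℝ) :
    stepFun l n f y = if (∀ i, 0 ≤ y i) ∧ ∑ i, ⌊n * y i⌋₊ + l ≤ n
      then f (fun i => ⌊n * y i⌋₊) else 0 := by
  simp only [stepFun, Set.indicator_apply, mem_gridCube hn]
  by_cases h : ∀ i, 0 ≤ y i
  · simp only [h, implies_true, true_and, Finset.sum_ite_eq, mem_simplexPoints]
  · simp [h]

lemma integral_stepFun {ι : Type*} [Fintype ι] (l n : ℕ) (f : (ι → ℕ) → ℝ) :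
    ∫ y, stepFun l n f y = (n : ℝ)⁻¹ ^ Fintype.card ι * ∑ a ∈ simplexPoints ι l n, f a := by
  have hvol : ∀ a : ι → ℕ, MeasureTheory.volume.real (gridCube n a) =
      (n : ℝ)⁻¹ ^ Fintype.card ι := by
    intro a
    rw [MeasureTheory.measureReal_def, volume_gridCube, ENNReal.toReal_pow,
      ENNReal.toReal_ofReal (by positivity)]
  simp only [stepFun]
  rw [MeasureTheory.integral_finsetSum, Finset.mul_sum]
  · refine Finset.sum_congr rfl fun a _ => ?_
    rw [MeasureTheory.integral_indicator_const _ (measurableSet_gridCube n a), hvol, smul_eq_mul]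
  · intro a _
    refine (MeasureTheory.integrable_indicator_iff (measurableSet_gridCube n a)).mpr ?_
    refine MeasureTheory.integrableOn_const ?_
    rw [volume_gridCube]
    exact ENNReal.pow_ne_top ENNReal.ofReal_ne_top

lemma measurable_stepFun {ι : Type*} [Fintype ι] (l n : ℕ) (f : (ι → ℕ) → ℝ) :
    Measurable (stepFun l n f) :=
  Finset.measurable_sum _ fun a _ => measurable_const.indicator (measurableSet_gridCube n a)

lemma ae_sum_ne_one (ι : Type*) [Fintype ι] : ∀ᵐ y : ι → ℝ, ∑ i, y i ≠ 1 := by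
  let A : AffineSubspace ℝ (ι → ℝ) :=
    { carrier := {y | ∑ i, y i = 1}
      smul_vsub_vadd_mem' := by
        intro c p q r hp hq hr
        simp only [Set.mem_ofPred_eq] at hp hq hr ⊢
        simp [Finset.sum_add_distrib, ← Finset.mul_sum, hp, hq, hr] }
  have hA : A ≠ ⊤ := by
    intro h
    have h0 : (0 : ι → ℝ) ∈ A := h ▸ AffineSubspace.mem_top ℝ _ _
    have h1 : ∑ i : ι, (0 : ι → ℝ) i = 1 := h0
    simp at h1
  have h := MeasureTheory.Measure.addHaar_affineSubspace
    (MeasureTheory.volume : MeasureTheory.Measure (ι → ℝ)) A hA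
  rw [MeasureTheory.ae_iff]
  simp only [ne_eq, not_not]
  exact h

lemma sum_floor_add_le_eventually {ι : Type*} [Fintype ι] (l : ℕ) {y : ι → ℝ}
    (hy : ∀ i, 0 ≤ y i) (h1 : ∑ i, y i < 1) :
    ∀ᶠ n : ℕ in atTop, ∑ i, ⌊n * y i⌋₊ + l ≤ n := by
  have hlim : Tendsto (fun n : ℕ => (n : ℝ) * (1 - ∑ i, y i)) atTop atTop :=
    tendsto_natCast_atTop_atTop.atTop_mul_const (by linarith)
  filter_upwards [hlim.eventually_ge_atTop (l : ℝ)] with n hn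
  have h2 : ∑ i, (⌊n * y i⌋₊ : ℝ) ≤ ∑ i, n * y i :=
    Finset.sum_le_sum fun i _ => Nat.floor_le (mul_nonneg (by positivity) (hy i))
  rw [← Finset.mul_sum] at h2
  have h3 : ((∑ i, ⌊n * y i⌋₊ + l : ℕ) : ℝ) ≤ n := by
    push_cast
    linarith
  exact_mod_cast h3

lemma lt_sum_floor_add_eventually {ι : Type*} [Fintype ι] (l : ℕ) {y : ι → ℝ}
    (h1 : 1 < ∑ i, y i) :
    ∀ᶠ n : ℕ in atTop, ¬ ∑ i, ⌊n * y i⌋₊ + l ≤ n := by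
  have hlim : Tendsto (fun n : ℕ => (n : ℝ) * (∑ i, y i - 1)) atTop atTop :=
    tendsto_natCast_atTop_atTop.atTop_mul_const (by linarith)
  filter_upwards [hlim.eventually_gt_atTop (Fintype.card ι : ℝ)] with n hn hle
  have h2 : ∑ i, n * y i ≤ ∑ i, ((⌊n * y i⌋₊ : ℝ) + 1) :=
    Finset.sum_le_sum fun i _ => (Nat.lt_floor_add_one _).le
  rw [← Finset.mul_sum, Finset.sum_add_distrib] at h2
  simp only [Finset.sum_const, Finset.card_univ, nsmul_eq_mul, mul_one] at h2
  have h3 : ((∑ i, ⌊n * y i⌋₊ + l : ℕ) : ℝ) ≤ n := by exact_mod_cast hle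
  push_cast at h3
  have h4 : (0 : ℝ) ≤ l := by positivity
  linarith

/-- Convergence of Riemann sums over dilated standard simplices. -/
lemma exists_tendsto_simplex_sum {ι : Type*} [Fintype ι] (l : ℕ) (f : ℕ → (ι → ℕ) → ℝ)
    (g : (ι → ℝ) → ℝ) (K : ℝ)
    (hbd : ∀ n a, 0 < n → ∑ i, a i + l ≤ n → 0 ≤ f n a ∧ f n a ≤ K)
    (hlim : ∀ y : ι → ℝ, (∀ i, 0 ≤ y i) → ∑ i, y i < 1 →
      Tendsto (fun n : ℕ => f n fun i => ⌊n * y i⌋₊) atTop (nhds (g y)) ∧ 0 < g y) :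
    ∃ C : ℝ, 0 < C ∧ Tendsto (fun n : ℕ => (n : ℝ)⁻¹ ^ Fintype.card ι *
      ∑ a ∈ simplexPoints ι l n, f n a) atTop (nhds C) := by
  let g' : (ι → ℝ) → ℝ := fun y => if (∀ i, 0 ≤ y i) ∧ ∑ i, y i < 1 then g y else 0
  let b : (ι → ℝ) → ℝ := (Set.Icc (0 : ι → ℝ) fun _ => 2).indicator fun _ => K
  have hbint : MeasureTheory.Integrable b := by
    refine (MeasureTheory.integrable_indicator_iff measurableSet_Icc).mpr ?_
    refine MeasureTheory.integrableOn_const ?_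
    exact (isCompact_Icc.measure_lt_top).ne
  have hnn : ∀ n : ℕ, 0 < n → ∀ y, 0 ≤ stepFun l n (f n) y ∧ stepFun l n (f n) y ≤ b y := by
    intro n hn y
    rw [stepFun_eq hn]
    have hn' : (1 : ℝ) ≤ n := by exact_mod_cast hn
    split_ifs with h
    · refine ⟨(hbd n _ hn h.2).1, ?_⟩
      have hy : y ∈ Set.Icc (0 : ι → ℝ) fun _ => 2 := by
        refine ⟨h.1, fun i => ?_⟩
        have h1 := Finset.single_le_sum (f := fun i => ⌊n * y i⌋₊) (fun j _ => Nat.zero_le _)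
          (Finset.mem_univ i)
        have h2 : (⌊n * y i⌋₊ : ℝ) ≤ n := by exact_mod_cast (by omega : ⌊n * y i⌋₊ ≤ n)
        have h3 := Nat.lt_floor_add_one (n * y i)
        by_contra! h4
        nlinarith
      simp only [b, Set.indicator_of_mem hy]
      exact (hbd n _ hn h.2).2
    · refine ⟨le_rfl, ?_⟩
      by_cases hy : y ∈ Set.Icc (0 : ι → ℝ) fun _ => 2
      · simp only [b, Set.indicator_of_mem hy]
        have h0 := hbd (n + l) 0 (by omega) (by simp)
        exact h0.1.trans h0.2
      · simp only [b, Set.indicator_of_notMem hy, le_refl]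
  have hpt : ∀ᵐ y : ι → ℝ, Tendsto (fun n => stepFun l n (f n) y) atTop (nhds (g' y)) := by
    filter_upwards [ae_sum_ne_one ι] with y hy
    by_cases h0 : ∀ i, 0 ≤ y i
    · rcases lt_or_gt_of_ne hy with h1 | h1
      · have hg : g' y = g y := if_pos ⟨h0, h1⟩
        rw [hg]
        refine (hlim y h0 h1).1.congr' ?_
        filter_upwards [sum_floor_add_le_eventually l h0 h1, eventually_gt_atTop 0] with n hn hn0
        rw [stepFun_eq hn0, if_pos ⟨h0, hn⟩]
      · have hg : g' y = 0 := if_neg fun h => by linarith [h.2]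
        rw [hg]
        refine tendsto_const_nhds.congr' ?_
        filter_upwards [lt_sum_floor_add_eventually l h1, eventually_gt_atTop 0] with n hn hn0
        rw [stepFun_eq hn0, if_neg fun h => hn h.2]
    · have hg : g' y = 0 := if_neg fun h => h0 h.1
      rw [hg]
      refine tendsto_const_nhds.congr' ?_
      filter_upwards [eventually_gt_atTop 0] with n hn0
      rw [stepFun_eq hn0, if_neg fun h => h0 h.1]
  have hg'0 : ∀ y, 0 ≤ g' y := by
    intro y
    by_cases h : (∀ i, 0 ≤ y i) ∧ ∑ i, y i < 1
    · rw [show g' y = g y from if_pos h]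
      exact (hlim y h.1 h.2).2.le
    · rw [show g' y = 0 from if_neg h]
  have hmeas : ∀ n, MeasureTheory.AEStronglyMeasurable (stepFun l n (f n))
      (MeasureTheory.volume : MeasureTheory.Measure (ι → ℝ)) :=
    fun n => (measurable_stepFun l n (f n)).aestronglyMeasurable
  have hg'meas := aestronglyMeasurable_of_tendsto_ae atTop hmeas hpt
  have hg'int : MeasureTheory.Integrable g' := by
    refine hbint.mono' hg'meas ?_
    filter_upwards [hpt] with y hy
    rw [Real.norm_of_nonneg (hg'0 y)]
    refine le_of_tendsto hy ?_
    filter_upwards [eventually_gt_atTop 0] with n hn using (hnn n hn y).2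
  refine ⟨∫ y, g' y, ?_, ?_⟩
  · rw [MeasureTheory.integral_pos_iff_support_of_nonneg hg'0 hg'int]
    let r : ℝ := ((Fintype.card ι : ℝ) + 1)⁻¹
    have hr : 0 < r := by positivity
    have hsub : (Set.pi Set.univ fun _ : ι => Set.Ioo 0 r) ⊆ Function.support g' := by
      intro y hy
      simp only [Set.mem_univ_pi, Set.mem_Ioo] at hy
      have h0 : ∀ i, 0 ≤ y i := fun i => (hy i).1.le
      have h1 : ∑ i, y i < 1 := by
        calc ∑ i, y i ≤ ∑ _i : ι, r := Finset.sum_le_sum fun i _ => (hy i).2.le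
          _ = Fintype.card ι * r := by simp
          _ < (Fintype.card ι + 1) * r := by linarith
          _ = 1 := mul_inv_cancel₀ (by positivity)
      have hg : g' y = g y := if_pos ⟨h0, h1⟩
      rw [Function.mem_support, hg]
      exact (hlim y h0 h1).2.ne'
    refine lt_of_lt_of_le ?_ (MeasureTheory.measure_mono hsub)
    rw [Real.volume_pi_Ioo]
    simp [pos_iff_ne_zero, hr]
  · simp only [← integral_stepFun]
    refine MeasureTheory.tendsto_integral_filter_of_dominated_convergence b
      (Filter.Eventually.of_forall hmeas) ?_ hbint hpt
    filter_upwards [eventually_gt_atTop 0] with n hn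
    refine Filter.Eventually.of_forall fun y => ?_
    rw [Real.norm_of_nonneg (hnn n hn y).1]
    exact (hnn n hn y).2

/-! ### Normal forms for words in a finitely generated commutative group -/

/-- The element represented by the commutative word with exponents `b`. -/
def evalWord {N : ℕ} {V : Type*} [AddCommMonoid V] (v : Fin N → V) (b : Fin N → ℕ) : V :=
  ∑ i, b i • v i

lemma evalWord_add {N : ℕ} {V : Type*} [AddCommMonoid V] (v : Fin N → V) (b c : Fin N → ℕ) :
    evalWord v (b + c) = evalWord v b + evalWord v c := by
  simp [evalWord, add_smul, Finset.sum_add_distrib]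

/-- The exponent vector `b`, as an element of the degree-lexicographic order. -/
noncomputable def degLexKey {N : ℕ} (b : Fin N → ℕ) : DegLex (Fin N →₀ ℕ) :=
  toDegLex (Finsupp.equivFunOnFinite.symm b)

lemma degLexKey_add {N : ℕ} (b c : Fin N → ℕ) :
    degLexKey (b + c) = degLexKey b + degLexKey c := by
  rw [degLexKey, degLexKey, degLexKey, ← toDegLex_add]
  congr 1
  ext i
  simp

lemma degLexKey_injective {N : ℕ} : Function.Injective (degLexKey (N := N)) :=
  toDegLex.injective.comp Finsupp.equivFunOnFinite.symm.injective

lemma sum_le_sum_of_degLexKey_le {N : ℕ} {b c : Fin N → ℕ} (h : degLexKey b ≤ degLexKey c) :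
    ∑ i, b i ≤ ∑ i, c i := by
  have h1 := Finsupp.DegLex.monotone_degree h
  simpa [degLexKey, Finsupp.degree_eq_sum] using h1

/-- The exponent vectors which are minimal among those representing the same element. -/
def normalForms {N : ℕ} {V : Type*} [AddCommMonoid V] (v : Fin N → V) : Set (Fin N → ℕ) :=
  {b | ∀ c, evalWord v c = evalWord v b → degLexKey b ≤ degLexKey c}

lemma exists_normalForm {N : ℕ} {V : Type*} [AddCommMonoid V] (v : Fin N → V) (b : Fin N → ℕ) :
    ∃ c ∈ normalForms v, evalWord v c = evalWord v b := by
  obtain ⟨c, hc, hmin⟩ := (InvImage.wf (degLexKey (N := N)) wellFounded_lt).has_min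
    {c | evalWord v c = evalWord v b} ⟨b, rfl⟩
  exact ⟨c, fun c' hc' => not_lt.mp (hmin c' (hc'.trans hc)), hc⟩

lemma injOn_evalWord_normalForms {N : ℕ} {V : Type*} [AddCommMonoid V] (v : Fin N → V) :
    Set.InjOn (evalWord v) (normalForms v) := fun _ hb _ hc h =>
  degLexKey_injective (le_antisymm (hb _ h.symm) (hc _ h))

lemma isLowerSet_normalForms {N : ℕ} {V : Type*} [AddCommMonoid V] (v : Fin N → V) :
    IsLowerSet (normalForms v) := by
  intro b c hcb hb c' hc'
  obtain ⟨e, rfl⟩ := exists_add_of_le hcb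
  have h1 := hb (c' + e) (by rw [evalWord_add, evalWord_add, hc'])
  rw [degLexKey_add, degLexKey_add] at h1
  exact le_of_add_le_add_right h1

/-- Dickson's lemma: membership in a lower set of `ℕ^N` only depends on truncated exponents. -/
lemma exists_forall_mem_iff_inf_mem {N : ℕ} {L : Set (Fin N → ℕ)} (hL : IsLowerSet L) :
    ∃ K : ℕ, ∀ b, b ∈ L ↔ (fun i => min (b i) K) ∈ L := by
  have hfin : {a | Minimal (· ∈ Lᶜ) a}.Finite :=
    WellQuasiOrderedLE.finite_of_isAntichain (setOfPred_minimal_antichain _)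
  obtain ⟨u, hu⟩ := hfin.bddAbove
  refine ⟨∑ i, u i, fun b => ⟨fun hb => hL (fun i => min_le_left _ _) hb, fun hb => ?_⟩⟩
  by_contra hb'
  obtain ⟨a, hab, ha⟩ := exists_minimal_le_of_wellFoundedLT (· ∈ Lᶜ) b hb'
  refine ha.prop (hL (fun i => le_min (hab i) ((hu ha i).trans ?_)) hb)
  exact Finset.single_le_sum (f := u) (fun j _ => Nat.zero_le _) (Finset.mem_univ i)

/-- Multiply the word with exponents `c` by the word with exponents `a` in the directions `i ≠ i₀`
with `c i = K`, and by the `t`-th power of the letter `i₀`. -/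
def extendWord {N : ℕ} (c : Fin N → ℕ) (K : ℕ) (i₀ : Fin N) (t : ℕ)
    (a : {i : Fin N // c i = K ∧ i ≠ i₀} → ℕ) (i : Fin N) : ℕ :=
  c i + if i = i₀ then t else if h : c i = K ∧ i ≠ i₀ then a ⟨i, h⟩ else 0

lemma sum_dite_subtype {α M : Type*} [Fintype α] [AddCommMonoid M] (p : α → Prop)
    [DecidablePred p]
    (f : {i : α // p i} → M) :
    ∑ i, (if h : p i then f ⟨i, h⟩ else 0) = ∑ j, f j := by
  have h1 : ∑ j, f j = ∑ j : {i : α // p i}, (if h : p j then f ⟨j, h⟩ else 0) :=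
    Finset.sum_congr rfl fun j _ => by rw [dif_pos j.2]
  rw [h1, ← Finset.sum_subtype (Finset.univ.filter p) (by simp)
    (fun i => if h : p i then f ⟨i, h⟩ else 0), Finset.sum_filter]
  refine Finset.sum_congr rfl fun i _ => ?_
  split_ifs <;> rfl

lemma evalWord_extendWord {N : ℕ} {V : Type*} [AddCommMonoid V] (v : Fin N → V)
    (c : Fin N → ℕ) (K : ℕ) (i₀ : Fin N) (t : ℕ) (a : {i : Fin N // c i = K ∧ i ≠ i₀} → ℕ) :
    evalWord v (extendWord c K i₀ t a) = evalWord v c + (t • v i₀ + ∑ j, a j • v j) := by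
  have h : ∀ i, (if i = i₀ then t else if h : c i = K ∧ i ≠ i₀ then a ⟨i, h⟩ else 0) • v i =
      (if i = i₀ then t • v i₀ else 0) +
        if h : c i = K ∧ i ≠ i₀ then a ⟨i, h⟩ • v i else 0 := by
    intro i
    by_cases h1 : i = i₀
    · subst h1
      simp
    · by_cases h2 : c i = K <;> simp [h1, h2]
  simp only [evalWord, extendWord, add_smul, Finset.sum_add_distrib, h]
  congr 2
  · simp
  · exact sum_dite_subtype (fun i => c i = K ∧ i ≠ i₀) fun j => a j • v j

lemma sum_extendWord {N : ℕ} (c : Fin N → ℕ) (K : ℕ) (i₀ : Fin N) (t : ℕ)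
    (a : {i : Fin N // c i = K ∧ i ≠ i₀} → ℕ) :
    ∑ i, extendWord c K i₀ t a i = ∑ i, c i + (t + ∑ j, a j) := by
  simpa only [evalWord, smul_eq_mul, mul_one] using evalWord_extendWord (fun _ => (1 : ℕ)) c K i₀ t a

lemma min_extendWord {N : ℕ} {c : Fin N → ℕ} {K : ℕ} {i₀ : Fin N} (hcK : ∀ i, c i ≤ K)
    (hi₀ : c i₀ = K) (t : ℕ) (a : {i : Fin N // c i = K ∧ i ≠ i₀} → ℕ) :
    (fun i => min (extendWord c K i₀ t a i) K) = c := by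
  ext i
  have hi := hcK i
  unfold extendWord
  split_ifs with h1 h2
  · subst h1
    omega
  · omega
  · omega

lemma eq_extendWord {N : ℕ} {b c : Fin N → ℕ} {K : ℕ} {i₀ : Fin N}
    (hb : (fun i => min (b i) K) = c) (hi₀ : c i₀ = K) :
    b = extendWord c K i₀ (b i₀ - K) fun j => b j - K := by
  ext i
  have hi : min (b i) K = c i := congrFun hb i
  unfold extendWord
  split_ifs with h1 h2
  · subst h1
    omega
  · have := h2.1
    dsimp only
    omega
  · have : c i ≠ K := fun h => h2 ⟨h, h1⟩
    omega

/-- Parametrization of the words of length `n` with truncation `c` by the lattice points of a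
simplex. -/
lemma sum_filter_min_eq {N : ℕ} {c : Fin N → ℕ} {K : ℕ} {i₀ : Fin N} (hcK : ∀ i, c i ≤ K)
    (hi₀ : c i₀ = K) (f : (Fin N → ℕ) → ℝ) (n : ℕ) :
    ∑ b ∈ (Finset.univ.piAntidiag n).filter (fun b => (fun i => min (b i) K) = c), f b =
      ∑ a ∈ simplexPoints {i : Fin N // c i = K ∧ i ≠ i₀} (∑ i, c i) n,
        f (extendWord c K i₀ (n - (∑ j, a j + ∑ i, c i)) a) := by
  have key : ∀ b ∈ (Finset.univ.piAntidiag n).filter (fun b => (fun i => min (b i) K) = c),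
      ∑ i, c i + ((b i₀ - K) + ∑ j : {i : Fin N // c i = K ∧ i ≠ i₀}, (b j - K)) = n := by
    intro b hb
    simp only [Finset.mem_filter, Finset.mem_piAntidiag] at hb
    rw [← sum_extendWord c K i₀ (b i₀ - K) fun j => b j - K, ← eq_extendWord hb.2 hi₀, hb.1.1]
  refine Finset.sum_bij' (fun b _ j => b j - K)
    (fun a _ => extendWord c K i₀ (n - (∑ j, a j + ∑ i, c i)) a) ?_ ?_ ?_ ?_ ?_
  · intro b hb
    have := key b hb
    rw [mem_simplexPoints]
    omega
  · intro a ha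
    rw [mem_simplexPoints] at ha
    simp only [Finset.mem_filter, Finset.mem_piAntidiag, min_extendWord hcK hi₀, sum_extendWord,
      Finset.mem_univ, implies_true, and_true]
    omega
  · intro b hb
    have h1 := key b hb
    have h2 : n - (∑ j : {i : Fin N // c i = K ∧ i ≠ i₀}, (b j - K) + ∑ i, c i) = b i₀ - K := by
      omega
    dsimp only
    rw [h2]
    exact (eq_extendWord (Finset.mem_filter.mp hb).2 hi₀).symm
  · intro a ha
    ext j
    have h1 := j.2.1
    simp only [extendWord, if_neg j.2.2, dif_pos j.2, Subtype.coe_eta]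
    omega
  · intro b hb
    have h1 := key b hb
    have h2 : n - (∑ j : {i : Fin N // c i = K ∧ i ≠ i₀}, (b j - K) + ∑ i, c i) = b i₀ - K := by
      omega
    rw [h2, ← eq_extendWord (Finset.mem_filter.mp hb).2 hi₀]

/-- If no direction is saturated, the truncation determines the word. -/
lemma eq_of_min_eq {N : ℕ} {b c : Fin N → ℕ} {K : ℕ} (hc : ∀ i, c i ≠ K)
    (hb : (fun i => min (b i) K) = c) : b = c := by
  ext i
  have h1 : min (b i) K = c i := congrFun hb i
  have h2 := hc i
  omega

/-! ### Saturated directions of normal forms -/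

lemma sum_le_of_mem_normalForms {N : ℕ} {V : Type*} [AddCommMonoid V] {v : Fin N → V}
    {b c : Fin N → ℕ} (hb : b ∈ normalForms v) (h : evalWord v c = evalWord v b) :
    ∑ i, b i ≤ ∑ i, c i :=
  sum_le_sum_of_degLexKey_le (hb c h)

lemma evalWord_sum_nsmul {N : ℕ} {V ι : Type*} [AddCommMonoid V] (v : Fin N → V)
    (s : Finset ι) (k : ι → ℕ) (b : ι → Fin N → ℕ) :
    evalWord v (∑ j ∈ s, k j • b j) = ∑ j ∈ s, k j • evalWord v (b j) := by
  simp only [evalWord, Finset.sum_apply, Pi.smul_apply, smul_eq_mul, Finset.sum_smul,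
    Finset.smul_sum, mul_smul]
  exact Finset.sum_comm

/-- The length of a normal form is at most a multiple of the norm of its value. -/
lemma exists_sum_le_norm_evalWord {N d : ℕ} {v : Fin N → Fin d → ℤ}
    (hv : ∀ x, ∃ b, evalWord v b = x) :
    ∃ c : ℝ, 0 < c ∧ ∀ b ∈ normalForms v, c * (∑ i, b i : ℕ) ≤ ‖evalWord v b‖ := by
  choose p hp using fun j : Fin d => hv (Pi.single j 1)
  choose q hq using fun j : Fin d => hv (-Pi.single j 1)
  let M : ℕ := ∑ j, (∑ i, p j i + ∑ i, q j i)
  refine ⟨((M : ℝ) + 1)⁻¹, by positivity, fun b hb => ?_⟩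
  set x := evalWord v b with hx
  let e : Fin N → ℕ := ∑ j, (x j).toNat • p j + ∑ j, (-x j).toNat • q j
  have he : evalWord v e = x := by
    simp only [e, evalWord_add, evalWord_sum_nsmul, hp, hq]
    ext i
    simp [Finset.sum_apply, Pi.single_apply]
    omega
  have h1 := sum_le_of_mem_normalForms hb (he.trans hx)
  have hxj : ∀ j, ((x j).toNat : ℝ) ≤ ‖x‖ ∧ ((-x j).toNat : ℝ) ≤ ‖x‖ := by
    intro j
    have h2 : ((x j).natAbs : ℝ) ≤ ‖x‖ := by
      refine le_trans (le_of_eq ?_) (norm_le_pi_norm x j)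
      rw [Int.norm_eq_abs, ← Int.cast_abs, ← Int.natCast_natAbs, Int.cast_natCast]
    constructor
    · refine le_trans ?_ h2
      exact_mod_cast (by omega : (x j).toNat ≤ (x j).natAbs)
    · refine le_trans ?_ h2
      exact_mod_cast (by omega : (-x j).toNat ≤ (x j).natAbs)
  have h2 : ((∑ i, e i : ℕ) : ℝ) ≤ M * ‖x‖ := by
    have h3 : ∑ i, e i = ∑ j, ((x j).toNat * ∑ i, p j i + (-x j).toNat * ∑ i, q j i) := by
      simp only [e, Pi.add_apply, Finset.sum_apply, Pi.smul_apply, smul_eq_mul,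
        Finset.sum_add_distrib, Finset.mul_sum]
      congr 1 <;> exact Finset.sum_comm
    rw [h3]
    simp only [M]
    push_cast
    rw [Finset.sum_mul]
    refine Finset.sum_le_sum fun j _ => ?_
    rw [add_mul, mul_comm (∑ i, (p j i : ℝ)), mul_comm (∑ i, (q j i : ℝ))]
    exact add_le_add (mul_le_mul_of_nonneg_right (hxj j).1 (by positivity))
      (mul_le_mul_of_nonneg_right (hxj j).2 (by positivity))
  have h3 : ((∑ i, b i : ℕ) : ℝ) ≤ (∑ i, e i : ℕ) := by exact_mod_cast h1
  rw [inv_mul_le_iff₀ (by positivity)]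
  nlinarith [norm_nonneg x]

/-- The directions saturated by a truncated normal form are linearly independent. -/
lemma card_saturated_le {N d : ℕ} {v : Fin N → Fin d → ℤ} {K : ℕ}
    (hK : ∀ b, b ∈ normalForms v ↔ (fun i => min (b i) K) ∈ normalForms v)
    {c : Fin N → ℕ} (hcK : ∀ i, c i ≤ K) (hc : c ∈ normalForms v) :
    Fintype.card {i // c i = K} ≤ d := by
  have hli : LinearIndependent ℤ fun j : {i // c i = K} => v j := by
    rw [Fintype.linearIndependent_iff]
    intro u hu
    let ext (w : {i // c i = K} → ℕ) : Fin N → ℕ :=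
      fun i => c i + if h : c i = K then w ⟨i, h⟩ else 0
    have hmem : ∀ w, ext w ∈ normalForms v := by
      intro w
      rw [hK]
      convert hc using 1
      ext i
      have := hcK i
      simp only [ext]
      split_ifs with h <;> omega
    have heval : ∀ w, evalWord v (ext w) = evalWord v c + ∑ j, w j • v j := by
      intro w
      simp only [ext, evalWord, add_smul, Finset.sum_add_distrib, dite_smul, zero_smul]
      congr 1
      exact sum_dite_subtype (fun i => c i = K) fun j => w j • v j
    have hinj : ∀ w w' : {i // c i = K} → ℕ, ∑ j, w j • v j = ∑ j, w' j • v j →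
        ∀ j, w j = w' j := by
      intro w w' h j
      have h1 := congrFun (injOn_evalWord_normalForms v (hmem w) (hmem w')
        (by rw [heval, heval, h])) j
      simpa only [ext, dif_pos j.2, Subtype.coe_eta, add_right_inj] using h1
    intro j
    have h1 := hinj (fun j => (u j).toNat) (fun j => (-u j).toNat) ?_ j
    · omega
    · rw [← sub_eq_zero, ← Finset.sum_sub_distrib, ← hu]
      refine Finset.sum_congr rfl fun j _ => ?_
      rw [← natCast_zsmul, ← natCast_zsmul, ← sub_smul]
      congr 1
      omega
  simpa using hli.fintype_card_le_finrank

/-- Some truncated normal form saturates `d` directions. -/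
lemma exists_le_card_saturated {N d : ℕ} {v : Fin N → Fin d → ℤ}
    (hv : ∀ x, ∃ b, evalWord v b = x) {K : ℕ}
    (hK : ∀ b, b ∈ normalForms v ↔ (fun i => min (b i) K) ∈ normalForms v) :
    ∃ c ∈ normalForms v, (∀ i, c i ≤ K) ∧ d ≤ Fintype.card {i // c i = K} := by
  let s : Finset (Fin N → ℕ) :=
    (Fintype.piFinset fun _ => Finset.range (K + 1)).filter (· ∈ normalForms v)
  let W (c : Fin N → ℕ) : Submodule ℤ (Fin d → ℤ) :=
    Submodule.span ℤ (Set.range fun j : {i // c i = K} => v j)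
  have hcov : ⋃ c ∈ s, evalWord v c +ᵥ ((W c).toAddSubgroup : Set (Fin d → ℤ)) = Set.univ := by
    refine Set.eq_univ_of_forall fun x => ?_
    obtain ⟨b', hb'⟩ := hv x
    obtain ⟨b, hb, hbb⟩ := exists_normalForm v b'
    have hbx : evalWord v b = x := hbb.trans hb'
    let c : Fin N → ℕ := fun i => min (b i) K
    have hcs : c ∈ s := by
      simp only [s, Finset.mem_filter, Fintype.mem_piFinset, Finset.mem_range]
      exact ⟨fun i => by simp only [c]; omega, (hK b).mp hb⟩
    refine Set.mem_biUnion hcs ?_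
    rw [Set.mem_vadd_set_iff_neg_vadd_mem, vadd_eq_add, neg_add_eq_sub, ← hbx]
    have hsub : evalWord v b - evalWord v c = ∑ i, (b i - c i) • v i := by
      rw [evalWord, evalWord, ← Finset.sum_sub_distrib]
      refine Finset.sum_congr rfl fun i _ => ?_
      rw [sub_eq_iff_eq_add, ← add_smul, Nat.sub_add_cancel (min_le_left _ _)]
    rw [hsub]
    refine (W c).sum_mem fun i _ => ?_
    by_cases h : c i = K
    · exact (W c).smul_of_tower_mem _ (Submodule.subset_span ⟨⟨i, h⟩, rfl⟩)
    · have : b i - c i = 0 := by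
        simp only [c] at h ⊢
        omega
      rw [this, zero_smul]
      exact (W c).zero_mem
  obtain ⟨c, hcs, hc⟩ := AddSubgroup.exists_finiteIndex_of_leftCoset_cover hcov
  simp only [s, Finset.mem_filter, Fintype.mem_piFinset, Finset.mem_range] at hcs
  refine ⟨c, hcs.2, fun i => by have := hcs.1 i; omega, ?_⟩
  have hli : LinearIndependent ℤ fun j : Fin d =>
      (⟨(W c).toAddSubgroup.index • Pi.single j 1,
        AddSubgroup.nsmul_index_mem (W c).toAddSubgroup _⟩ : W c) := by
    rw [Fintype.linearIndependent_iff]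
    intro u hu j
    have h1 := congrFun (congrArg Subtype.val hu) j
    simpa [Pi.single_apply, hc.index_ne_zero] using h1
  have h1 := hli.fintype_card_le_finrank
  have h2 := finrank_range_le_card (R := ℤ) fun j : {i // c i = K} => v j
  rw [Fintype.card_fin] at h1
  exact h1.trans h2

/-! ### Asymptotics of the sphere sums -/

lemma tendsto_natFloor_mul_div {y : ℝ} (hy : 0 ≤ y) :
    Tendsto (fun n : ℕ => (⌊n * y⌋₊ : ℝ) / n) atTop (nhds y) := by
  have h := (tendsto_nat_floor_mul_div_atTop hy).comp (tendsto_natCast_atTop_atTop (R := ℝ))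
  simpa only [Function.comp_def, mul_comm y] using h

lemma extendWord_mem_normalForms {N d : ℕ} {v : Fin N → Fin d → ℤ} {K : ℕ}
    (hK : ∀ b, b ∈ normalForms v ↔ (fun i => min (b i) K) ∈ normalForms v)
    {c : Fin N → ℕ} (hcK : ∀ i, c i ≤ K) (hc : c ∈ normalForms v) {i₀ : Fin N} (hi₀ : c i₀ = K)
    (t : ℕ) (a : {i : Fin N // c i = K ∧ i ≠ i₀} → ℕ) :
    extendWord c K i₀ t a ∈ normalForms v := by
  rw [hK, min_extendWord hcK hi₀]
  exact hc

lemma tendsto_evalWord_extendWord_div {N d : ℕ} (v : Fin N → Fin d → ℤ) (c : Fin N → ℕ) (K : ℕ)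
    (i₀ : Fin N) {y : {i : Fin N // c i = K ∧ i ≠ i₀} → ℝ} (hy : ∀ j, 0 ≤ y j)
    (hy1 : ∑ j, y j < 1) (i : Fin d) :
    Tendsto (fun n : ℕ => (evalWord v (extendWord c K i₀
        (n - (∑ j, ⌊n * y j⌋₊ + ∑ i, c i)) fun j => ⌊n * y j⌋₊) i : ℝ) / n) atTop
      (nhds ((1 - ∑ j, y j) * v i₀ i + ∑ j, y j * v j i)) := by
  have hconst : ∀ r : ℝ, Tendsto (fun n : ℕ => r / n) atTop (nhds 0) := fun r =>
    tendsto_const_div_atTop_nhds_zero_nat r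
  have hsum : Tendsto (fun n : ℕ => (1 : ℝ) - (∑ j, (⌊n * y j⌋₊ : ℝ) / n +
      (∑ i, c i : ℕ) / (n : ℝ))) atTop (nhds (1 - (∑ j, y j + 0))) :=
    tendsto_const_nhds.sub ((tendsto_finsetSum _ fun j _ =>
      tendsto_natFloor_mul_div (hy j)).add (hconst _))
  have hlim := (hconst (evalWord v c i : ℝ)).add ((hsum.mul_const (v i₀ i : ℝ)).add
    (tendsto_finsetSum Finset.univ fun j _ =>
      (tendsto_natFloor_mul_div (hy j)).mul_const (v j i : ℝ)))
  rw [zero_add, add_zero] at hlim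
  refine hlim.congr' ?_
  filter_upwards [sum_floor_add_le_eventually (∑ i, c i) hy hy1, eventually_gt_atTop 0] with n hn hn0
  have hn' : (n : ℝ) ≠ 0 := by exact_mod_cast hn0.ne'
  rw [evalWord_extendWord]
  simp only [Pi.add_apply, Pi.smul_apply, Finset.sum_apply]
  simp only [nsmul_eq_mul, Int.cast_add, Int.cast_mul, Int.cast_sum, Int.cast_natCast]
  rw [Nat.cast_sub hn, add_div, add_div, Finset.sum_div, Nat.cast_add, Nat.cast_sum]
  congr 2
  · rw [← Finset.sum_div]
    field_simp
    push_cast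
    ring
  · exact Finset.sum_congr rfl fun j _ => by ring

/-- The rescaled Green sums over the normal forms with a given truncation converge. -/
lemma IsStepLaw.exists_tendsto_saturated_sum {d : ℕ} (hd : 3 ≤ d) {s : Finset (Fin d → ℤ)}
    {m : (Fin d → ℤ) → ℝ} (h : IsStepLaw s m) {N : ℕ} {v : Fin N → Fin d → ℤ}
    (hv : ∀ x, ∃ b, evalWord v b = x) {K : ℕ}
    (hK : ∀ b, b ∈ normalForms v ↔ (fun i => min (b i) K) ∈ normalForms v)
    {c : Fin N → ℕ} (hcK : ∀ i, c i ≤ K) (hc : c ∈ normalForms v) {i₀ : Fin N} (hi₀ : c i₀ = K) :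
    ∃ C : ℝ, 0 < C ∧ Tendsto (fun n : ℕ =>
      (n : ℝ)⁻¹ ^ Fintype.card {i : Fin N // c i = K ∧ i ≠ i₀} *
        ∑ b ∈ (Finset.univ.piAntidiag n).filter (fun b => (fun i => min (b i) K) = c),
          (n : ℝ) ^ (d - 2) * latticeGreen s m (evalWord v b)) atTop (nhds C) := by
  obtain ⟨c₀, hc₀, hnorm⟩ := exists_sum_le_norm_evalWord hv
  obtain ⟨M, hM⟩ := h.exists_scaled_latticeGreen_le hd hc₀
  have hlow : ∀ (n : ℕ) (a : {i : Fin N // c i = K ∧ i ≠ i₀} → ℕ),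
      ∑ j, a j + ∑ i, c i ≤ n →
      c₀ * n ≤ ‖evalWord v (extendWord c K i₀ (n - (∑ j, a j + ∑ i, c i)) a)‖ := by
    intro n a ha
    have h1 := hnorm _ (extendWord_mem_normalForms hK hcK hc hi₀
      (n - (∑ j, a j + ∑ i, c i)) a)
    rwa [sum_extendWord, show ∑ i, c i + (n - (∑ j, a j + ∑ i, c i) + ∑ j, a j) = n by omega]
      at h1
  simp only [sum_filter_min_eq hcK hi₀]
  refine exists_tendsto_simplex_sum (∑ i, c i)
    (fun n a => (n : ℝ) ^ (d - 2) * latticeGreen s m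
      (evalWord v (extendWord c K i₀ (n - (∑ j, a j + ∑ i, c i)) a)))
    (fun y => newtonKernel s m fun i => (1 - ∑ j, y j) * v i₀ i + ∑ j, y j * v j i) M ?_ ?_
  · intro n a hn ha
    exact ⟨mul_nonneg (by positivity) (h.latticeGreen_nonneg _), hM n hn _ (hlow n a ha)⟩
  · intro y hy hy1
    refine h.tendsto_scaled_latticeGreen hd hc₀ ?_
      (tendsto_evalWord_extendWord_div v c K i₀ hy hy1)
    filter_upwards [sum_floor_add_le_eventually (∑ i, c i) hy hy1] with n hn using hlow n _ hn

lemma card_saturated_ne_add_one {N : ℕ} {c : Fin N → ℕ} {K : ℕ} {i₀ : Fin N} (hi₀ : c i₀ = K) :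
    Fintype.card {i : Fin N // c i = K ∧ i ≠ i₀} + 1 = Fintype.card {i : Fin N // c i = K} := by
  rw [Fintype.card_subtype, Fintype.card_subtype]
  have h1 : (Finset.univ.filter fun i => c i = K ∧ i ≠ i₀) =
      (Finset.univ.filter fun i => c i = K).erase i₀ := by
    ext i
    simp [and_comm]
  rw [h1, Finset.card_erase_add_one (by simpa using hi₀)]

lemma IsStepLaw.exists_tendsto_truncated_sum {d : ℕ} (hd : 3 ≤ d) {s : Finset (Fin d → ℤ)}
    {m : (Fin d → ℤ) → ℝ} (h : IsStepLaw s m) {N : ℕ} {v : Fin N → Fin d → ℤ}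
    (hv : ∀ x, ∃ b, evalWord v b = x) {K : ℕ}
    (hK : ∀ b, b ∈ normalForms v ↔ (fun i => min (b i) K) ∈ normalForms v)
    {c : Fin N → ℕ} (hcK : ∀ i, c i ≤ K) (hc : c ∈ normalForms v) :
    ∃ C : ℝ, 0 ≤ C ∧ (d ≤ Fintype.card {i // c i = K} → 0 < C) ∧ Tendsto (fun n : ℕ =>
        (∑ b ∈ (Finset.univ.piAntidiag n).filter (fun b => (fun i => min (b i) K) = c),
          latticeGreen s m (evalWord v b)) / n) atTop (nhds C) := by
  by_cases hsat : ∃ i₀, c i₀ = K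
  · obtain ⟨i₀, hi₀⟩ := hsat
    obtain ⟨C, hC, hlim⟩ := h.exists_tendsto_saturated_sum hd hv hK hcK hc hi₀
    have hcard := card_saturated_ne_add_one hi₀
    have hle := card_saturated_le hK hcK hc
    set k := Fintype.card {i : Fin N // c i = K ∧ i ≠ i₀}
    have hinv : Tendsto (fun n : ℕ => (n : ℝ)⁻¹ ^ (d - 1 - k)) atTop
        (nhds (0 ^ (d - 1 - k))) := tendsto_inv_atTop_nhds_zero_nat.pow _
    refine ⟨0 ^ (d - 1 - k) * C, by positivity, ?_, ?_⟩
    · intro hdk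
      have h0 : d - 1 - k = 0 := by omega
      rw [h0, pow_zero, one_mul]
      exact hC
    · refine (hinv.mul hlim).congr' ?_
      filter_upwards [eventually_gt_atTop 0] with n hn
      have hn' : (n : ℝ) ≠ 0 := by exact_mod_cast hn.ne'
      rw [← Finset.mul_sum, ← mul_assoc, ← mul_assoc, ← pow_add,
        show d - 1 - k + k = (d - 2) + 1 by omega, pow_succ, inv_pow]
      field_simp
  · push Not at hsat
    refine ⟨0, le_rfl, ?_, ?_⟩
    · intro hdk
      have : IsEmpty {i // c i = K} := ⟨fun j => hsat j j.2⟩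
      rw [Fintype.card_eq_zero] at hdk
      omega
    · refine tendsto_const_nhds.congr' ?_
      filter_upwards [eventually_gt_atTop (∑ i, c i)] with n hn
      rw [Finset.sum_eq_zero, zero_div]
      intro b hb
      rw [Finset.mem_filter, Finset.mem_piAntidiag] at hb
      have h1 := eq_of_min_eq hsat hb.2
      subst h1
      have h2 : ∑ i, b i = n := hb.1.1
      omega

/-- The sums of the Green function over the normal forms of length `n` grow linearly. -/
lemma IsStepLaw.exists_tendsto_normalForms_sum {d : ℕ} (hd : 3 ≤ d) {s : Finset (Fin d → ℤ)}
    {m : (Fin d → ℤ) → ℝ} (h : IsStepLaw s m) {N : ℕ} {v : Fin N → Fin d → ℤ}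
    (hv : ∀ x, ∃ b, evalWord v b = x) :
    ∃ C : ℝ, 0 < C ∧ Tendsto (fun n : ℕ =>
      (∑ b ∈ (Finset.univ.piAntidiag n).filter (· ∈ normalForms v),
        latticeGreen s m (evalWord v b)) / n) atTop (nhds C) := by
  obtain ⟨K, hK⟩ := exists_forall_mem_iff_inf_mem (isLowerSet_normalForms v)
  let T : Finset (Fin N → ℕ) :=
    (Fintype.piFinset fun _ => Finset.range (K + 1)).filter (· ∈ normalForms v)
  have hT : ∀ c, c ∈ T ↔ (∀ i, c i ≤ K) ∧ c ∈ normalForms v := by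
    intro c
    simp [T]
  have hex : ∀ c : Fin N → ℕ, ∃ C : ℝ, c ∈ T → 0 ≤ C ∧
      (d ≤ Fintype.card {i // c i = K} → 0 < C) ∧ Tendsto (fun n : ℕ =>
        (∑ b ∈ (Finset.univ.piAntidiag n).filter (fun b => (fun i => min (b i) K) = c),
          latticeGreen s m (evalWord v b)) / n) atTop (nhds C) := by
    intro c
    by_cases hc : c ∈ T
    · obtain ⟨C, hC⟩ := h.exists_tendsto_truncated_sum hd hv hK ((hT c).mp hc).1 ((hT c).mp hc).2
      exact ⟨C, fun _ => hC⟩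
    · exact ⟨0, fun hc' => absurd hc' hc⟩
  choose C hC using hex
  refine ⟨∑ c ∈ T, C c, ?_, ?_⟩
  · obtain ⟨c, hc, hcK, hcd⟩ := exists_le_card_saturated hv hK
    have hcT : c ∈ T := (hT c).mpr ⟨hcK, hc⟩
    exact Finset.sum_pos' (fun c hc => (hC c hc).1) ⟨c, hcT, (hC c hcT).2.1 hcd⟩
  · refine (tendsto_finsetSum T fun c hc => (hC c hc).2.2).congr fun n => ?_
    rw [← Finset.sum_div]
    congr 1
    rw [← Finset.sum_fiberwise_of_maps_to (s := (Finset.univ.piAntidiag n).filter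
      (· ∈ normalForms v)) (t := T) (g := fun b i => min (b i) K)]
    · refine Finset.sum_congr rfl fun c hc => Finset.sum_congr ?_ fun _ _ => rfl
      ext b
      simp only [Finset.mem_filter]
      refine ⟨fun hb => ⟨⟨hb.1, ?_⟩, hb.2⟩, fun hb => ⟨hb.1.1, hb.2⟩⟩
      rw [hK, hb.2]
      exact ((hT c).mp hc).2
    · intro b hb
      rw [hT]
      exact ⟨fun i => min_le_right _ _, (hK b).mp (Finset.mem_filter.mp hb).2⟩

/-! ### Back to the word metric and the random walk on `ℤ^d` -/

lemma mem_pow_iff_exists_evalWord {N : ℕ} {V : Type*} [AddCommGroup V] (v : Fin N → V)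
    {A : Set (Multiplicative V)} (hA : ∀ x, x ∈ A ↔ ∃ i, v i = Multiplicative.toAdd x) (n : ℕ)
    (x : Multiplicative V) :
    x ∈ A ^ n ↔ ∃ b : Fin N → ℕ, ∑ i, b i = n ∧ evalWord v b = Multiplicative.toAdd x := by
  induction n generalizing x with
  | zero =>
    rw [pow_zero, Set.mem_one]
    constructor
    · rintro rfl
      exact ⟨0, by simp, by simp [evalWord]⟩
    · rintro ⟨b, hb, hx⟩
      have h0 : ∀ i, b i = 0 := by simpa using hb
      refine Multiplicative.toAdd.injective (hx.symm.trans ?_)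
      simp [evalWord, h0]
  | succ n ih =>
    rw [pow_succ, Set.mem_mul]
    constructor
    · rintro ⟨y, hy, a, ha, rfl⟩
      obtain ⟨b, hb, hby⟩ := (ih y).mp hy
      obtain ⟨i, hi⟩ := (hA a).mp ha
      refine ⟨b + Pi.single i 1, ?_, ?_⟩
      · simp [Finset.sum_add_distrib, hb]
      · rw [evalWord_add, hby, toAdd_mul, ← hi]
        simp [evalWord, Pi.single_apply, ite_smul]
    · rintro ⟨b, hb, hx⟩
      obtain ⟨i, -, hi⟩ : ∃ i ∈ Finset.univ, b i ≠ 0 :=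
        Finset.exists_ne_zero_of_sum_ne_zero (by omega)
      have hle : Pi.single i 1 ≤ b := by
        intro j
        by_cases hj : j = i
        · subst hj
          simpa using Nat.one_le_iff_ne_zero.mpr hi
        · simp [hj]
      obtain ⟨e, rfl⟩ := exists_add_of_le hle
      refine ⟨Multiplicative.ofAdd (evalWord v e), (ih _).mpr ⟨e, ?_, rfl⟩,
        Multiplicative.ofAdd (v i), (hA _).mpr ⟨i, rfl⟩, ?_⟩
      · simp only [Pi.add_apply, Finset.sum_add_distrib, Finset.sum_pi_single', Finset.mem_univ,
          if_true] at hb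
        omega
      · refine Multiplicative.toAdd.injective ?_
        rw [← hx, evalWord_add, toAdd_mul, add_comm]
        simp [evalWord, Pi.single_apply, ite_smul]

lemma wordLength_evalWord {N : ℕ} {V : Type*} [AddCommGroup V] {v : Fin N → V}
    {S : Finset (Multiplicative V)}
    (hA : ∀ x, x ∈ (S : Set (Multiplicative V)) ∪ (S : Set (Multiplicative V))⁻¹ ↔
      ∃ i, v i = Multiplicative.toAdd x)
    {b : Fin N → ℕ} (hb : b ∈ normalForms v) :
    wordLength S (Multiplicative.ofAdd (evalWord v b)) = ∑ i, b i := by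
  have hmem : ∀ n, n ∈ {n : ℕ | Multiplicative.ofAdd (evalWord v b) ∈
      ((S : Set (Multiplicative V)) ∪ (S : Set (Multiplicative V))⁻¹) ^ n} ↔
      ∃ c : Fin N → ℕ, ∑ i, c i = n ∧ evalWord v c = evalWord v b := fun n =>
    mem_pow_iff_exists_evalWord v hA n _
  refine le_antisymm (Nat.sInf_le ((hmem _).mpr ⟨b, rfl, rfl⟩))
    (le_csInf ⟨_, (hmem _).mpr ⟨b, rfl, rfl⟩⟩ fun n hn => ?_)
  obtain ⟨c, rfl, hc⟩ := (hmem n).mp hn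
  exact sum_le_of_mem_normalForms hb hc

lemma exists_evalWord_eq {N : ℕ} {V : Type*} [AddCommGroup V] {v : Fin N → V}
    {S : Finset (Multiplicative V)}
    (hA : ∀ x, x ∈ (S : Set (Multiplicative V)) ∪ (S : Set (Multiplicative V))⁻¹ ↔
      ∃ i, v i = Multiplicative.toAdd x)
    (hS : Subgroup.closure (S : Set (Multiplicative V)) = ⊤) (x : V) :
    ∃ b, evalWord v b = x := by
  have hx : Multiplicative.ofAdd x ∈ (Subgroup.closure (S : Set (Multiplicative V))).toSubmonoid :=
    hS ▸ Subgroup.mem_top _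
  rw [Subgroup.closure_toSubmonoid] at hx
  have key : ∃ b, evalWord v b = Multiplicative.toAdd (Multiplicative.ofAdd x) := by
    refine Submonoid.closure_induction
      (motive := fun y _ => ∃ b, evalWord v b = Multiplicative.toAdd y) ?_ ?_ ?_ hx
    · intro y hy
      obtain ⟨i, hi⟩ := (hA y).mp hy
      exact ⟨Pi.single i 1, by rw [← hi]; simp [evalWord, Pi.single_apply, ite_smul]⟩
    · exact ⟨0, by simp [evalWord]⟩
    · rintro y z _ _ ⟨b, hb⟩ ⟨c, hc⟩
      exact ⟨b + c, by rw [evalWord_add, hb, hc, toAdd_mul]⟩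
  exact key

/-- The sphere sum of a function is the sum over the normal forms of the given length. -/
lemma tsum_sphere_eq {N : ℕ} {V : Type*} [AddCommGroup V] {v : Fin N → V}
    {S : Finset (Multiplicative V)}
    (hA : ∀ x, x ∈ (S : Set (Multiplicative V)) ∪ (S : Set (Multiplicative V))⁻¹ ↔
      ∃ i, v i = Multiplicative.toAdd x)
    (hv : ∀ x, ∃ b, evalWord v b = x) (f : Multiplicative V → ℝ) (n : ℕ) :
    (∑' x, if wordLength S x = n then f x else 0) =
      ∑ b ∈ (Finset.univ.piAntidiag n).filter (· ∈ normalForms v),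
        f (Multiplicative.ofAdd (evalWord v b)) := by
  have hlen : ∀ b ∈ (Finset.univ.piAntidiag n).filter (· ∈ normalForms v),
      wordLength S (Multiplicative.ofAdd (evalWord v b)) = n := by
    intro b hb
    rw [Finset.mem_filter, Finset.mem_piAntidiag] at hb
    rw [wordLength_evalWord hA hb.2]
    exact hb.1.1
  rw [tsum_eq_sum (s := ((Finset.univ.piAntidiag n).filter (· ∈ normalForms v)).image
    fun b => Multiplicative.ofAdd (evalWord v b)), Finset.sum_image]
  · exact Finset.sum_congr rfl fun b hb => if_pos (hlen b hb)
  · intro b hb c hc hbc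
    exact injOn_evalWord_normalForms v (Finset.mem_filter.mp hb).2 (Finset.mem_filter.mp hc).2
      (Multiplicative.ofAdd.injective hbc)
  · intro x hx
    refine if_neg fun hxn => hx ?_
    obtain ⟨b', hb'⟩ := hv (Multiplicative.toAdd x)
    obtain ⟨b, hb, hbb⟩ := exists_normalForm v b'
    have hbx : Multiplicative.ofAdd (evalWord v b) = x := by
      rw [hbb, hb', ofAdd_toAdd]
    refine Finset.mem_image.mpr ⟨b, ?_, hbx⟩
    rw [Finset.mem_filter, Finset.mem_piAntidiag]
    refine ⟨⟨?_, by simp⟩, hb⟩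
    rw [← hxn, ← hbx, wordLength_evalWord hA hb]

lemma convPow_ofAdd {d : ℕ} {μ : Multiplicative (Fin d → ℤ) → ℝ}
    (hfin : (Function.support μ).Finite) (k : ℕ) (x : Fin d → ℤ) :
    convPow μ k (Multiplicative.ofAdd x) =
      latticeConv (hfin.toFinset.map Multiplicative.toAdd.toEmbedding)
        (fun y => μ (Multiplicative.ofAdd y)) k x := by
  induction k generalizing x with
  | zero => simp [convPow, latticeConv]
  | succ k ih =>
    simp only [convPow, latticeConv]
    rw [tsum_eq_sum (s := hfin.toFinset), Finset.sum_map]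
    · refine Finset.sum_congr rfl fun y _ => ?_
      rw [← ih]
      simp [div_eq_mul_inv, mul_comm]
    · intro y hy
      have : μ y = 0 := by simpa using hy
      rw [this, zero_mul]

lemma isStepLaw_of_isProbMeasure {d : ℕ} {μ : Multiplicative (Fin d → ℤ) → ℝ}
    (hprob : IsProbMeasure μ) (hsymm : IsSymm μ) (hadm : IsAdmissible μ)
    (hfin : (Function.support μ).Finite) :
    IsStepLaw (hfin.toFinset.map Multiplicative.toAdd.toEmbedding)
      (fun y => μ (Multiplicative.ofAdd y)) where
  nonneg y := hprob.1 _
  symm y := hsymm (Multiplicative.ofAdd y)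
  zero_of_notMem y hy := by
    by_contra h
    exact hy (Finset.mem_map.mpr ⟨Multiplicative.ofAdd y, by simpa using h, rfl⟩)
  sum_eq_one := by
    rw [Finset.sum_map]
    refine Eq.trans ?_ hprob.2.tsum_eq
    rw [tsum_eq_sum (s := hfin.toFinset)]
    · rfl
    · intro y hy
      simpa using hy
  generates x := by
    obtain ⟨k, hk⟩ := hadm (Multiplicative.ofAdd x)
    exact ⟨k, by rwa [← convPow_ofAdd]⟩

lemma green_ofAdd {d : ℕ} {μ : Multiplicative (Fin d → ℤ) → ℝ}
    (hfin : (Function.support μ).Finite) (x : Fin d → ℤ) :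
    green μ 1 (Multiplicative.ofAdd x) =
      latticeGreen (hfin.toFinset.map Multiplicative.toAdd.toEmbedding)
        (fun y => μ (Multiplicative.ofAdd y)) x := by
  simp only [green, latticeGreen, one_pow, one_mul, convPow_ofAdd hfin]

/-- Let `d ≥ 3` and let `μ` be a finitely supported symmetric admissible
probability measure on `ℤ^d`.  For any finite generating set `S` there exists `C > 0`
such that `Σ_{x∈S_n} G(e,x) ∼ C n` as `n → ∞`. -/
theorem zd_green_sphere_sum_linear (d : ℕ) (hd : 3 ≤ d)
    (S : Finset (Multiplicative (Fin d → ℤ)))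
    (hS : Subgroup.closure (S : Set (Multiplicative (Fin d → ℤ))) = ⊤)
    (μ : Multiplicative (Fin d → ℤ) → ℝ)
    (hprob : IsProbMeasure μ) (hsymm : IsSymm μ) (hadm : IsAdmissible μ)
    (hfin : (Function.support μ).Finite) :
    ∃ C : ℝ, 0 < C ∧
      Tendsto (fun n : ℕ => greenSphereSum S μ 1 n / n) atTop (nhds C) := by
  let A : Finset (Multiplicative (Fin d → ℤ)) := S ∪ S⁻¹
  let v : Fin A.card → Fin d → ℤ := fun i => Multiplicative.toAdd (A.equivFin.symm i : _)
  have hA : ∀ x, x ∈ (S : Set (Multiplicative (Fin d → ℤ))) ∪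
      (S : Set (Multiplicative (Fin d → ℤ)))⁻¹ ↔ ∃ i, v i = Multiplicative.toAdd x := by
    intro x
    have hxA : x ∈ (S : Set (Multiplicative (Fin d → ℤ))) ∪
        (S : Set (Multiplicative (Fin d → ℤ)))⁻¹ ↔ x ∈ A := by
      simp [A]
    rw [hxA]
    constructor
    · intro hx
      exact ⟨A.equivFin ⟨x, hx⟩, by simp [v]⟩
    · rintro ⟨i, hi⟩
      rw [← Multiplicative.toAdd.injective hi]
      exact (A.equivFin.symm i).2
  have hv := exists_evalWord_eq hA hS
  obtain ⟨C, hC, hlim⟩ :=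
    (isStepLaw_of_isProbMeasure hprob hsymm hadm hfin).exists_tendsto_normalForms_sum hd hv
  refine ⟨C, hC, hlim.congr fun n => ?_⟩
  simp only [greenSphereSum, tsum_sphere_eq hA hv, green_ofAdd hfin]

end GreenGrowth
end
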